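/- Let n ∈ ℕ, let D ⊂ ℝ^d be a bounded Lipschitz domain, and let T be a homogeneous C^{n+1}-smooth Calderón–Zygmund operator. Then the restricted operator T_D is bounded on the classical Zygmund space 𝒵_n(D) = 𝒞_{ω_n}(D) with ω_n(t) = t^n if and only if: (i) for every polynomial P ∈ 𝒫_n one has T_D(P·χ_D) ∈ 𝒵_n(D); and (ii) there exists a constant C such that for every cube Q ⊂ D centered at x₀ and every polynomial P that is homogeneous of degree n with respect to x − x₀ there exists a polynomial S_Q ∈ 𝒫_n with (1/|Q|)∫_Q |T_D(P·χ_D) − S_Q| dx ≤ C·‖P‖_{L^∞(D)}·ℓ(Q)^n / max{1, log(1/ℓ(Q))}. -/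

import Mathlib

open MeasureTheory Filter Set Metric
open scoped ENNReal Topology InnerProductSpace

noncomputable section

/-- The axis-parallel closed cube in `ℝ^d` with center `x₀` and side length `l`. -/
def cube {d : ℕ} (x₀ : EuclideanSpace ℝ (Fin d)) (l : ℝ) : Set (EuclideanSpace ℝ (Fin d)) :=
  {x | ∀ i, |x i - x₀ i| ≤ l / 2}

/-- `𝒫_n`: functions on `ℝ^d` given by polynomials of total degree at most `n`. -/
def PolyLE (d n : ℕ) : Set (EuclideanSpace ℝ (Fin d) → ℝ) :=
  {P | ∃ p : MvPolynomial (Fin d) ℝ, p.totalDegree ≤ n ∧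
    ∀ x, MvPolynomial.eval (fun i => x i) p = P x}

/-- The Campanato-type Zygmund seminorm `‖f‖_{ω,D}` (valued in `ℝ≥0∞`). -/
def zygSeminorm {d : ℕ} (ω : ℝ → ℝ) (n : ℕ) (D : Set (EuclideanSpace ℝ (Fin d)))
    (f : EuclideanSpace ℝ (Fin d) → ℝ) : ℝ≥0∞ :=
  ⨆ (x₀ : EuclideanSpace ℝ (Fin d)) (l : ℝ) (_ : 0 < l) (_ : cube x₀ l ⊆ D),
    ⨅ (P : EuclideanSpace ℝ (Fin d) → ℝ) (_ : P ∈ PolyLE d n),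
      (ENNReal.ofReal (ω l * l ^ d))⁻¹ * ∫⁻ x in cube x₀ l, ENNReal.ofReal |f x - P x|

/-- The `L¹(D)` norm (valued in `ℝ≥0∞`). -/
def l1Norm {d : ℕ} (D : Set (EuclideanSpace ℝ (Fin d)))
    (f : EuclideanSpace ℝ (Fin d) → ℝ) : ℝ≥0∞ :=
  ∫⁻ x in D, ENNReal.ofReal |f x|

/-- The two regularity conditions of order `m` for a modulus of continuity:
`ω(t)/t^q` almost decreasing for some `m ≤ q < m+1`, and `ω(t)/t^r` almost
increasing for some `m-1 < r < m`. -/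
def ModulusConds (ω : ℝ → ℝ) (m : ℕ) : Prop :=
  (∃ q : ℝ, (m : ℝ) ≤ q ∧ q < (m : ℝ) + 1 ∧ ∃ C : ℝ, 0 < C ∧
      ∀ s t : ℝ, 1 < s → 0 < t → ω (s * t) ≤ C * s ^ q * ω t) ∧
  (∃ r : ℝ, (m : ℝ) - 1 < r ∧ r < (m : ℝ) ∧ ∃ C : ℝ, 0 < C ∧
      ∀ s t : ℝ, 0 < s → s < 1 → 0 < t → ω (s * t) ≤ C * s ^ r * ω t)

/-- `ω` is a modulus of continuity of order `n`: continuous, increasing, `ω(0)=0`,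
nonnegative, and `n` is the smallest positive integer satisfying the two
regularity conditions. -/
structure IsModulusOfOrder (ω : ℝ → ℝ) (n : ℕ) : Prop where
  continuousOn : ContinuousOn ω (Set.Ici 0)
  monotoneOn : MonotoneOn ω (Set.Ici 0)
  nonneg : ∀ t, 0 ≤ t → 0 ≤ ω t
  map_zero : ω 0 = 0
  npos : 0 < n
  conds : ModulusConds ω n
  minimal : ∀ m : ℕ, 0 < m → ModulusConds ω m → n ≤ m

/-- `ξ(r) = ∫_r^1 ω(t) t^{-n-1} dt`. -/
def xi (ω : ℝ → ℝ) (n : ℕ) (r : ℝ) : ℝ :=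
  ∫ t in Set.Ioc r 1, ω t / t ^ (n + 1)

/-- The associated modulus of continuity `ω̃(x) = ω(x)/max{1, ξ(x)}`. -/
def omegaTilde (ω : ℝ → ℝ) (n : ℕ) (x : ℝ) : ℝ :=
  ω x / max 1 (xi ω n x)

/-- `D ⊂ ℝ^d` is a bounded Lipschitz domain: it is open, connected, bounded, and near
every boundary point, after a rigid motion, it coincides inside an `R`-window with the
region above the graph of a Lipschitz function (with Lipschitz constant at most `δ`). -/
def IsLipschitzDomain {d : ℕ} (D : Set (EuclideanSpace ℝ (Fin d))) : Prop :=
  IsOpen D ∧ IsConnected D ∧ Bornology.IsBounded D ∧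
  ∃ δ R : ℝ, 0 < δ ∧ 0 < R ∧
    ∀ a ∈ frontier D,
      ∃ (g : EuclideanSpace ℝ (Fin d) ≃ᵢ EuclideanSpace ℝ (Fin d)) (j : Fin d)
        (A : EuclideanSpace ℝ (Fin d) → ℝ),
        g a = 0 ∧
        LipschitzWith (Real.toNNReal δ) A ∧
        (∀ x y : EuclideanSpace ℝ (Fin d), (∀ i, i ≠ j → x i = y i) → A x = A y) ∧
        (g '' D) ∩ cube 0 R = {x ∈ cube (0 : EuclideanSpace ℝ (Fin d)) R | A x < x j}

/-- `Ω` is the density of a `C^k`-smooth homogeneous Calderón–Zygmund kernel: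
homogeneous of degree `0`, `C^k` away from the origin, with zero mean on the
unit sphere. -/
structure IsCZDensity (d : ℕ) (k : ℕ∞) (Ω : EuclideanSpace ℝ (Fin d) → ℝ) : Prop where
  homog : ∀ c : ℝ, 0 < c → ∀ x : EuclideanSpace ℝ (Fin d), Ω (c • x) = Ω x
  smooth : ContDiffOn ℝ k Ω {x : EuclideanSpace ℝ (Fin d) | x ≠ 0}
  meanZero : ∫ x : Metric.sphere (0 : EuclideanSpace ℝ (Fin d)) 1,
      Ω x ∂((volume : Measure (EuclideanSpace ℝ (Fin d))).toSphere) = 0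

/-- `g = T_D f`: `g` vanishes off `D` and, for a.e. `y ∈ D`, `g y` is the principal
value `lim_{ε→0+} ∫_{x ∈ D, |y-x|>ε} f(x) K(y-x) dx` (here `f` is implicitly
multiplied by `χ_D`). -/
def IsRestrictedCZ {d : ℕ} (D : Set (EuclideanSpace ℝ (Fin d)))
    (K : EuclideanSpace ℝ (Fin d) → ℝ) (f g : EuclideanSpace ℝ (Fin d) → ℝ) : Prop :=
  (∀ y, y ∉ D → g y = 0) ∧
  ∀ᵐ y ∂(volume.restrict D),
    Tendsto (fun ε : ℝ => ∫ x in {x ∈ D | ε < dist y x}, f x * K (y - x))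
      (𝓝[>] (0 : ℝ)) (𝓝 (g y))

/-- `P` is a polynomial of near best approximation (with constant `C₀`) for `f`
on the cube with center `x₀` and side length `l`. -/
def IsNearBestApprox {d : ℕ} (ω : ℝ → ℝ) (n : ℕ) (D : Set (EuclideanSpace ℝ (Fin d)))
    (f : EuclideanSpace ℝ (Fin d) → ℝ) (C₀ : ℝ) (x₀ : EuclideanSpace ℝ (Fin d)) (l : ℝ)
    (P : EuclideanSpace ℝ (Fin d) → ℝ) : Prop :=
  P ∈ PolyLE d n ∧
    (ENNReal.ofReal (l ^ d))⁻¹ * ∫⁻ x in cube x₀ l, ENNReal.ofReal |f x - P x| ≤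
      ENNReal.ofReal (C₀ * ω l) * zygSeminorm ω n D f

abbrev Eu (d : ℕ) := EuclideanSpace ℝ (Fin d)

/-! ### Cubes -/

lemma mem_cube {d : ℕ} {x₀ x : Eu d} {l : ℝ} : x ∈ cube x₀ l ↔ ∀ i, |x i - x₀ i| ≤ l / 2 := Iff.rfl

lemma isClosed_cube {d : ℕ} (x₀ : Eu d) (l : ℝ) : IsClosed (cube x₀ l) := by
  have : cube x₀ l = ⋂ i, {x : Eu d | |x i - x₀ i| ≤ l / 2} := by
    ext x; simp [cube]
  rw [this]
  refine isClosed_iInter fun i => isClosed_le (by fun_prop) continuous_const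

lemma measurableSet_cube {d : ℕ} (x₀ : Eu d) (l : ℝ) : MeasurableSet (cube x₀ l) :=
  (isClosed_cube x₀ l).measurableSet

lemma abs_coord_le {d : ℕ} (x : Eu d) (i : Fin d) : |x i| ≤ ‖x‖ := by
  simpa using EuclideanSpace.norm_eq x ▸ PiLp.norm_apply_le x i

lemma norm_le_of_coord {d : ℕ} (x : Eu d) {r : ℝ} (hr : 0 ≤ r) (h : ∀ i, |x i| ≤ r) :
    ‖x‖ ≤ d * r := by
  rw [EuclideanSpace.norm_eq]
  apply Real.sqrt_le_iff.2
  refine ⟨by positivity, ?_⟩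
  calc ∑ i, ‖x i‖ ^ 2 ≤ ∑ i : Fin d, r ^ 2 := by
        refine Finset.sum_le_sum fun i _ => ?_
        have := h i
        rw [Real.norm_eq_abs]
        gcongr
    _ = d * r ^ 2 := by simp
    _ ≤ (d * r) ^ 2 := by
        rw [mul_pow]
        rcases Nat.eq_zero_or_pos d with h0 | h0
        · simp [h0]
        · have : (1 : ℝ) ≤ d := by exact_mod_cast h0
          gcongr
          nlinarith

lemma norm_sub_le_of_mem_cube {d : ℕ} {x₀ x : Eu d} {l : ℝ} (hl : 0 ≤ l) (h : x ∈ cube x₀ l) :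
    ‖x - x₀‖ ≤ d * (l / 2) :=
  norm_le_of_coord _ (by positivity) (fun i => by simpa using h i)

lemma mem_cube_of_norm {d : ℕ} {x₀ x : Eu d} {l : ℝ} (h : ‖x - x₀‖ ≤ l / 2) : x ∈ cube x₀ l :=
  fun i => le_trans (by simpa using abs_coord_le (x - x₀) i) h

lemma cube_subset_cube {d : ℕ} {z z' : Eu d} {s s' : ℝ} (h : ‖z - z'‖ + s / 2 ≤ s' / 2) :
    cube z s ⊆ cube z' s' := by
  intro x hx i
  have h1 := hx i
  have h2 : |z i - z' i| ≤ ‖z - z'‖ := by simpa using abs_coord_le (z - z') i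
  calc |x i - z' i| = |(x i - z i) + (z i - z' i)| := by ring_nf
    _ ≤ |x i - z i| + |z i - z' i| := abs_add_le _ _
    _ ≤ s' / 2 := by linarith

lemma isCompact_cube {d : ℕ} (x₀ : Eu d) (l : ℝ) : IsCompact (cube x₀ l) := by
  rcases le_or_gt 0 l with hl | hl
  · refine (isCompact_closedBall x₀ (d * (l / 2))).of_isClosed_subset (isClosed_cube _ _) ?_
    intro x hx
    rw [mem_closedBall, dist_eq_norm]
    exact norm_sub_le_of_mem_cube hl hx
  · rcases Nat.eq_zero_or_pos d with h0 | h0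
    · subst h0
      exact Set.Subsingleton.isCompact (fun x _ y _ => Subsingleton.elim x y)
    · have : cube x₀ l = ∅ := by
        ext x
        simp only [mem_empty_iff_false, iff_false]
        intro hx
        have := hx ⟨0, h0⟩
        have := abs_nonneg (x ⟨0, h0⟩ - x₀ ⟨0, h0⟩)
        linarith
      rw [this]; exact isCompact_empty

lemma volume_cube {d : ℕ} (x₀ : Eu d) {l : ℝ} (hl : 0 ≤ l) :
    volume (cube x₀ l) = ENNReal.ofReal (l ^ d) := by
  have hs : cube x₀ l = (MeasurableEquiv.toLp 2 (Fin d → ℝ)).symm ⁻¹'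
      (Set.pi univ fun i => Icc (x₀ i - l / 2) (x₀ i + l / 2)) := by
    ext x
    simp only [cube, mem_ofPred_eq, mem_preimage, Set.mem_pi, mem_univ, true_implies, mem_Icc, abs_le]
    refine forall_congr' fun i => ?_
    change _ ↔ x₀ i - l / 2 ≤ x i ∧ x i ≤ x₀ i + l / 2
    constructor <;> rintro ⟨h1, h2⟩ <;> constructor <;> linarith
  rw [hs, (EuclideanSpace.volume_preserving_symm_measurableEquiv_toLp (Fin d)).measure_preimage_equiv,
    volume_pi_pi]
  simp only [Real.volume_Icc]
  have h3 : ∀ i : Fin d, x₀ i + l / 2 - (x₀ i - l / 2) = l := fun i => by ring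
  simp only [h3]
  rw [Finset.prod_const, ← ENNReal.ofReal_pow hl]
  simp

lemma volume_real_cube {d : ℕ} (x₀ : Eu d) {l : ℝ} (hl : 0 ≤ l) :
    volume.real (cube x₀ l) = l ^ d := by
  rw [Measure.real, volume_cube x₀ hl, ENNReal.toReal_ofReal (by positivity)]

open scoped Pointwise in
lemma setIntegral_cube_scale {d : ℕ} (F : Eu d → ℝ) (x₀ : Eu d) {s : ℝ} (hs : 0 < s) :
    ∫ x in cube x₀ s, F (x - x₀) = s ^ d * ∫ w in cube (0 : Eu d) 1, F (s • w) := by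
  have h1 : ∫ x in cube x₀ s, F (x - x₀) = ∫ x in cube (0 : Eu d) s, F x := by
    rw [← integral_indicator (measurableSet_cube _ _), ← integral_indicator (measurableSet_cube _ _)]
    rw [← integral_sub_right_eq_self ((cube (0 : Eu d) s).indicator _) x₀]
    congr 1
    ext x
    by_cases h : x ∈ cube x₀ s
    · rw [indicator_of_mem h, indicator_of_mem]
      intro i; simpa using h i
    · rw [indicator_of_notMem h, indicator_of_notMem]
      intro h'; apply h; intro i; simpa using h' i
  rw [h1, Measure.setIntegral_comp_smul_of_pos _ _ _ hs]
  have h2 : s • cube (0 : Eu d) 1 = cube (0 : Eu d) s := by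
    ext x
    rw [Set.mem_smul_set_iff_inv_smul_mem₀ hs.ne']
    simp only [cube, mem_ofPred_eq]
    refine forall_congr' fun i => ?_
    simp only [PiLp.smul_apply, smul_eq_mul, PiLp.zero_apply, sub_zero, abs_mul, abs_inv, abs_of_pos hs]
    rw [inv_mul_le_iff₀ hs]
    ring_nf
  rw [h2]
  simp only [finrank_euclideanSpace, Fintype.card_fin, smul_eq_mul]
  field_simp

/-! ### Polynomials -/

/-- polynomial as a function -/
def pv {d : ℕ} (p : MvPolynomial (Fin d) ℝ) (w : Eu d) : ℝ := MvPolynomial.eval (fun i => w i) p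

lemma continuous_pv {d : ℕ} (p : MvPolynomial (Fin d) ℝ) : Continuous (pv p) := by
  unfold pv
  exact (MvPolynomial.continuous_eval p).comp (by fun_prop)

lemma pv_mem {d n : ℕ} {p : MvPolynomial (Fin d) ℝ} (hp : p.totalDegree ≤ n) : pv p ∈ PolyLE d n :=
  ⟨p, hp, fun _ => rfl⟩

lemma polyLE_exists {d n : ℕ} {P : Eu d → ℝ} (hP : P ∈ PolyLE d n) :
    ∃ p : MvPolynomial (Fin d) ℝ, p.totalDegree ≤ n ∧ P = pv p := by
  obtain ⟨p, h1, h2⟩ := hP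
  exact ⟨p, h1, funext fun x => (h2 x).symm⟩

lemma polyLE_continuous {d n : ℕ} {P : Eu d → ℝ} (hP : P ∈ PolyLE d n) : Continuous P := by
  obtain ⟨p, _, rfl⟩ := polyLE_exists hP
  exact continuous_pv p

lemma polyLE_add {d n : ℕ} {P Q : Eu d → ℝ} (hP : P ∈ PolyLE d n) (hQ : Q ∈ PolyLE d n) :
    (fun x => P x + Q x) ∈ PolyLE d n := by
  obtain ⟨p, hp, rfl⟩ := polyLE_exists hP
  obtain ⟨q, hq, rfl⟩ := polyLE_exists hQ
  exact ⟨p + q, (MvPolynomial.totalDegree_add p q).trans (max_le hp hq), fun x => by simp [pv]⟩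

lemma polyLE_smul {d n : ℕ} {P : Eu d → ℝ} (c : ℝ) (hP : P ∈ PolyLE d n) :
    (fun x => c * P x) ∈ PolyLE d n := by
  obtain ⟨p, hp, rfl⟩ := polyLE_exists hP
  exact ⟨c • p, (MvPolynomial.totalDegree_smul_le c p).trans hp, fun x => by simp [pv]⟩

lemma polyLE_sub {d n : ℕ} {P Q : Eu d → ℝ} (hP : P ∈ PolyLE d n) (hQ : Q ∈ PolyLE d n) :
    (fun x => P x - Q x) ∈ PolyLE d n := by
  have := polyLE_add hP (polyLE_smul (-1) hQ)
  simpa [sub_eq_add_neg] using this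

lemma polyLE_const {d n : ℕ} (c : ℝ) : (fun _ : Eu d => c) ∈ PolyLE d n :=
  ⟨MvPolynomial.C c, by simp, fun x => by simp⟩

lemma polyLE_sum {d n : ℕ} {ι : Type*} (s : Finset ι) (F : ι → Eu d → ℝ)
    (h : ∀ i ∈ s, F i ∈ PolyLE d n) : (fun x => ∑ i ∈ s, F i x) ∈ PolyLE d n := by
  classical
  induction s using Finset.induction_on with
  | empty => simpa using polyLE_const (d := d) (n := n) 0
  | insert a s ha ih =>
    simp only [Finset.sum_insert ha]
    exact polyLE_add (h a (by simp)) (ih fun i hi => h i (by simp [hi]))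

lemma totalDegree_bind_le {d n : ℕ} (p : MvPolynomial (Fin d) ℝ) (hp : p.totalDegree ≤ n)
    (L : Fin d → MvPolynomial (Fin d) ℝ) (hL : ∀ i, (L i).totalDegree ≤ 1) :
    (MvPolynomial.bind₁ L p).totalDegree ≤ n := by
  classical
  rw [MvPolynomial.bind₁, MvPolynomial.aeval_def, MvPolynomial.eval₂_eq']
  refine (MvPolynomial.totalDegree_finsetSum _ _).trans (Finset.sup_le fun α hα => ?_)
  refine (MvPolynomial.totalDegree_mul _ _).trans ?_
  rw [MvPolynomial.algebraMap_eq, MvPolynomial.totalDegree_C, zero_add]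
  refine (MvPolynomial.totalDegree_finsetProd _ _).trans ?_
  calc ∑ i, (L i ^ α i).totalDegree ≤ ∑ i, α i := by
        refine Finset.sum_le_sum fun i _ => (MvPolynomial.totalDegree_pow _ _).trans ?_
        have := Nat.mul_le_mul_left (α i) (hL i)
        simpa using this
    _ = α.sum fun _ e => e := by rw [Finsupp.sum_fintype]; simp
    _ ≤ p.totalDegree := MvPolynomial.le_totalDegree hα
    _ ≤ n := hp

lemma polyLE_affine {d n : ℕ} {P : Eu d → ℝ} (hP : P ∈ PolyLE d n) (a : Eu d) (s : ℝ) :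
    (fun y => P (a + s • y)) ∈ PolyLE d n := by
  obtain ⟨p, hp, rfl⟩ := polyLE_exists hP
  refine ⟨MvPolynomial.bind₁ (fun i => MvPolynomial.C (a i) + MvPolynomial.C s * MvPolynomial.X i) p,
    totalDegree_bind_le p hp _ ?_, ?_⟩
  · intro i
    refine (MvPolynomial.totalDegree_add _ _).trans (max_le (by simp) ?_)
    refine (MvPolynomial.totalDegree_mul _ _).trans (by simp)
  · intro x
    unfold pv
    rw [← MvPolynomial.aeval_eq_eval, MvPolynomial.aeval_bind₁]
    beta_reduce
    rw [← MvPolynomial.aeval_eq_eval]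
    congr 2
    ext i
    simp

/-- expansion around a point -/
lemma polyLE_center {d n : ℕ} {P : Eu d → ℝ} (hP : P ∈ PolyLE d n) (x₀ : Eu d) :
    ∃ p : MvPolynomial (Fin d) ℝ, p.totalDegree ≤ n ∧ ∀ x, P x = pv p (x - x₀) := by
  obtain ⟨p, hp, h⟩ := polyLE_exists (polyLE_affine hP x₀ 1)
  refine ⟨p, hp, fun x => ?_⟩
  rw [← h]; simp

lemma pv_center_mem {d n : ℕ} {p : MvPolynomial (Fin d) ℝ} (hp : p.totalDegree ≤ n) (x₀ : Eu d) :
    (fun x => pv p (x - x₀)) ∈ PolyLE d n := by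
  have := polyLE_affine (pv_mem hp) (-x₀) 1
  simpa [sub_eq_neg_add] using this

abbrev hc {d : ℕ} (j : ℕ) (p : MvPolynomial (Fin d) ℝ) := MvPolynomial.homogeneousComponent j p

lemma sum_hc {d n : ℕ} {p : MvPolynomial (Fin d) ℝ} (hp : p.totalDegree ≤ n) :
    ∑ j ∈ Finset.range (n + 1), hc j p = p := by
  conv_rhs => rw [← MvPolynomial.sum_homogeneousComponent p]
  symm
  apply Finset.sum_subset
  · intro j; simp; omega
  · intro j _ hj
    apply MvPolynomial.homogeneousComponent_eq_zero
    simp at hj; omega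

lemma pv_sum {d : ℕ} {ι : Type*} (s : Finset ι) (F : ι → MvPolynomial (Fin d) ℝ) (w : Eu d) :
    pv (∑ i ∈ s, F i) w = ∑ i ∈ s, pv (F i) w := by
  simp [pv, map_sum]

lemma pv_eq_sum_hc {d n : ℕ} {p : MvPolynomial (Fin d) ℝ} (hp : p.totalDegree ≤ n) (w : Eu d) :
    pv p w = ∑ j ∈ Finset.range (n + 1), pv (hc j p) w := by
  rw [← pv_sum, sum_hc hp]

lemma pv_homog {d j : ℕ} {p : MvPolynomial (Fin d) ℝ} (hp : p.IsHomogeneous j) (s : ℝ) (w : Eu d) :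
    pv p (s • w) = s ^ j * pv p w := by
  simp only [pv, MvPolynomial.eval_eq']
  rw [Finset.mul_sum]
  refine Finset.sum_congr rfl fun α hα => ?_
  have h1 : ∑ i, α i = j := by
    have := hp (MvPolynomial.mem_support_iff.1 hα)
    rw [← this]
    simp [Finsupp.weight_apply, Finsupp.sum_fintype]
  simp only [PiLp.smul_apply, smul_eq_mul, mul_pow, Finset.prod_mul_distrib]
  rw [Finset.prod_pow_eq_pow_sum, h1]
  ring

lemma hc_degree {d n j : ℕ} {p : MvPolynomial (Fin d) ℝ} (hj : j ≤ n) : (hc j p).totalDegree ≤ n :=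
  (MvPolynomial.homogeneousComponent_isHomogeneous j p).totalDegree_le.trans hj

/-- index set of multi-indices bounded by `n` in each coordinate -/
abbrev MI (d n : ℕ) := Fin d → Fin (n + 1)

def miF {d n : ℕ} (a : MI d n) : Fin d →₀ ℕ := Finsupp.equivFunOnFinite.symm fun i => (a i : ℕ)

lemma miF_apply {d n : ℕ} (a : MI d n) (i : Fin d) : miF a i = a i := rfl

lemma miF_inj {d n : ℕ} : Function.Injective (miF (d := d) (n := n)) := by
  intro a b h
  funext i
  have := DFunLike.congr_fun h i
  rw [miF_apply, miF_apply] at this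
  exact Fin.ext this

lemma exists_miF {d n : ℕ} {α : Fin d →₀ ℕ} (h : α.degree ≤ n) : ∃ a : MI d n, miF a = α := by
  refine ⟨fun i => ⟨α i, ?_⟩, ?_⟩
  · have := Finsupp.le_degree i α
    omega
  · ext i; rfl

def toPoly {d n : ℕ} (c : MI d n → ℝ) : MvPolynomial (Fin d) ℝ :=
  ∑ a, MvPolynomial.monomial (miF a) (c a)

lemma coeff_toPoly {d n : ℕ} (c : MI d n → ℝ) (a : MI d n) : (toPoly c).coeff (miF a) = c a := by
  classical
  simp only [toPoly, MvPolynomial.coeff_sum, MvPolynomial.coeff_monomial, miF_inj.eq_iff]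
  simp

lemma toPoly_coeff {d n : ℕ} {p : MvPolynomial (Fin d) ℝ} (hp : p.totalDegree ≤ n) :
    toPoly (fun a : MI d n => p.coeff (miF a)) = p := by
  classical
  ext α
  by_cases h : α.degree ≤ n
  · obtain ⟨a, rfl⟩ := exists_miF h
    rw [coeff_toPoly]
  · have h1 : p.coeff α = 0 := by
      apply MvPolynomial.coeff_eq_zero_of_totalDegree_lt
      rw [← Finsupp.degree_apply]
      omega
    rw [h1, toPoly, MvPolynomial.coeff_sum]
    refine Finset.sum_eq_zero fun a _ => ?_
    rw [MvPolynomial.coeff_monomial]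
    split_ifs with h2
    · rw [h2, h1]
    · rfl

lemma pv_toPoly {d n : ℕ} (c : MI d n → ℝ) (w : Eu d) :
    pv (toPoly c) w = ∑ a, c a * ∏ i, w i ^ (a i : ℕ) := by
  rw [toPoly, pv_sum]
  refine Finset.sum_congr rfl fun a _ => ?_
  unfold pv
  rw [MvPolynomial.eval_monomial, Finsupp.prod_fintype _ _ (by simp)]
  simp [miF_apply]

lemma pv_integrable {d : ℕ} (p : MvPolynomial (Fin d) ℝ) (z : Eu d) (s : ℝ) :
    Integrable (pv p) (volume.restrict (cube z s)) :=
  (continuous_pv p).continuousOn.integrableOn_compact (isCompact_cube z s)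

def polyL1 (d n : ℕ) : (MI d n → ℝ) →ₗ[ℝ] (Eu d →₁[volume.restrict (cube (0 : Eu d) 1)] ℝ) where
  toFun c := (pv_integrable (toPoly c) 0 1).toL1 _
  map_add' c c' := by
    rw [← Integrable.toL1_add]
    congr 1
    funext w
    simp only [pv_toPoly, Pi.add_apply, add_mul, Finset.sum_add_distrib]
  map_smul' r c := by
    simp only [RingHom.id_apply]
    rw [← Integrable.toL1_smul]
    congr 1
    funext w
    simp only [pv_toPoly, Pi.smul_apply, smul_eq_mul, mul_assoc, Finset.mul_sum]

lemma polyL1_ker (d n : ℕ) : LinearMap.ker (polyL1 d n) = ⊥ := by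
  rw [LinearMap.ker_eq_bot']
  intro c hc0
  have h1 : pv (toPoly c) =ᵐ[volume.restrict (cube (0 : Eu d) 1)] (fun _ => (0 : ℝ)) := by
    have h2 : (pv_integrable (toPoly c) 0 1).toL1 _ = (integrable_zero _ _ _).toL1 _ := by
      rw [Integrable.toL1_zero]; exact hc0
    exact (Integrable.toL1_eq_toL1_iff _ _ _ _).1 h2
  have hU : IsOpen {x : Eu d | ∀ i, |x i| < 1 / 2} := by
    have : {x : Eu d | ∀ i, |x i| < 1 / 2} = ⋂ i, {x : Eu d | |x i| < 1 / 2} := by ext x; simp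
    rw [this]
    exact isOpen_iInter_of_finite fun i => isOpen_lt (by fun_prop) continuous_const
  have hsub : {x : Eu d | ∀ i, |x i| < 1 / 2} ⊆ cube (0 : Eu d) 1 := by
    intro x hx i
    simpa using (hx i).le
  have h3 := Measure.eqOn_open_of_ae_eq (ae_restrict_of_ae_restrict_of_subset hsub h1) hU
    (continuous_pv _).continuousOn continuousOn_const
  have h4 : toPoly c = 0 := by
    apply MvPolynomial.funext_set (fun _ => Ioo (-1 / 2 : ℝ) (1 / 2))
      (fun _ => Set.Ioo_infinite (by norm_num))
    intro x hx
    have := h3 (x := WithLp.toLp 2 x) (fun i => by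
      have := hx i (mem_univ i)
      simp only [mem_Ioo] at this
      rw [abs_lt]; constructor <;> [skip; skip] <;> simp <;> linarith)
    simpa [pv] using this
  funext a
  rw [← coeff_toPoly c a, h4]; simp

lemma coeff_bound (d n : ℕ) : ∃ C : ℝ, 0 < C ∧ ∀ p : MvPolynomial (Fin d) ℝ, p.totalDegree ≤ n →
    ∀ a : MI d n, |p.coeff (miF a)| ≤ C * ∫ w in cube (0 : Eu d) 1, |pv p w| := by
  obtain ⟨K, hK, h⟩ := LinearMap.exists_antilipschitzWith (polyL1 d n) (polyL1_ker d n)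
  refine ⟨K, hK, fun p hp a => ?_⟩
  have h1 := h.le_mul_dist (fun a : MI d n => p.coeff (miF a)) 0
  rw [map_zero, dist_zero_right, dist_zero_right] at h1
  have h2 : ‖polyL1 d n (fun a : MI d n => p.coeff (miF a))‖ = ∫ w in cube (0 : Eu d) 1, |pv p w| := by
    rw [L1.norm_eq_integral_norm]
    apply integral_congr_ae
    have h3 := Integrable.coeFn_toL1 (pv_integrable (toPoly (fun a : MI d n => p.coeff (miF a))) 0 1)
    rw [toPoly_coeff hp] at h3
    have h4 : polyL1 d n (fun a : MI d n => p.coeff (miF a)) = (pv_integrable p 0 1).toL1 _ := by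
      simp only [polyL1, LinearMap.coe_mk, AddHom.coe_mk]
      congr 1
      rw [toPoly_coeff hp]
    rw [h4]
    filter_upwards [h3] with w hw
    rw [hw, Real.norm_eq_abs]
  rw [h2] at h1
  exact le_trans (norm_le_pi_norm (fun a : MI d n => p.coeff (miF a)) a) h1

/-- bound of an individual homogeneous component by coefficients -/
lemma abs_pv_hc_le {d n : ℕ} {p : MvPolynomial (Fin d) ℝ} (hp : p.totalDegree ≤ n) (j : ℕ) (w : Eu d)
    {B : ℝ} (hB0 : 0 ≤ B) (hB : ∀ a : MI d n, (miF a).degree = j → |p.coeff (miF a)| ≤ B) :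
    |pv (hc j p) w| ≤ Fintype.card (MI d n) * B * ‖w‖ ^ j := by
  classical
  have hd : (hc j p).totalDegree ≤ n := by
    by_cases hjn : j ≤ n
    · exact hc_degree hjn
    · rw [hc, MvPolynomial.homogeneousComponent_eq_zero _ _ (by omega)]; simp
  rw [← toPoly_coeff hd, pv_toPoly]
  refine (Finset.abs_sum_le_sum_abs _ _).trans ?_
  have : ∀ a ∈ (Finset.univ : Finset (MI d n)),
      |(hc j p).coeff (miF a) * ∏ i, w i ^ (a i : ℕ)| ≤ B * ‖w‖ ^ j := by
    intro a _
    rw [hc, MvPolynomial.coeff_homogeneousComponent]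
    split_ifs with h
    · rw [abs_mul]
      refine mul_le_mul (hB a h) ?_ (abs_nonneg _) hB0
      rw [Finset.abs_prod]
      have h2 : ∑ i, (a i : ℕ) = j := by
        rw [← h, Finsupp.degree_eq_sum]; rfl
      rw [← h2, ← Finset.prod_pow_eq_pow_sum]
      refine Finset.prod_le_prod (fun i _ => abs_nonneg _) fun i _ => ?_
      rw [abs_pow]
      exact pow_le_pow_left₀ (abs_nonneg _) (abs_coord_le w i) _
    · simp; positivity
  refine (Finset.sum_le_sum this).trans ?_
  rw [Finset.sum_const, nsmul_eq_mul, Finset.card_univ, mul_assoc]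

/-- Main estimate: homogeneous components are controlled by the `L¹` average on a cube. -/
lemma poly_main (d n : ℕ) : ∃ C : ℝ, 0 < C ∧ ∀ (x₀ : Eu d) (s : ℝ), 0 < s →
    ∀ p : MvPolynomial (Fin d) ℝ, p.totalDegree ≤ n → ∀ (j : ℕ) (w : Eu d),
    |pv (hc j p) w| ≤ C * (‖w‖ / s) ^ j * ((s ^ d)⁻¹ * ∫ x in cube x₀ s, |pv p (x - x₀)|) := by
  obtain ⟨C, hC, h⟩ := coeff_bound d n
  refine ⟨Fintype.card (MI d n) * C, by positivity, fun x₀ s hs p hp j w => ?_⟩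
  set p' : MvPolynomial (Fin d) ℝ := ∑ i ∈ Finset.range (n + 1), MvPolynomial.C (s ^ i) * hc i p with hp'
  have hdeg : p'.totalDegree ≤ n := by
    refine (MvPolynomial.totalDegree_finsetSum _ _).trans (Finset.sup_le fun i hi => ?_)
    refine (MvPolynomial.totalDegree_mul _ _).trans ?_
    rw [MvPolynomial.totalDegree_C, zero_add]
    exact hc_degree (by simp at hi; omega)
  have hpv : ∀ w, pv p' w = pv p (s • w) := by
    intro w
    rw [pv_eq_sum_hc hp, hp', pv_sum]
    refine Finset.sum_congr rfl fun i _ => ?_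
    rw [pv_homog (MvPolynomial.homogeneousComponent_isHomogeneous i p)]
    simp [pv]
  have hcoef : ∀ a : MI d n, (miF a).degree = j → p'.coeff (miF a) = s ^ j * p.coeff (miF a) := by
    intro a ha
    simp only [hp', MvPolynomial.coeff_sum, MvPolynomial.coeff_C_mul, hc,
      MvPolynomial.coeff_homogeneousComponent, ha]
    by_cases hj : j ≤ n
    · rw [Finset.sum_eq_single j]
      · simp
      · intro b _ hb; simp [hb.symm]
      · intro hb; simp at hb; omega
    · have : p.coeff (miF a) = 0 := by
        apply MvPolynomial.coeff_eq_zero_of_totalDegree_lt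
        rw [← Finsupp.degree_apply, ha]; omega
      simp [this]
  have hI : (s ^ d)⁻¹ * ∫ x in cube x₀ s, |pv p (x - x₀)| = ∫ w in cube (0 : Eu d) 1, |pv p' w| := by
    rw [setIntegral_cube_scale (fun w => |pv p w|) x₀ hs, ← mul_assoc, inv_mul_cancel₀ (by positivity),
      one_mul]
    simp only [hpv]
  rw [hI]
  set I := ∫ w in cube (0 : Eu d) 1, |pv p' w| with hIdef
  have hI0 : 0 ≤ I := integral_nonneg fun _ => abs_nonneg _
  have := abs_pv_hc_le hp j w (B := C * I / s ^ j) (by positivity) (by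
    intro a ha
    have h1 := h p' hdeg a
    rw [hcoef a ha, abs_mul, abs_of_pos (by positivity : 0 < s ^ j)] at h1
    rw [le_div_iff₀ (by positivity)]
    linarith)
  refine this.trans (le_of_eq ?_)
  rw [div_pow]
  field_simp

/-- `L¹` average over a cube -/
def av {d : ℕ} (z : Eu d) (s : ℝ) (F : Eu d → ℝ) : ℝ := (s ^ d)⁻¹ * ∫ x in cube z s, |F x|

lemma av_nonneg {d : ℕ} (z : Eu d) {s : ℝ} (hs : 0 < s) (F : Eu d → ℝ) : 0 ≤ av z s F :=
  mul_nonneg (by positivity) (integral_nonneg fun _ => abs_nonneg _)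

lemma av_le_of_bound {d : ℕ} {z : Eu d} {s B : ℝ} (hs : 0 < s) {F : Eu d → ℝ}
    (hF : ∀ x ∈ cube z s, |F x| ≤ B) : av z s F ≤ B := by
  have h1 : ‖∫ x in cube z s, |F x|‖ ≤ B * volume.real (cube z s) := by
    apply norm_setIntegral_le_of_norm_le_const
    · rw [volume_cube z hs.le]; exact ENNReal.ofReal_lt_top
    · intro x hx; simpa using hF x hx
  rw [volume_real_cube z hs.le] at h1
  have h2 := le_trans (le_abs_self _) h1
  unfold av
  rw [inv_mul_le_iff₀ (by positivity)]
  linarith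

lemma polyLE_intOn {d n : ℕ} {P : Eu d → ℝ} (hP : P ∈ PolyLE d n) (z : Eu d) (s : ℝ) :
    IntegrableOn P (cube z s) :=
  (polyLE_continuous hP).continuousOn.integrableOn_compact (isCompact_cube z s)

lemma poly_point (d n : ℕ) : ∃ C : ℝ, 0 < C ∧ ∀ P ∈ PolyLE d n, ∀ (z : Eu d) (s : ℝ), 0 < s →
    ∀ y, |P y| ≤ C * (1 + ‖y - z‖ / s) ^ n * av z s P := by
  obtain ⟨C, hC, h⟩ := poly_main d n
  refine ⟨(n + 1) * C, by positivity, fun P hP z s hs y => ?_⟩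
  obtain ⟨p, hp, hPp⟩ := polyLE_center hP z
  have hav : av z s P = (s ^ d)⁻¹ * ∫ x in cube z s, |pv p (x - z)| := by simp only [av, hPp]
  have h0 := av_nonneg z hs P
  rw [hPp, pv_eq_sum_hc hp]
  refine (Finset.abs_sum_le_sum_abs _ _).trans ?_
  have : ∀ j ∈ Finset.range (n + 1), |pv (hc j p) (y - z)| ≤ C * (1 + ‖y - z‖ / s) ^ n * av z s P := by
    intro j hj
    refine (h z s hs p hp j (y - z)).trans ?_
    rw [← hav]
    gcongr
    have hq : 0 ≤ ‖y - z‖ / s := by positivity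
    calc (‖y - z‖ / s) ^ j ≤ (1 + ‖y - z‖ / s) ^ j := by gcongr; linarith
      _ ≤ (1 + ‖y - z‖ / s) ^ n := pow_le_pow_right₀ (by linarith) (by simp at hj; omega)
  refine (Finset.sum_le_sum this).trans (le_of_eq ?_)
  simp; ring

lemma poly_hc (d n : ℕ) (A : ℝ) (hA : 0 ≤ A) : ∃ C : ℝ, 0 < C ∧ ∀ (x₀ z : Eu d) (s : ℝ), 0 < s →
    ‖z - x₀‖ ≤ A * s → ∀ p : MvPolynomial (Fin d) ℝ, p.totalDegree ≤ n → ∀ (j : ℕ) (w : Eu d),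
    |pv (hc j p) w| ≤ C * (‖w‖ / s) ^ j * av z s (fun x => pv p (x - x₀)) := by
  obtain ⟨C, hC, h⟩ := poly_main d n
  obtain ⟨C₁, hC₁, h₁⟩ := poly_point d n
  refine ⟨C * (C₁ * (1 + (d / 2 + A)) ^ n), by positivity, fun x₀ z s hs hz p hp j w => ?_⟩
  have h0 := av_nonneg z hs (fun x => pv p (x - x₀))
  have h2 : (s ^ d)⁻¹ * ∫ x in cube x₀ s, |pv p (x - x₀)| ≤
      C₁ * (1 + (d / 2 + A)) ^ n * av z s (fun x => pv p (x - x₀)) := by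
    apply av_le_of_bound hs (F := fun x => pv p (x - x₀))
    intro x hx
    refine (h₁ _ (pv_center_mem hp x₀) z s hs x).trans ?_
    gcongr
    rw [div_le_iff₀ hs]
    have h3 := norm_sub_le_of_mem_cube hs.le hx
    calc ‖x - z‖ ≤ ‖x - x₀‖ + ‖x₀ - z‖ := norm_sub_le_norm_sub_add_norm_sub _ _ _
      _ ≤ (d / 2 + A) * s := by rw [norm_sub_rev x₀ z]; linarith
  refine (h x₀ s hs p hp j w).trans ?_
  calc _ ≤ C * (‖w‖ / s) ^ j * (C₁ * (1 + (d / 2 + A)) ^ n * av z s (fun x => pv p (x - x₀))) := by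
        gcongr
    _ = _ := by ring

lemma poly_lip (d n : ℕ) (A : ℝ) (hA : 0 ≤ A) : ∃ C : ℝ, 0 < C ∧ ∀ P ∈ PolyLE d n,
    ∀ (z x y : Eu d) (s : ℝ), 0 < s →
    ‖x - z‖ ≤ A * s → ‖y - z‖ ≤ A * s → |P x - P y| ≤ C * (‖x - y‖ / s) * av z s P := by
  obtain ⟨C, hC, h⟩ := poly_hc d n A hA
  refine ⟨n * (C * (1 + 2 * A) ^ n) + 1, by positivity, fun P hP z x y s hs hx hy => ?_⟩
  obtain ⟨p, hp, hPp⟩ := polyLE_center hP y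
  have h0 := av_nonneg z hs P
  have h1 : P x - P y = ∑ j ∈ Finset.range n, pv (hc (j + 1) p) (x - y) := by
    rw [hPp x, hPp y, pv_eq_sum_hc hp, pv_eq_sum_hc hp, Finset.sum_range_succ', Finset.sum_range_succ']
    have h2 : ∀ j, pv (hc (j + 1) p) (y - y) = 0 := by
      intro j
      have := pv_homog (MvPolynomial.homogeneousComponent_isHomogeneous (j + 1) p) 0 0
      simpa using this
    have h3 : ∀ w : Eu d, pv (hc 0 p) w = p.coeff 0 := by
      intro w
      rw [hc, MvPolynomial.homogeneousComponent_zero]; simp [pv]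
    simp only [h2, h3, Finset.sum_const_zero]
    ring
  rw [h1]
  refine (Finset.abs_sum_le_sum_abs _ _).trans ?_
  have hav : av z s P = av z s (fun x => pv p (x - y)) := by simp only [av, hPp]
  have hxy : ‖x - y‖ / s ≤ 2 * A := by
    rw [div_le_iff₀ hs]
    calc ‖x - y‖ ≤ ‖x - z‖ + ‖z - y‖ := norm_sub_le_norm_sub_add_norm_sub _ _ _
      _ ≤ _ := by rw [norm_sub_rev z y]; linarith
  have h3 : ∀ j ∈ Finset.range n, |pv (hc (j + 1) p) (x - y)| ≤
      C * (1 + 2 * A) ^ n * (‖x - y‖ / s) * av z s P := by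
    intro j hj
    refine (h y z s hs (by rw [norm_sub_rev]; exact hy) p hp (j + 1) (x - y)).trans ?_
    rw [← hav, pow_succ]
    have : (‖x - y‖ / s) ^ j ≤ (1 + 2 * A) ^ n := by
      calc (‖x - y‖ / s) ^ j ≤ (1 + 2 * A) ^ j := by gcongr; linarith
        _ ≤ _ := pow_le_pow_right₀ (by linarith) (by simp at hj; omega)
    rw [← mul_assoc]
    have hq : 0 ≤ ‖x - y‖ / s := by positivity
    exact mul_le_mul_of_nonneg_right (mul_le_mul_of_nonneg_right
      (mul_le_mul_of_nonneg_left this hC.le) hq) h0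
  refine (Finset.sum_le_sum h3).trans ?_
  rw [Finset.sum_const, Finset.card_range, nsmul_eq_mul, add_mul, add_mul]
  have : 0 ≤ 1 * (‖x - y‖ / s) * av z s P := by positivity
  linarith [mul_assoc (n : ℝ) (C * (1 + 2 * A) ^ n * (‖x - y‖ / s)) (av z s P),
    mul_assoc (n : ℝ) (C * (1 + 2 * A) ^ n) (‖x - y‖ / s)]

/-! ### Near best approximation -/

/-- `P` approximates `f` on a cube with error `N s^n` -/
def NearB {d : ℕ} (n : ℕ) (f : Eu d → ℝ) (N : ℝ) (P : Eu d → ℝ) (z : Eu d) (s : ℝ) : Prop :=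
  P ∈ PolyLE d n ∧ av z s (fun x => f x - P x) ≤ N * s ^ n

structure Camp {d : ℕ} (n : ℕ) (D : Set (Eu d)) (f : Eu d → ℝ) (N : ℝ) : Prop where
  nonneg : 0 ≤ N
  integ : ∀ z s, 0 < s → cube z s ⊆ D → IntegrableOn f (cube z s)
  near : ∀ z s, 0 < s → cube z s ⊆ D → ∃ P, NearB n f N P z s

lemma av_mono_cube {d : ℕ} {z z' : Eu d} {s s' A : ℝ} (hs : 0 < s) (hs' : s' ≤ A * s) (hs'0 : 0 < s')
    (hsub : cube z s ⊆ cube z' s') {F : Eu d → ℝ} (hF : IntegrableOn F (cube z' s')) :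
    av z s F ≤ A ^ d * av z' s' F := by
  unfold av
  have h1 : ∫ x in cube z s, |F x| ≤ ∫ x in cube z' s', |F x| :=
    setIntegral_mono_set hF.abs (ae_of_all _ fun _ => abs_nonneg _) hsub.eventuallyLE
  have h2 : 0 ≤ ∫ x in cube z s, |F x| := integral_nonneg fun _ => abs_nonneg _
  rw [← mul_assoc]
  refine mul_le_mul ?_ h1 h2 ?_
  · rw [inv_le_iff_one_le_mul₀ (by positivity)]
    rw [mul_comm (A ^ d), mul_assoc, ← mul_pow, ← div_eq_inv_mul, one_le_div (by positivity)]
    exact pow_le_pow_left₀ hs'0.le hs' _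
  · have : 0 < A := by
      by_contra h
      push Not at h
      nlinarith
    positivity

lemma av_add_le {d : ℕ} {z : Eu d} {s : ℝ} (hs : 0 < s) {F G H : Eu d → ℝ}
    (hF : IntegrableOn F (cube z s)) (hG : IntegrableOn G (cube z s))
    (h : ∀ x ∈ cube z s, |H x| ≤ |F x| + |G x|) : av z s H ≤ av z s F + av z s G := by
  unfold av
  rw [← mul_add, ← integral_add hF.abs hG.abs]
  refine mul_le_mul_of_nonneg_left ?_ (by positivity)
  by_cases hH : IntegrableOn H (cube z s)
  · refine setIntegral_mono_on hH.abs (hF.abs.add hG.abs) (measurableSet_cube _ _) h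
  · by_cases hH2 : IntegrableOn (fun x => |H x|) (cube z s)
    · refine setIntegral_mono_on hH2 (hF.abs.add hG.abs) (measurableSet_cube _ _) h
    · rw [integral_undef hH2]
      exact integral_nonneg fun x => by positivity

lemma compare {d n : ℕ} {f : Eu d → ℝ} {N : ℝ} {P₁ P₂ : Eu d → ℝ} {z z₁ z₂ : Eu d}
    {s s₁ s₂ A : ℝ} (hN : 0 ≤ N) (hs : 0 < s) (hs₁ : 0 < s₁) (hs₂ : 0 < s₂)
    (h₁ : NearB n f N P₁ z₁ s₁) (h₂ : NearB n f N P₂ z₂ s₂) (hA₁ : s₁ ≤ A * s) (hA₂ : s₂ ≤ A * s)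
    (hsub₁ : cube z s ⊆ cube z₁ s₁) (hsub₂ : cube z s ⊆ cube z₂ s₂)
    (hf₁ : IntegrableOn f (cube z₁ s₁)) (hf₂ : IntegrableOn f (cube z₂ s₂)) :
    av z s (fun x => P₁ x - P₂ x) ≤ 2 * A ^ (n + d) * N * s ^ n := by
  have hA : 0 < A := by
    by_contra h
    push Not at h
    nlinarith
  have i1 : IntegrableOn (fun x => f x - P₁ x) (cube z₁ s₁) := hf₁.sub (polyLE_intOn h₁.1 _ _)
  have i2 : IntegrableOn (fun x => f x - P₂ x) (cube z₂ s₂) := hf₂.sub (polyLE_intOn h₂.1 _ _)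
  have k1 := av_mono_cube hs hA₁ hs₁ hsub₁ i1
  have k2 := av_mono_cube hs hA₂ hs₂ hsub₂ i2
  have k3 := av_add_le hs (i1.mono_set hsub₁) (i2.mono_set hsub₂) (H := fun x => P₁ x - P₂ x)
    (fun x _ => by
      have := abs_sub (f x - P₂ x) (f x - P₁ x)
      have e : f x - P₂ x - (f x - P₁ x) = P₁ x - P₂ x := by ring
      rw [e] at this
      linarith)
  have b : ∀ {s' : ℝ}, 0 < s' → s' ≤ A * s → A ^ d * (N * s' ^ n) ≤ A ^ (n + d) * N * s ^ n := by
    intro s' h0 h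
    calc A ^ d * (N * s' ^ n) ≤ A ^ d * (N * (A * s) ^ n) := by gcongr
      _ = _ := by rw [mul_pow, pow_add]; ring
  have m1 : A ^ d * av z₁ s₁ (fun x => f x - P₁ x) ≤ A ^ d * (N * s₁ ^ n) := by
    gcongr; exact h₁.2
  have m2 : A ^ d * av z₂ s₂ (fun x => f x - P₂ x) ≤ A ^ d * (N * s₂ ^ n) := by
    gcongr; exact h₂.2
  linarith [b hs₁ hA₁, b hs₂ hA₂]

/-! ### Chains of cubes -/

lemma pv_inj {d : ℕ} {p q : MvPolynomial (Fin d) ℝ} (h : ∀ w : Eu d, pv p w = pv q w) : p = q := by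
  apply MvPolynomial.funext
  intro x
  have := h (WithLp.toLp 2 x)
  simpa [pv] using this

structure Cone {d : ℕ} (D : Set (Eu d)) (x v : Eu d) (c T : ℝ) : Prop where
  cpos : 0 < c
  cle : c ≤ 1
  Tpos : 0 < T
  vle : ‖v‖ ≤ 1
  sub : ∀ t, 0 < t → t ≤ T → cube (x + t • v) (c * t) ⊆ D

lemma Cone.mono {d : ℕ} {D : Set (Eu d)} {x v : Eu d} {c T T' : ℝ} (h : Cone D x v c T)
    (h0 : 0 < T') (hT : T' ≤ T) : Cone D x v c T' :=
  ⟨h.cpos, h.cle, h0, h.vle, fun t ht htT => h.sub t ht (htT.trans hT)⟩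

/-- ratio of the chain -/
def lam (c : ℝ) : ℝ := 1 - c / 8

lemma lam_pos {c : ℝ} (h1 : c ≤ 1) : 0 < lam c := by unfold lam; linarith
lemma lam_half {c : ℝ} (h1 : c ≤ 1) : 1 / 2 ≤ lam c := by unfold lam; linarith
lemma lam_lt {c : ℝ} (h1 : 0 < c) : lam c < 1 := by unfold lam; linarith

lemma exists_chain {d n : ℕ} {D : Set (Eu d)} {f : Eu d → ℝ} {N : ℝ} (hf : Camp n D f N) {x v : Eu d}
    {c T : ℝ} (hc : Cone D x v c T) {P₀ : Eu d → ℝ} (hP : NearB n f N P₀ (x + T • v) (c * T)) :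
    ∃ P : ℕ → Eu d → ℝ, P 0 = P₀ ∧
      ∀ k, NearB n f N (P k) (x + (lam c ^ k * T) • v) (c * (lam c ^ k * T)) := by
  have h : ∀ k : ℕ, ∃ P, NearB n f N P (x + (lam c ^ k * T) • v) (c * (lam c ^ k * T)) := by
    intro k
    have h1 : 0 < lam c ^ k * T := mul_pos (pow_pos (lam_pos hc.cle) _) hc.Tpos
    apply hf.near
    · exact mul_pos hc.cpos h1
    · apply hc.sub _ h1
      have := pow_le_one₀ (lam_pos hc.cle).le (lam_lt hc.cpos).le (n := k)
      nlinarith [hc.Tpos]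
  choose P hPk using h
  refine ⟨fun k => if k = 0 then P₀ else P k, by simp, fun k => ?_⟩
  by_cases hk : k = 0
  · subst hk; simpa using hP
  · simpa [hk] using hPk k

/-- one step -/
lemma chain_step {d n : ℕ} {D : Set (Eu d)} {f : Eu d → ℝ} {N : ℝ} (hf : Camp n D f N) {x v : Eu d}
    {c T t : ℝ} (hc : Cone D x v c T) (ht : 0 < t) (htT : t ≤ T) {P P' : Eu d → ℝ}
    (hP : NearB n f N P (x + t • v) (c * t))
    (hP' : NearB n f N P' (x + (lam c * t) • v) (c * (lam c * t))) :
    av (x + (lam c * t) • v) (c * t / 2) (fun y => P y - P' y) ≤ 2 * 2 ^ (n + d) * N * t ^ n := by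
  have hl0 := lam_pos hc.cle
  have hl2 := lam_half hc.cle
  have hl1 := lam_lt hc.cpos
  have hc0 := hc.cpos
  have hc1 := hc.cle
  have hlt : lam c * t ≤ T := by nlinarith
  have hct : 0 < c * t := mul_pos hc0 ht
  have hs1 : cube (x + (lam c * t) • v) (c * t / 2) ⊆ cube (x + t • v) (c * t) := by
    apply cube_subset_cube
    have e : x + (lam c * t) • v - (x + t • v) = (-(c / 8 * t)) • v := by
      rw [add_sub_add_left_eq_sub, ← sub_smul]; congr 1; unfold lam; ring
    rw [e, norm_smul, Real.norm_eq_abs, abs_neg, abs_of_pos (by positivity)]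
    have : c / 8 * t * ‖v‖ ≤ c / 8 * t * 1 := mul_le_mul_of_nonneg_left hc.vle (by positivity)
    linarith
  have hs2 : cube (x + (lam c * t) • v) (c * t / 2) ⊆ cube (x + (lam c * t) • v) (c * (lam c * t)) := by
    apply cube_subset_cube
    rw [sub_self, norm_zero]
    nlinarith
  have := compare (A := 2) hf.nonneg (by positivity) hct (by positivity) hP hP' (by linarith)
    (by nlinarith) hs1 hs2 (hf.integ _ _ hct (hc.sub t ht htT))
    (hf.integ _ _ (by positivity) (hc.sub _ (by positivity) hlt))
  refine this.trans ?_
  have hN := hf.nonneg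
  have : c * t / 2 ≤ t := by nlinarith
  gcongr

lemma chain_center {d : ℕ} {D : Set (Eu d)} {x v : Eu d}
    {c T t : ℝ} (hc : Cone D x v c T) (ht : 0 < t) :
    ‖x + (lam c * t) • v - x‖ ≤ t := by
  rw [add_sub_cancel_left, norm_smul, Real.norm_eq_abs, abs_of_pos (mul_pos (lam_pos hc.cle) ht)]
  have h1 := lam_lt hc.cpos
  have h0 := lam_pos hc.cle
  have := hc.vle
  have : lam c * t * ‖v‖ ≤ 1 * t * 1 := by gcongr
  linarith

lemma chain_point (d n : ℕ) (c : ℝ) (hc0 : 0 < c) : ∃ C : ℝ, 0 < C ∧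
    ∀ {D : Set (Eu d)} {f : Eu d → ℝ} {N : ℝ} (_ : Camp n D f N) {x v : Eu d}
    {T t : ℝ} (_ : Cone D x v c T) (_ : 0 < t) (_ : t ≤ T) {P P' : Eu d → ℝ}
    (_ : NearB n f N P (x + t • v) (c * t))
    (_ : NearB n f N P' (x + (lam c * t) • v) (c * (lam c * t))),
    |P x - P' x| ≤ C * N * t ^ n := by
  obtain ⟨C, hC, h⟩ := poly_point d n
  refine ⟨C * (1 + 2 / c) ^ n * (2 * 2 ^ (n + d)), by positivity, ?_⟩
  intro D f N hf x v T t hc ht htT P P' hP hP'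
  have h1 := chain_step hf hc ht htT hP hP'
  have h2 := h _ (polyLE_sub hP.1 hP'.1) (x + (lam c * t) • v) (c * t / 2) (by positivity) x
  have h3 := chain_center hc ht
  rw [norm_sub_rev] at h3
  have hN := hf.nonneg
  refine h2.trans ?_
  have h4 : ‖x - (x + (lam c * t) • v)‖ / (c * t / 2) ≤ 2 / c := by
    rw [div_le_div_iff₀ (by positivity) (by positivity)]
    nlinarith
  have h5 := av_nonneg (x + (lam c * t) • v) (show 0 < c * t / 2 by positivity) (fun y => P y - P' y)
  calc _ ≤ C * (1 + 2 / c) ^ n * (2 * 2 ^ (n + d) * N * t ^ n) := by gcongr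
    _ = _ := by ring

lemma chain_lip (d n : ℕ) (c : ℝ) (hc0 : 0 < c) : ∃ C : ℝ, 0 < C ∧
    ∀ {D : Set (Eu d)} {f : Eu d → ℝ} {N : ℝ} (_ : Camp n D f N) {x v : Eu d}
    {T t : ℝ} (_ : Cone D x v c T) (_ : 0 < t) (_ : t ≤ T) {P P' : Eu d → ℝ}
    (_ : NearB n f N P (x + t • v) (c * t))
    (_ : NearB n f N P' (x + (lam c * t) • v) (c * (lam c * t))) {y : Eu d} (_ : ‖y - x‖ ≤ t),
    |(P x - P' x) - (P y - P' y)| ≤ C * N * t ^ n * (‖x - y‖ / t) := by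
  obtain ⟨C, hC, h⟩ := poly_lip d n (4 / c) (by positivity)
  refine ⟨C * (2 / c) * (2 * 2 ^ (n + d)), by positivity, ?_⟩
  intro D f N hf x v T t hc ht htT P P' hP hP' y hy
  have h1 := chain_step hf hc ht htT hP hP'
  have h3 := chain_center hc ht
  rw [norm_sub_rev] at h3
  have e : 4 / c * (c * t / 2) = 2 * t := by field_simp; ring
  have h2 := h _ (polyLE_sub hP.1 hP'.1) (x + (lam c * t) • v) x y (c * t / 2) (by positivity)
    (by rw [e]; linarith) (by
      rw [e]
      calc _ ≤ ‖y - x‖ + ‖x - (x + (lam c * t) • v)‖ := norm_sub_le_norm_sub_add_norm_sub _ _ _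
        _ ≤ _ := by linarith)
  refine h2.trans ?_
  have h5 := av_nonneg (x + (lam c * t) • v) (show 0 < c * t / 2 by positivity) (fun y => P y - P' y)
  have hN := hf.nonneg
  calc _ ≤ C * (‖x - y‖ / (c * t / 2)) * (2 * 2 ^ (n + d) * N * t ^ n) := by gcongr
    _ = _ := by field_simp

lemma chain_hc (d n : ℕ) (c : ℝ) (hc0 : 0 < c) : ∃ C : ℝ, 0 < C ∧
    ∀ {D : Set (Eu d)} {f : Eu d → ℝ} {N : ℝ} (_ : Camp n D f N) {x v : Eu d}
    {T t : ℝ} (_ : Cone D x v c T) (_ : 0 < t) (_ : t ≤ T) {P P' : Eu d → ℝ}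
    (_ : NearB n f N P (x + t • v) (c * t))
    (_ : NearB n f N P' (x + (lam c * t) • v) (c * (lam c * t)))
    {p : MvPolynomial (Fin d) ℝ} (_ : p.totalDegree ≤ n) (_ : ∀ y, P y - P' y = pv p (y - x))
    {j : ℕ} (_ : j ≤ n) (w : Eu d),
    |pv (hc j p) w| ≤ C * N * ‖w‖ ^ j * t ^ (n - j) := by
  obtain ⟨C, hC, h⟩ := poly_hc d n (2 / c) (by positivity)
  refine ⟨C * (1 + 2 / c) ^ n * (2 * 2 ^ (n + d)), by positivity, ?_⟩
  intro D f N hf x v T t hc ht htT P P' hP hP' p hp hPp j hj w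
  have h1 := chain_step hf hc ht htT hP hP'
  simp only [hPp] at h1
  have h3 := chain_center hc ht
  have e : 2 / c * (c * t / 2) = t := by field_simp
  have h2 := h x (x + (lam c * t) • v) (c * t / 2) (by positivity) (by rw [e]; exact h3) p hp j w
  have h5 := av_nonneg (x + (lam c * t) • v) (show 0 < c * t / 2 by positivity) (fun y => pv p (y - x))
  have hN := hf.nonneg
  refine h2.trans ?_
  have e2 : (‖w‖ / (c * t / 2)) = ‖w‖ * (2 / c) / t := by field_simp
  have e3 : t ^ n = t ^ (n - j) * t ^ j := by rw [← pow_add]; congr 1; omega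
  have h6 : (2 / c) ^ j ≤ (1 + 2 / c) ^ n := by
    have : 0 < 2 / c := by positivity
    calc (2 / c) ^ j ≤ (1 + 2 / c) ^ j := by gcongr; linarith
      _ ≤ _ := pow_le_pow_right₀ (by linarith) hj
  calc _ ≤ C * (‖w‖ / (c * t / 2)) ^ j * (2 * 2 ^ (n + d) * N * t ^ n) := by gcongr
    _ = C * (2 / c) ^ j * (2 * 2 ^ (n + d)) * N * ‖w‖ ^ j * t ^ (n - j) := by
        rw [e2, e3, div_pow, mul_pow]; field_simp
    _ ≤ _ := by gcongr

/-- nontangential Lebesgue points -/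
def Good {d : ℕ} (f : Eu d → ℝ) (x : Eu d) : Prop :=
  ∀ A : ℝ, ∀ ε > 0, ∃ δ > 0, ∀ z s, 0 < s → s < δ → ‖z - x‖ ≤ A * s → av z s (fun y => f y - f x) ≤ ε

lemma geom_bound {lm : ℝ} (h0 : 0 ≤ lm) (h1 : lm < 1) (k : ℕ) :
    ∑ i ∈ Finset.range k, lm ^ i ≤ (1 - lm)⁻¹ := by
  rw [← tsum_geometric_of_lt_one h0 h1]
  exact (summable_geometric_of_lt_one h0 h1).sum_le_tsum _ (fun i _ => by positivity)

lemma chain_limit {d n : ℕ} (hn : 0 < n) {D : Set (Eu d)} {f : Eu d → ℝ} {N : ℝ} (hf : Camp n D f N)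
    {x v : Eu d} {c T : ℝ} (hc : Cone D x v c T) (hx : Good f x) {P : ℕ → Eu d → ℝ}
    (hP : ∀ k, NearB n f N (P k) (x + (lam c ^ k * T) • v) (c * (lam c ^ k * T))) :
    Tendsto (fun k => P k x) atTop (𝓝 (f x)) := by
  obtain ⟨C, hC, h⟩ := poly_point d n
  have hl0 := lam_pos hc.cle
  have hl1 := lam_lt hc.cpos
  have hc0 := hc.cpos
  have hT := hc.Tpos
  have hN := hf.nonneg
  have ht0 : Tendsto (fun k : ℕ => c * (lam c ^ k * T)) atTop (𝓝 0) := by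
    have := ((tendsto_pow_atTop_nhds_zero_of_lt_one hl0.le hl1).mul_const T).const_mul c
    simpa using this
  have ht1 : Tendsto (fun k : ℕ => N * (c * (lam c ^ k * T)) ^ n) atTop (𝓝 0) := by
    have := (ht0.pow n).const_mul N
    simpa [hn.ne'] using this
  rw [Metric.tendsto_atTop]
  intro ε hε
  set B := C * (1 + 1 / c) ^ n with hB
  have hB0 : 0 < B := by positivity
  obtain ⟨δ, hδ, hg⟩ := hx (1 / c) (ε / (4 * B)) (by positivity)
  obtain ⟨k0, hk0⟩ := (ht0.eventually (gt_mem_nhds hδ)).exists_forall_of_atTop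
  obtain ⟨k1, hk1⟩ := (ht1.eventually (gt_mem_nhds (show 0 < ε / (4 * B) by positivity))).exists_forall_of_atTop
  refine ⟨max k0 k1, fun k hk => ?_⟩
  have ht : 0 < lam c ^ k * T := by positivity
  have htT : lam c ^ k * T ≤ T := by
    have := pow_le_one₀ hl0.le hl1.le (n := k)
    nlinarith
  set z := x + (lam c ^ k * T) • v with hz
  set s := c * (lam c ^ k * T) with hs
  have hs0 : 0 < s := by positivity
  have hzx : ‖z - x‖ ≤ 1 / c * s := by
    have e : 1 / c * s = lam c ^ k * T := by rw [hs]; field_simp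
    rw [e, hz, add_sub_cancel_left, norm_smul, Real.norm_eq_abs, abs_of_pos ht]
    have := hc.vle
    nlinarith
  have h1 := hg z s hs0 (hk0 k (le_trans (le_max_left _ _) hk)) hzx
  have h2 : av z s (fun y => f y - P k y) ≤ ε / (4 * B) :=
    (hP k).2.trans (hk1 k (le_trans (le_max_right _ _) hk)).le
  have hfi : IntegrableOn f (cube z s) := hf.integ _ _ hs0 (hc.sub _ ht htT)
  have hci : IntegrableOn (fun _ => f x) (cube z s) := polyLE_intOn (n := n) (polyLE_const (f x)) z s
  have h3 : av z s (fun y => P k y - f x) ≤ ε / (4 * B) + ε / (4 * B) :=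
    (av_add_le hs0 (hfi.sub hci) (hfi.sub (polyLE_intOn (hP k).1 z s)) (fun y _ => by
      have := abs_sub (f y - f x) (f y - P k y)
      have e : f y - f x - (f y - P k y) = P k y - f x := by ring
      rw [e] at this
      simpa using this)).trans (add_le_add h1 h2)
  have h4 := h _ (polyLE_sub (hP k).1 (polyLE_const (f x))) z s hs0 x
  rw [Real.dist_eq]
  refine h4.trans_lt ?_
  have h5 : ‖x - z‖ / s ≤ 1 / c := by
    rw [div_le_iff₀ hs0, norm_sub_rev]; exact hzx
  have h6 := av_nonneg z hs0 (fun y => P k y - f x)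
  calc _ ≤ B * (ε / (4 * B) + ε / (4 * B)) := by
        rw [hB]; gcongr
    _ = ε / 2 := by field_simp; ring
    _ < ε := by linarith

lemma CH1 (d n : ℕ) (hn : 0 < n) (c : ℝ) (hc0 : 0 < c) : ∃ C : ℝ, 0 < C ∧
    ∀ {D : Set (Eu d)} {f : Eu d → ℝ} {N : ℝ} (_ : Camp n D f N) {x v : Eu d}
    {T : ℝ} (_ : Cone D x v c T) (_ : Good f x) {P : Eu d → ℝ}
    (_ : NearB n f N P (x + T • v) (c * T)), |f x - P x| ≤ C * N * T ^ n := by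
  obtain ⟨C, hC, h⟩ := chain_point d n c hc0
  have hl1 := lam_lt hc0
  refine ⟨C * (1 - lam c)⁻¹, mul_pos hC (inv_pos.2 (by linarith)), ?_⟩
  intro D f N hf x v T hc hx P₀ hP₀
  obtain ⟨P, hP0, hP⟩ := exists_chain hf hc hP₀
  have hlim := chain_limit hn hf hc hx hP
  have hl0 := lam_pos hc.cle
  have hT := hc.Tpos
  have hN := hf.nonneg
  have key : ∀ k, |P k x - P₀ x| ≤ C * (1 - lam c)⁻¹ * N * T ^ n := by
    intro k
    have e : P k x - P₀ x = ∑ i ∈ Finset.range k, (P (i + 1) x - P i x) := by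
      rw [Finset.sum_range_sub (fun i => P i x), hP0]
    rw [e]
    refine (Finset.abs_sum_le_sum_abs _ _).trans ?_
    have : ∀ i ∈ Finset.range k, |P (i + 1) x - P i x| ≤ C * N * T ^ n * lam c ^ i := by
      intro i _
      have hi1 : lam c ^ i ≤ 1 := pow_le_one₀ hl0.le hl1.le
      have hi0 : 0 < lam c ^ i := by positivity
      have hpp := hP (i + 1)
      rw [pow_succ', mul_assoc] at hpp
      have := h hf hc (t := lam c ^ i * T) (by positivity) (by nlinarith) (hP i) hpp
      rw [abs_sub_comm]
      refine this.trans ?_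
      rw [mul_pow]
      have h9 : (lam c ^ i) ^ n ≤ lam c ^ i := pow_le_of_le_one hi0.le hi1 hn.ne'
      calc C * N * ((lam c ^ i) ^ n * T ^ n) ≤ C * N * (lam c ^ i * T ^ n) := by gcongr
        _ = _ := by ring
    refine (Finset.sum_le_sum this).trans ?_
    rw [← Finset.mul_sum]
    calc _ ≤ C * N * T ^ n * (1 - lam c)⁻¹ := by
          gcongr
          exact geom_bound hl0.le hl1 k
      _ = _ := by ring
  exact le_of_tendsto ((hlim.sub_const (P₀ x)).abs) (Eventually.of_forall key)

/-- every point of a cube sees the cube through a cone -/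
lemma cube_cone {d : ℕ} (hd : 0 < d) {D : Set (Eu d)} {x₀ x : Eu d} {l : ℝ} (hl : 0 < l)
    (hQ : cube x₀ l ⊆ D) (hx : x ∈ cube x₀ l) :
    Cone D x ((l * d)⁻¹ • (x₀ - x)) (1 / (d : ℝ)) (l * d) := by
  have hd' : (0 : ℝ) < d := by exact_mod_cast hd
  have hd1 : (1 : ℝ) ≤ d := by exact_mod_cast hd
  refine ⟨by positivity, by rw [div_le_one hd']; exact hd1, by positivity, ?_, ?_⟩
  · rw [norm_smul, norm_inv, Real.norm_eq_abs, abs_of_pos (by positivity), inv_mul_le_iff₀ (by positivity),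
      norm_sub_rev]
    have := norm_sub_le_of_mem_cube hl.le hx
    nlinarith
  · intro t ht htT
    refine Subset.trans ?_ hQ
    intro y hy i
    have h1 := hy i
    have h2 := hx i
    simp only [PiLp.add_apply, PiLp.smul_apply, PiLp.sub_apply, smul_eq_mul] at h1
    set τ := t * (l * d)⁻¹ with hτ
    have hτ0 : 0 < τ := by positivity
    have hτ1 : τ ≤ 1 := by
      rw [hτ, ← div_eq_mul_inv, div_le_one (by positivity)]; exact htT
    have e : 1 / (d : ℝ) * t / 2 = τ * (l / 2) := by rw [hτ]; field_simp
    rw [e, ← mul_assoc, ← hτ] at h1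
    have e2 : y i - x₀ i = (y i - (x i + τ * (x₀ i - x i))) + (1 - τ) * (x i - x₀ i) := by ring
    rw [e2]
    refine (abs_add_le _ _).trans ?_
    rw [abs_mul, abs_of_nonneg (by linarith : 0 ≤ 1 - τ)]
    nlinarith

lemma near_of_cube {d n : ℕ} (hd : 0 < d) {f : Eu d → ℝ} {N : ℝ} {P : Eu d → ℝ} {x₀ x : Eu d} {l : ℝ} (hl : 0 < l)
    (hP : NearB n f N P x₀ l) :
    NearB n f N P (x + (l * d) • ((l * d)⁻¹ • (x₀ - x))) (1 / (d : ℝ) * (l * d)) := by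
  have hd' : (0 : ℝ) < d := by exact_mod_cast hd
  have e1 : x + (l * d) • (((l : ℝ) * d)⁻¹ • (x₀ - x)) = x₀ := by
    rw [smul_smul, mul_inv_cancel₀ (by positivity), one_smul]; abel
  have e2 : 1 / (d : ℝ) * (l * d) = l := by field_simp
  rw [e1, e2]; exact hP

lemma cube_sup (d n : ℕ) (hd : 0 < d) (hn : 0 < n) : ∃ C : ℝ, 0 < C ∧
    ∀ {D : Set (Eu d)} {f : Eu d → ℝ} {N : ℝ} (_ : Camp n D f N) {x₀ : Eu d} {l : ℝ} (_ : 0 < l)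
    (_ : cube x₀ l ⊆ D) {P : Eu d → ℝ} (_ : NearB n f N P x₀ l) {x : Eu d} (_ : x ∈ cube x₀ l)
    (_ : Good f x), |f x - P x| ≤ C * N * l ^ n := by
  have hd' : (0 : ℝ) < d := by exact_mod_cast hd
  obtain ⟨C, hC, h⟩ := CH1 d n hn (1 / (d : ℝ)) (by positivity)
  refine ⟨C * d ^ n, by positivity, ?_⟩
  intro D f N hf x₀ l hl hQ P hP x hx hg
  refine (h hf (cube_cone hd hl hQ hx) hg (near_of_cube hd hl hP)).trans (le_of_eq ?_)
  rw [mul_pow]; ring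

lemma sqrt_div_le {r t : ℝ} (hr : 0 ≤ r) (ht : 0 < t) (h : r ≤ t) : r / t ≤ √(r / t) := by
  have h0 : 0 ≤ r / t := by positivity
  have h1 : r / t ≤ 1 := (div_le_one ht).2 h
  exact Real.le_sqrt_of_sq_le (by nlinarith)

set_option maxHeartbeats 1600000 in
lemma cube_holder (d n : ℕ) (hd : 0 < d) (hn : 0 < n) : ∃ C : ℝ, 0 < C ∧
    ∀ {D : Set (Eu d)} {f : Eu d → ℝ} {N : ℝ} (_ : Camp n D f N) {x₀ : Eu d} {l : ℝ} (_ : 0 < l)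
    (_ : cube x₀ l ⊆ D) {P : Eu d → ℝ} (_ : NearB n f N P x₀ l) {x y : Eu d} (_ : x ∈ cube x₀ l)
    (_ : y ∈ cube x₀ l) (_ : Good f x) (_ : Good f y),
    |(f x - P x) - (f y - P y)| ≤ C * N * l ^ n * √(‖x - y‖ / l) := by
  have hd' : (0 : ℝ) < d := by exact_mod_cast hd
  have hd1 : (1 : ℝ) ≤ d := by exact_mod_cast hd
  set c := 1 / (d : ℝ) with hcdef
  have hc0 : 0 < c := by positivity
  have hc1 : c ≤ 1 := by rw [hcdef, div_le_one hd']; exact hd1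
  obtain ⟨C₁, hC₁, h₁⟩ := cube_sup d n hd hn
  obtain ⟨C₂, hC₂, h₂⟩ := CH1 d n hn c hc0
  obtain ⟨C₃, hC₃, h₃⟩ := chain_lip d n c hc0
  obtain ⟨C₄, hC₄, h₄⟩ := poly_point d n
  have hl0 := lam_pos hc1
  have hl1 := lam_lt hc0
  set μ := √(lam c) with hμ
  have hμ0 : 0 < μ := Real.sqrt_pos.2 hl0
  have hμ1 : μ < 1 := by rw [hμ]; exact (Real.sqrt_lt' one_pos).2 (by simpa using hl1)
  have hμm : 0 < (1 - μ)⁻¹ := inv_pos.2 (by linarith)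
  set E : ℝ := 2 * (C₂ * (d ^ n * 8)) + C₃ * d ^ n * (1 - μ)⁻¹ +
    C₄ * (1 + (2 * d + 2)) ^ n * (2 * 2 ^ (n + d)) * 8 with hE
  have hE0 : 0 < E := by positivity
  refine ⟨4 * C₁ + E, by positivity, ?_⟩
  intro D f N hf x₀ l hl hQ P hP x y hx hy hgx hgy
  have hN := hf.nonneg
  have hX := cube_cone hd hl hQ hx
  have hY := cube_cone hd hl hQ hy
  rcases eq_or_ne x y with hxy | hxy
  · subst hxy; simp
  set r := ‖x - y‖ with hr
  have hr0 : 0 < r := norm_pos_iff.2 (sub_ne_zero.2 hxy)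
  have hS0 : 0 ≤ √(r / l) := Real.sqrt_nonneg _
  rcases le_or_gt l (4 * r) with hbig | hsmall
  · have a1 := h₁ hf hl hQ hP hx hgx
    have a2 := h₁ hf hl hQ hP hy hgy
    have a3 : 1 / 2 ≤ √(r / l) := by
      apply Real.le_sqrt_of_sq_le
      rw [le_div_iff₀ hl]; linarith
    have a4 := abs_sub (f x - P x) (f y - P y)
    have a5 : 0 ≤ C₁ * N * l ^ n := by positivity
    have a6 : 0 ≤ E * N * l ^ n * √(r / l) := by positivity
    nlinarith
  · obtain ⟨k, hk1, hk2⟩ := exists_nat_pow_near_of_lt_one (x := 4 * r / l) (y := lam c) (by positivity)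
      ((div_le_one hl).2 hsmall.le) hl0 hl1
    set τ := lam c ^ k with hτ
    have hτ0 : 0 < τ := by positivity
    have hτ1 : τ ≤ 1 := pow_le_one₀ hl0.le hl1.le
    have hrτ : 4 * r ≤ τ * l := by rwa [div_le_iff₀ hl] at hk2
    have hτr : τ ≤ 8 * (r / l) := by
      have h5 := lam_half hc1
      rw [pow_succ] at hk1
      have : τ * (1 / 2) ≤ τ * lam c := by gcongr
      have e : 8 * (r / l) = 2 * (4 * r / l) := by ring
      rw [e]; linarith
    have hrl : r / l ≤ √(r / l) := sqrt_div_le hr0.le hl (by linarith)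
    have hτn : τ ^ n ≤ 8 * √(r / l) :=
      (pow_le_of_le_one hτ0.le hτ1 hn.ne').trans (by linarith)
    obtain ⟨Px, hPx0, hPx⟩ := exists_chain hf hX (near_of_cube hd hl hP)
    obtain ⟨Py, hPy0, hPy⟩ := exists_chain hf hY (near_of_cube hd hl hP)
    have hT : 0 < τ * (l * d) := by positivity
    have hTT : τ * (l * d) ≤ l * d := by
      have : 0 < l * d := by positivity
      nlinarith
    have b1 := h₂ hf (hX.mono hT hTT) hgx (hPx k)
    have b2 := h₂ hf (hY.mono hT hTT) hgy (hPy k)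
    have b0 : C₂ * N * (τ * (l * d)) ^ n ≤ C₂ * (d ^ n * 8) * N * l ^ n * √(r / l) := by
      calc C₂ * N * (τ * (l * d)) ^ n = C₂ * d ^ n * N * l ^ n * τ ^ n := by
            rw [mul_pow, mul_pow]; ring
        _ ≤ C₂ * d ^ n * N * l ^ n * (8 * √(r / l)) := by gcongr
        _ = _ := by ring
    -- Lipschitz part
    have b3 : |(Px k x - P x) - (Px k y - P y)| ≤ C₃ * d ^ n * (1 - μ)⁻¹ * N * l ^ n * √(r / l) := by
      have e : (Px k x - P x) - (Px k y - P y) =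
          ∑ i ∈ Finset.range k, ((Px (i + 1) x - Px (i + 1) y) - (Px i x - Px i y)) := by
        rw [Finset.sum_range_sub (fun i => Px i x - Px i y), hPx0]; ring
      rw [e]
      refine (Finset.abs_sum_le_sum_abs _ _).trans ?_
      have : ∀ i ∈ Finset.range k, |((Px (i + 1) x - Px (i + 1) y) - (Px i x - Px i y))| ≤
          C₃ * d ^ n * N * l ^ n * √(r / l) * μ ^ i := by
        intro i hi
        have hik : i ≤ k := (Finset.mem_range.1 hi).le
        have hi1 : lam c ^ i ≤ 1 := pow_le_one₀ hl0.le hl1.le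
        have hi0 : 0 < lam c ^ i := by positivity
        have hik' : τ ≤ lam c ^ i := pow_le_pow_of_le_one hl0.le hl1.le hik
        set t := lam c ^ i * (l * d) with ht
        have ht0 : 0 < t := by positivity
        have htl : lam c ^ i * l ≤ t := by rw [ht]; gcongr; nlinarith
        have hrt0 : r ≤ lam c ^ i * l := by nlinarith
        have hrt : r ≤ t := by linarith
        have hpp := hPx (i + 1)
        rw [pow_succ', mul_assoc] at hpp
        have q := h₃ hf hX (t := t) ht0 (by rw [ht]; have : 0 < l * d := by positivity
                                            nlinarith) (hPx i) hpp (y := y) (by rw [norm_sub_rev]; exact hrt)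
        have e : ((Px (i + 1) x - Px (i + 1) y) - (Px i x - Px i y)) =
          -((Px i x - Px (i + 1) x) - (Px i y - Px (i + 1) y)) := by ring
        rw [e, abs_neg]
        refine q.trans ?_
        have e2 : lam c ^ i = μ ^ i * μ ^ i := by
          rw [← mul_pow, hμ, Real.mul_self_sqrt hl0.le]
        have h9 : (lam c ^ i) ^ n ≤ lam c ^ i := pow_le_of_le_one hi0.le hi1 hn.ne'
        have h10 : r / t ≤ √(r / l) / μ ^ i := by
          calc r / t ≤ r / (lam c ^ i * l) := by gcongr
            _ ≤ √(r / (lam c ^ i * l)) := sqrt_div_le hr0.le (by positivity) hrt0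
            _ = √(r / l) / μ ^ i := by
              have : r / (lam c ^ i * l) = (r / l) / (μ ^ i * μ ^ i) := by rw [← e2]; field_simp
              rw [this, Real.sqrt_div' _ (by positivity), Real.sqrt_mul_self (by positivity)]
        calc C₃ * N * t ^ n * (r / t) ≤ C₃ * N * (lam c ^ i * (l * d) ^ n) * (√(r / l) / μ ^ i) := by
              rw [ht, mul_pow]; gcongr
          _ = _ := by rw [e2, mul_pow]; field_simp
      refine (Finset.sum_le_sum this).trans ?_
      rw [← Finset.mul_sum]
      calc _ ≤ C₃ * d ^ n * N * l ^ n * √(r / l) * (1 - μ)⁻¹ := by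
            gcongr
            exact geom_bound hμ0.le hμ1 k
        _ = _ := by ring
    -- comparison of the two chains
    have b4 : |Px k y - Py k y| ≤ C₄ * (1 + (2 * d + 2)) ^ n * (2 * 2 ^ (n + d)) * 8 * N * l ^ n * √(r / l) := by
      have p1 := hPx k
      have p2 := hPy k
      have s1 := hX.sub _ hT hTT
      have s2 := hY.sub _ hT hTT
      have e1 : c * (lam c ^ k * (l * d)) = τ * l := by rw [hcdef, ← hτ]; field_simp
      have e2 : c * (τ * (l * d)) = τ * l := e1
      have e3 : ∀ x : Eu d, (τ * (l * d)) • ((l * (d : ℝ))⁻¹ • (x₀ - x)) = τ • (x₀ - x) := by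
        intro x; rw [smul_smul]; congr 1; field_simp
      rw [e1, ← hτ, e3] at p1 p2
      rw [← hcdef, e2, e3] at s1 s2
      have hτl : 0 < τ * l := by positivity
      have hcs : cube (x + τ • (x₀ - x)) (τ * l / 2) ⊆ cube (y + τ • (x₀ - y)) (τ * l) := by
        apply cube_subset_cube
        have : x + τ • (x₀ - x) - (y + τ • (x₀ - y)) = (1 - τ) • (x - y) := by
          module
        rw [this, norm_smul, Real.norm_eq_abs, abs_of_nonneg (by linarith)]
        nlinarith
      have hcs2 : cube (x + τ • (x₀ - x)) (τ * l / 2) ⊆ cube (x + τ • (x₀ - x)) (τ * l) := by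
        apply cube_subset_cube
        rw [sub_self, norm_zero]; linarith
      have q := compare (A := 2) hN (by positivity) hτl hτl p1 p2 (by linarith) (by linarith) hcs2 hcs
        (hf.integ _ _ hτl s1) (hf.integ _ _ hτl s2)
      have q2 := h₄ _ (polyLE_sub p1.1 p2.1) (x + τ • (x₀ - x)) (τ * l / 2) (by positivity) y
      have q3 : ‖y - (x + τ • (x₀ - x))‖ / (τ * l / 2) ≤ 2 * d + 2 := by
        rw [div_le_iff₀ (by positivity)]
        have a1 : y - (x + τ • (x₀ - x)) = -(x - y) + τ • (x - x₀) := by module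
        rw [a1]
        refine (norm_add_le _ _).trans ?_
        rw [norm_neg, norm_smul, Real.norm_eq_abs, abs_of_pos hτ0]
        have := norm_sub_le_of_mem_cube hl.le hx
        have : τ * ‖x - x₀‖ ≤ τ * (d * (l / 2)) := by gcongr
        have : 0 ≤ τ * l * d := by positivity
        nlinarith
      have h5 := av_nonneg (x + τ • (x₀ - x)) (show 0 < τ * l / 2 by positivity)
        (fun y => Px k y - Py k y)
      refine q2.trans ?_
      calc _ ≤ C₄ * (1 + (2 * d + 2)) ^ n * (2 * 2 ^ (n + d) * N * (τ * l / 2) ^ n) := by gcongr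
        _ ≤ C₄ * (1 + (2 * d + 2)) ^ n * (2 * 2 ^ (n + d) * N * (τ * l) ^ n) := by gcongr; linarith
        _ = C₄ * (1 + (2 * d + 2)) ^ n * (2 * 2 ^ (n + d)) * N * l ^ n * τ ^ n := by rw [mul_pow]; ring
        _ ≤ C₄ * (1 + (2 * d + 2)) ^ n * (2 * 2 ^ (n + d)) * N * l ^ n * (8 * √(r / l)) := by gcongr
        _ = _ := by ring
    have e : (f x - P x) - (f y - P y) = (f x - Px k x) - (f y - Py k y)
        + ((Px k x - P x) - (Px k y - P y)) + (Px k y - Py k y) := by ring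
    rw [e]
    have t1 := abs_add_le ((f x - Px k x) - (f y - Py k y) + ((Px k x - P x) - (Px k y - P y)))
      (Px k y - Py k y)
    have t2 := abs_add_le ((f x - Px k x) - (f y - Py k y)) ((Px k x - P x) - (Px k y - P y))
    have t3 := abs_sub (f x - Px k x) (f y - Py k y)
    have t4 : 0 ≤ 4 * C₁ * N * l ^ n * √(r / l) := by positivity
    have t5 : (4 * C₁ + E) * N * l ^ n * √(r / l) = 4 * C₁ * N * l ^ n * √(r / l) +
      2 * (C₂ * (d ^ n * 8) * N * l ^ n * √(r / l)) + C₃ * d ^ n * (1 - μ)⁻¹ * N * l ^ n * √(r / l) +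
      C₄ * (1 + (2 * d + 2)) ^ n * (2 * 2 ^ (n + d)) * 8 * N * l ^ n * √(r / l) := by rw [hE]; ring
    rw [t5]
    linarith

/-- log factor -/
def LL (n j : ℕ) (q : ℝ) : ℝ := if j < n then 1 else 1 + max 0 (Real.log q)

lemma one_le_LL (n j : ℕ) (q : ℝ) : 1 ≤ LL n j q := by
  unfold LL; split_ifs
  · exact le_rfl
  · linarith [le_max_left 0 (Real.log q)]

lemma LL_le (n j : ℕ) (q : ℝ) : LL n j q ≤ 1 + max 0 (Real.log q) := by
  unfold LL; split_ifs
  · linarith [le_max_left 0 (Real.log q)]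
  · exact le_rfl

lemma exists_first {lm T b : ℝ} (h0 : 0 < lm) (h1 : lm < 1) (hT : 0 < T) (hb : 0 < b) :
    ∃ k : ℕ, lm ^ k * T ≤ b ∧ (k = 0 ∨ lm * b ≤ lm ^ k * T) := by
  rcases le_or_gt T b with h | h
  · exact ⟨0, by simpa using h, Or.inl rfl⟩
  · obtain ⟨k, hk1, hk2⟩ := exists_nat_pow_near_of_lt_one (x := b / T) (y := lm) (by positivity)
      ((div_le_one hT).2 h.le) h0 h1
    refine ⟨k + 1, ?_, Or.inr ?_⟩
    · rw [lt_div_iff₀ hT] at hk1; exact hk1.le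
    · rw [div_le_iff₀ hT] at hk2
      rw [pow_succ', mul_assoc]; gcongr

lemma geom_LL {lm : ℝ} (n j : ℕ) (hj : j ≤ n) (h0 : 0 < lm) (h1 : lm < 1) : ∃ C : ℝ, 0 < C ∧
    ∀ {T b q : ℝ} (_ : 0 < T) (_ : 0 < b) (_ : T / b ≤ 4 * q) (_ : 0 < q) {k : ℕ} (_ : k = 0 ∨ lm * b ≤ lm ^ k * T),
    ∑ i ∈ Finset.range (k + 1), (lm ^ i * T) ^ (n - j) ≤ C * T ^ (n - j) * LL n j q := by
  have hlog : 0 < -Real.log lm := by have := Real.log_neg h0 h1; linarith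
  refine ⟨(1 - lm)⁻¹ + (2 + (Real.log 4) / (-Real.log lm) + 1 / (-Real.log lm)), ?_, ?_⟩
  · have : 0 < (1 - lm)⁻¹ := inv_pos.2 (by linarith)
    have : 0 ≤ Real.log 4 := Real.log_nonneg (by norm_num)
    positivity
  intro T b q hT hb hq hq0 k hk
  have h41 : 0 ≤ Real.log 4 := Real.log_nonneg (by norm_num)
  have hi1 : 0 < (1 - lm)⁻¹ := inv_pos.2 (by linarith)
  have hTn : 0 < T ^ (n - j) := by positivity
  rcases lt_or_eq_of_le hj with h | h
  · have hL : LL n j q = 1 := by simp [LL, h]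
    rw [hL, mul_one]
    have : ∀ i ∈ Finset.range (k + 1), (lm ^ i * T) ^ (n - j) ≤ lm ^ i * T ^ (n - j) := by
      intro i _
      rw [mul_pow]
      gcongr
      exact pow_le_of_le_one (by positivity) (pow_le_one₀ h0.le h1.le) (by omega)
    refine (Finset.sum_le_sum this).trans ?_
    rw [← Finset.sum_mul]
    gcongr
    refine (geom_bound h0.le h1 _).trans ?_
    have : 0 ≤ 2 + (Real.log 4) / (-Real.log lm) + 1 / (-Real.log lm) := by positivity
    linarith
  · have hL : LL n j q = 1 + max 0 (Real.log q) := by simp [LL, h]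
    have hnj : n - j = 0 := by omega
    rw [hnj]
    simp only [pow_zero, mul_one, Finset.sum_const, Finset.card_range, nsmul_eq_mul]
    set M := max 0 (Real.log q) with hM
    have hM0 : 0 ≤ M := le_max_left _ _
    have hkb : (k : ℝ) ≤ 1 + (Real.log 4 + M) / (-Real.log lm) := by
      rcases hk with hk | hk
      · rw [hk]; simp; positivity
      · have h3 : lm ≤ lm ^ k * (4 * q) := by
          calc lm = lm * b / b := by field_simp
            _ ≤ lm ^ k * T / b := by gcongr
            _ = lm ^ k * (T / b) := by ring
            _ ≤ _ := by gcongr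
        have h4 := Real.log_le_log h0 h3
        rw [Real.log_mul (by positivity) (by positivity), Real.log_pow, Real.log_mul (by norm_num) hq0.ne'] at h4
        have h5 : Real.log q ≤ M := le_max_right _ _
        rw [← sub_le_iff_le_add', le_div_iff₀ hlog]
        linarith
    rw [hL]
    push_cast
    have e : (Real.log 4 + M) / (-Real.log lm) = (Real.log 4) / (-Real.log lm) + M * (1 / (-Real.log lm)) := by ring
    have p1 : 0 ≤ (Real.log 4) / (-Real.log lm) := by positivity
    have p2 : 0 ≤ 1 / (-Real.log lm) := by positivity
    rw [e] at hkb
    nlinarith [mul_nonneg hM0 p1, mul_nonneg hM0 p2, mul_nonneg hM0 hi1.le]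

set_option maxHeartbeats 800000 in
lemma descent (d n : ℕ) (c B : ℝ) (hc0 : 0 < c) (hB : 0 < B) : ∃ C : ℝ, 0 < C ∧
    ∀ {D : Set (Eu d)} {f : Eu d → ℝ} {N : ℝ} (_ : Camp n D f N) {x v : Eu d}
    {T l : ℝ} (_ : Cone D x v c T) (_ : 0 < l) (_ : l ≤ B * T) (_ : cube x l ⊆ D) {P P₀ : Eu d → ℝ}
    (_ : NearB n f N P x l) (_ : NearB n f N P₀ (x + T • v) (c * T))
    {p : MvPolynomial (Fin d) ℝ} (_ : ∀ y, P y - P₀ y = pv p (y - x))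
    {j : ℕ} (_ : j ≤ n) (w : Eu d),
    |pv (hc j p) w| ≤ C * N * ‖w‖ ^ j * T ^ (n - j) * LL n j (T / l) := by
  rcases lt_or_ge 1 c with hc1 | hc1
  · refine ⟨1, one_pos, ?_⟩
    intro D f N hf x v T l hc
    have := hc.cle; linarith
  have hl0 := lam_pos hc1
  have hl1 := lam_lt hc0
  obtain ⟨C₁, hC₁, h₁⟩ := chain_hc d n c hc0
  set A := max (4 / (lam c * c)) (B / c) with hA
  have hA0 : 0 < A := lt_max_of_lt_left (by positivity)
  have hA1 : 4 / (lam c * c) ≤ A := le_max_left _ _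
  have hA2 : B / c ≤ A := le_max_right _ _
  obtain ⟨C₂, hC₂, h₂⟩ := poly_hc d n (1 / c) (by positivity)
  have hG : ∃ C : ℝ, 0 < C ∧ ∀ j ≤ n, ∀ {T b q : ℝ} (_ : 0 < T) (_ : 0 < b) (_ : T / b ≤ 4 * q) (_ : 0 < q)
    {k : ℕ} (_ : k = 0 ∨ lam c * b ≤ lam c ^ k * T),
    ∑ i ∈ Finset.range (k + 1), (lam c ^ i * T) ^ (n - j) ≤ C * T ^ (n - j) * LL n j q := by
    have : ∀ j : ℕ, ∃ C : ℝ, 0 < C ∧ (j ≤ n → ∀ {T b q : ℝ} (_ : 0 < T) (_ : 0 < b) (_ : T / b ≤ 4 * q) (_ : 0 < q)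
      {k : ℕ} (_ : k = 0 ∨ lam c * b ≤ lam c ^ k * T),
      ∑ i ∈ Finset.range (k + 1), (lam c ^ i * T) ^ (n - j) ≤ C * T ^ (n - j) * LL n j q) := by
      intro j
      by_cases hj : j ≤ n
      · obtain ⟨C, hC, h⟩ := geom_LL n j hj hl0 hl1
        exact ⟨C, hC, fun _ => h⟩
      · exact ⟨1, one_pos, fun h => absurd h hj⟩
    choose C hC h using this
    refine ⟨∑ j ∈ Finset.range (n + 1), C j, Finset.sum_pos (fun j _ => hC j) ⟨0, by simp⟩, ?_⟩
    intro j hj T b q hT hb hq hq0 k hk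
    refine (h j hj hT hb hq hq0 hk).trans ?_
    have : C j ≤ ∑ j ∈ Finset.range (n + 1), C j :=
      Finset.single_le_sum (fun i _ => (hC i).le) (Finset.mem_range.2 (by omega))
    have := one_le_LL n j q
    gcongr
  obtain ⟨C₃, hC₃, h₃⟩ := hG
  set E := C₁ + C₂ * (1 + 1 / c) ^ n * (2 * A ^ (n + d)) with hE
  refine ⟨E * C₃, by positivity, ?_⟩
  intro D f N hf x v T l hcn hl hlB hQ P P₀ hP hP₀ p hPp j hj w
  have hN := hf.nonneg
  have hT := hcn.Tpos
  obtain ⟨k, hk1, hk2⟩ := exists_first hl0 hl1 hT (show 0 < l / 4 by positivity)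
  obtain ⟨PP, hPP0, hPP⟩ := exists_chain hf hcn hP₀
  -- polynomials
  have hq : ∀ i, ∃ p : MvPolynomial (Fin d) ℝ, p.totalDegree ≤ n ∧ ∀ y, PP i y - PP (i + 1) y = pv p (y - x) :=
    fun i => polyLE_center (polyLE_sub (hPP i).1 (hPP (i + 1)).1) x
  choose q hqd hq using hq
  obtain ⟨u, hud, hu⟩ := polyLE_center (polyLE_sub hP.1 (hPP k).1) x
  have hp : p = u - ∑ i ∈ Finset.range k, q i := by
    apply pv_inj
    intro y
    have e1 : pv p y = P (y + x) - P₀ (y + x) := by rw [hPp]; simp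
    have e2 : pv u y = P (y + x) - PP k (y + x) := by rw [hu]; simp
    have e3 : ∀ i, pv (q i) y = PP i (y + x) - PP (i + 1) (y + x) := by intro i; rw [hq]; simp
    have e4 : pv (u - ∑ i ∈ Finset.range k, q i) y = pv u y - ∑ i ∈ Finset.range k, pv (q i) y := by
      rw [← pv_sum]; simp [pv]
    rw [e4, e1, e2]
    simp only [e3]
    rw [Finset.sum_range_sub' (fun i => PP i (y + x)), hPP0]
    ring
  have hpw : pv (hc j p) w = pv (hc j u) w - ∑ i ∈ Finset.range k, pv (hc j (q i)) w := by
    rw [hp, hc, map_sub, map_sum, ← pv_sum]; simp [pv]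
  have t1 : ∀ i ∈ Finset.range k, |pv (hc j (q i)) w| ≤ E * N * ‖w‖ ^ j * (lam c ^ i * T) ^ (n - j) := by
    intro i _
    have hi1 : lam c ^ i ≤ 1 := pow_le_one₀ hl0.le hl1.le
    have hi0 : 0 < lam c ^ i := by positivity
    have hpp := hPP (i + 1)
    rw [pow_succ', mul_assoc] at hpp
    refine (h₁ hf hcn (t := lam c ^ i * T) (by positivity) (by nlinarith) (hPP i) hpp (hqd i) (hq i) hj w).trans ?_
    have : C₁ ≤ E := by
      have : 0 ≤ C₂ * (1 + 1 / c) ^ n * (2 * A ^ (n + d)) := by positivity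
      rw [hE]; linarith
    gcongr
  have t2 : |pv (hc j u) w| ≤ E * N * ‖w‖ ^ j * (lam c ^ k * T) ^ (n - j) := by
    set t := lam c ^ k * T with ht
    have ht0 : 0 < t := by positivity
    have hk1' : lam c ^ k ≤ 1 := pow_le_one₀ hl0.le hl1.le
    have htT : t ≤ T := by rw [ht]; nlinarith
    have hv := hcn.vle
    have hn1 : ‖x + t • v - x‖ ≤ t := by
      rw [add_sub_cancel_left, norm_smul, Real.norm_eq_abs, abs_of_pos ht0]; nlinarith
    have hs1 : cube (x + t • v) (c * t) ⊆ cube x l := by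
      apply cube_subset_cube
      nlinarith
    have hAt : l ≤ A * (c * t) := by
      rcases hk2 with h | h
      · have : t = T := by rw [ht, h]; simp
        rw [this]
        calc l ≤ B * T := hlB
          _ = B / c * (c * T) := by field_simp
          _ ≤ _ := by gcongr
      · calc l = 4 / (lam c * c) * (c * (lam c * (l / 4))) := by field_simp
          _ ≤ _ := by gcongr
    have hAc : c * t ≤ A * (c * t) := by
      have : c * t ≤ l := by nlinarith
      linarith
    have hct : 0 < c * t := by positivity
    have a1 := compare hN hct hl hct hP (hPP k) hAt hAc hs1 subset_rfl (hf.integ _ _ hl hQ)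
      (hf.integ _ _ hct (hcn.sub _ ht0 htT))
    simp only [hu] at a1
    have e : 1 / c * (c * t) = t := by field_simp
    have a2 := h₂ x (x + t • v) (c * t) hct (by rw [e]; exact hn1) u hud j w
    have h5 := av_nonneg (x + t • v) hct (fun y => pv u (y - x))
    refine a2.trans ?_
    have e2 : (‖w‖ / (c * t)) = ‖w‖ * (1 / c) / t := by field_simp
    have e3 : t ^ n = t ^ (n - j) * t ^ j := by rw [← pow_add]; congr 1; omega
    have h6 : (1 / c) ^ j ≤ (1 + 1 / c) ^ n := by
      have : 0 < 1 / c := by positivity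
      calc (1 / c) ^ j ≤ (1 + 1 / c) ^ j := by gcongr; linarith
        _ ≤ _ := pow_le_pow_right₀ (by linarith) hj
    have hct1 : (c * t) ^ n ≤ t ^ n := by gcongr; nlinarith
    calc _ ≤ C₂ * (‖w‖ / (c * t)) ^ j * (2 * A ^ (n + d) * N * (c * t) ^ n) := by gcongr
      _ ≤ C₂ * (‖w‖ / (c * t)) ^ j * (2 * A ^ (n + d) * N * t ^ n) := by gcongr
      _ = C₂ * (1 / c) ^ j * (2 * A ^ (n + d)) * N * ‖w‖ ^ j * t ^ (n - j) := by
          rw [e2, e3, div_pow, mul_pow]; field_simp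
      _ ≤ C₂ * (1 + 1 / c) ^ n * (2 * A ^ (n + d)) * N * ‖w‖ ^ j * t ^ (n - j) := by gcongr
      _ ≤ _ := by
        have : C₂ * (1 + 1 / c) ^ n * (2 * A ^ (n + d)) ≤ E := by rw [hE]; linarith
        gcongr
  rw [hpw]
  have t3 := abs_sub (pv (hc j u) w) (∑ i ∈ Finset.range k, pv (hc j (q i)) w)
  have t4 := (Finset.abs_sum_le_sum_abs (fun i => pv (hc j (q i)) w) (Finset.range k)).trans (Finset.sum_le_sum t1)
  have t5 := h₃ j hj hT (show 0 < l / 4 by positivity) (q := T / l) (by apply le_of_eq; field_simp) (by positivity) hk2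
  have t6 : E * N * ‖w‖ ^ j * ∑ i ∈ Finset.range (k + 1), (lam c ^ i * T) ^ (n - j) ≤
      E * N * ‖w‖ ^ j * (C₃ * T ^ (n - j) * LL n j (T / l)) := by gcongr
  rw [Finset.sum_range_succ, mul_add, Finset.mul_sum] at t6
  have e : E * C₃ * N * ‖w‖ ^ j * T ^ (n - j) * LL n j (T / l) =
    E * N * ‖w‖ ^ j * (C₃ * T ^ (n - j) * LL n j (T / l)) := by ring
  rw [e]
  linarith

/-! ### Almost every point is good -/

lemma good_of_lebesgue {d : ℕ} (hd : 0 < d) {f F : Eu d → ℝ} {x : Eu d} {U : Set (Eu d)} (hU : IsOpen U) (hx : x ∈ U)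
    (hfF : ∀ y ∈ U, F y = f y) (hF : LocallyIntegrable F)
    (h : ∀ m : ℕ, Tendsto (fun q : Eu d × ℝ => ⨍ y in closedBall q.1 (d * q.2), ‖F y - F x‖)
      ((comap Prod.snd (𝓝[>] (0 : ℝ))) ⊓ 𝓟 {q : Eu d × ℝ | ‖q.1 - x‖ ≤ m * q.2}) (𝓝 0)) :
    Good f x := by
  intro A ε hε
  have hd' : (0 : ℝ) < d := by exact_mod_cast hd
  have hd1 : (1 : ℝ) ≤ d := by exact_mod_cast hd
  obtain ⟨m, hm⟩ := exists_nat_ge A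
  obtain ⟨r, hr, hrU⟩ := Metric.isOpen_iff.1 hU x hx
  have hev := (h m).eventually (gt_mem_nhds (show (0 : ℝ) < ε / (2 * d) ^ d by positivity))
  rw [eventually_inf_principal, eventually_comap, eventually_iff, mem_nhdsGT_iff_exists_Ioo_subset] at hev
  obtain ⟨δ, hδ, hsub⟩ := hev
  simp only [mem_Ioi] at hδ
  have hm0 : (0 : ℝ) ≤ m := Nat.cast_nonneg m
  refine ⟨min δ (r / (m + d)), lt_min hδ (by positivity), ?_⟩
  intro z s hs hsδ hz
  have hs1 : s < δ := lt_of_lt_of_le hsδ (min_le_left _ _)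
  have hs2 : s < r / (m + d) := lt_of_lt_of_le hsδ (min_le_right _ _)
  rw [lt_div_iff₀ (by positivity)] at hs2
  have hzm : ‖z - x‖ ≤ m * s := hz.trans (by gcongr)
  have hq := hsub (show s ∈ Ioo 0 δ from ⟨hs, hs1⟩) (z, s) rfl hzm
  simp only at hq
  have hcU : cube z s ⊆ U := by
    intro y hy
    apply hrU
    rw [mem_ball, dist_eq_norm]
    have h1 := norm_sub_le_of_mem_cube hs.le hy
    calc ‖y - x‖ ≤ ‖y - z‖ + ‖z - x‖ := norm_sub_le_norm_sub_add_norm_sub _ _ _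
      _ ≤ d * (s / 2) + m * s := add_le_add h1 hzm
      _ < r := by nlinarith
  have hcb : cube z s ⊆ closedBall z (d * s) := by
    intro y hy
    rw [mem_closedBall, dist_eq_norm]
    have h1 := norm_sub_le_of_mem_cube hs.le hy
    nlinarith
  have hbc : closedBall z (d * s) ⊆ cube z (2 * d * s) := by
    intro y hy
    rw [mem_closedBall, dist_eq_norm] at hy
    apply mem_cube_of_norm; linarith
  have hnt : IntegrableOn (fun y => ‖F y - F x‖) (closedBall z (d * s)) :=
    ((hF.integrableOn_isCompact (isCompact_closedBall _ _)).sub (integrableOn_const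
      (measure_closedBall_lt_top.ne))).norm
  have h1 : av z s (fun y => f y - f x) = (s ^ d)⁻¹ * ∫ y in cube z s, ‖F y - F x‖ := by
    unfold av
    congr 1
    apply setIntegral_congr_fun (measurableSet_cube _ _)
    intro y hy
    simp only [hfF y (hcU hy), hfF x hx, Real.norm_eq_abs]
  rw [h1]
  have h2 : ∫ y in cube z s, ‖F y - F x‖ ≤ ∫ y in closedBall z (d * s), ‖F y - F x‖ :=
    setIntegral_mono_set hnt (ae_of_all _ fun _ => norm_nonneg _) hcb.eventuallyLE
  have hv : volume.real (closedBall z (d * s)) ≤ (2 * d * s) ^ d := by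
    rw [← volume_real_cube z (by positivity : (0 : ℝ) ≤ 2 * d * s)]
    exact measureReal_mono hbc (by rw [volume_cube _ (by positivity)]; exact ENNReal.ofReal_ne_top)
  rw [setAverage_eq, smul_eq_mul] at hq
  have hv0 : 0 < volume.real (closedBall z (d * s)) := by
    apply ENNReal.toReal_pos
    · exact (measure_closedBall_pos _ _ (by positivity)).ne'
    · exact measure_closedBall_lt_top.ne
  rw [inv_mul_lt_iff₀ hv0] at hq
  rw [inv_mul_le_iff₀ (by positivity)]
  calc _ ≤ _ := h2
    _ ≤ (2 * d * s) ^ d * (ε / (2 * d) ^ d) := hq.le.trans (by gcongr)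
    _ = s ^ d * ε := by rw [mul_pow]; field_simp

lemma ae_good {d : ℕ} (hd : 0 < d) {D : Set (Eu d)} (hD : IsOpen D) {f : Eu d → ℝ} (hf : LocallyIntegrableOn f D) :
    ∀ᵐ x ∂(volume.restrict D), Good f x := by
  have hd' : (0 : ℝ) < d := by exact_mod_cast hd
  have hd1 : (1 : ℝ) ≤ d := by exact_mod_cast hd
  obtain ⟨u, hu, hDu, hi⟩ := hf.exists_nat_integrableOn
  set F : ℕ → Eu d → ℝ := fun k => (u k ∩ D).indicator f with hFdef
  have hF : ∀ k, LocallyIntegrable (F k) := fun k =>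
    ((integrable_indicator_iff ((hu k).inter hD).measurableSet).2 (hi k)).locallyIntegrable
  have key : ∀ᵐ x : Eu d, ∀ k m : ℕ,
      Tendsto (fun q : Eu d × ℝ => ⨍ y in closedBall q.1 (d * q.2), ‖F k y - F k x‖)
      ((comap Prod.snd (𝓝[>] (0 : ℝ))) ⊓ 𝓟 {q : Eu d × ℝ | ‖q.1 - x‖ ≤ m * q.2}) (𝓝 0) := by
    rw [ae_all_iff]; intro k; rw [ae_all_iff]; intro m
    filter_upwards [IsUnifLocDoublingMeasure.ae_tendsto_average_norm_sub volume (hF k) m] with x hx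
    apply hx (fun q : Eu d × ℝ => q.1) (fun q : Eu d × ℝ => d * q.2)
    · have h1 : Tendsto (fun s : ℝ => d * s) (𝓝[>] (0 : ℝ)) (𝓝[>] 0) := by
        apply tendsto_nhdsWithin_iff.2
        constructor
        · have : Tendsto (fun s : ℝ => d * s) (𝓝 0) (𝓝 (d * 0)) := (continuous_const_mul _).tendsto 0
          rw [mul_zero] at this
          exact this.mono_left nhdsWithin_le_nhds
        · filter_upwards [self_mem_nhdsWithin] with s hs
          exact mul_pos hd' hs
      exact h1.comp (tendsto_comap.mono_left inf_le_left)
    · have : ∀ᶠ q : Eu d × ℝ in (comap Prod.snd (𝓝[>] (0 : ℝ))) ⊓ 𝓟 {q : Eu d × ℝ | ‖q.1 - x‖ ≤ m * q.2}, 0 < q.2 := by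
        have : Tendsto Prod.snd ((comap (Prod.snd : Eu d × ℝ → ℝ) (𝓝[>] (0 : ℝ))) ⊓ 𝓟 {q : Eu d × ℝ | ‖q.1 - x‖ ≤ m * q.2}) (𝓝[>] (0 : ℝ)) := tendsto_comap.mono_left inf_le_left
        exact this.eventually self_mem_nhdsWithin
      have h2 : ∀ᶠ q : Eu d × ℝ in (comap Prod.snd (𝓝[>] (0 : ℝ))) ⊓ 𝓟 {q : Eu d × ℝ | ‖q.1 - x‖ ≤ m * q.2}, ‖q.1 - x‖ ≤ m * q.2 := by
        apply eventually_inf_principal.2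
        exact Eventually.of_forall fun q h => h
      filter_upwards [this, h2] with q h1 h2
      rw [mem_closedBall, dist_comm, dist_eq_norm]
      refine h2.trans ?_
      have : (0 : ℝ) ≤ m := Nat.cast_nonneg m
      have : 0 ≤ m * q.2 := by positivity
      nlinarith
  rw [ae_restrict_iff' hD.measurableSet]
  filter_upwards [key] with x hx hxD
  obtain ⟨k, hk⟩ := mem_iUnion.1 (hDu hxD)
  exact good_of_lebesgue hd ((hu k).inter hD) ⟨hk, hxD⟩
    (fun y hy => by simp only [hFdef]; rw [indicator_of_mem hy]) (hF k) (hx k)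

/-! ### Cones in Lipschitz domains -/

def HasCones {d : ℕ} (D : Set (Eu d)) (c r0 : ℝ) : Prop :=
  0 < r0 ∧ 0 < c ∧ c ≤ 1 ∧ ∀ a ∈ D, ∃ e : Eu d, ∀ x ∈ D, ‖x - a‖ ≤ r0 → Cone D x e c r0

lemma cone_of_ball {d : ℕ} (hd : 0 < d) {D : Set (Eu d)} {x e : Eu d} {κ r0 : ℝ} (he : ‖e‖ ≤ 1) (h0 : 0 < r0)
    (hκ : 0 < κ) (hκ1 : κ ≤ 1)
    (h : ∀ t, 0 < t → t ≤ r0 → ∀ y, ‖y - (x + t • e)‖ < κ * t → y ∈ D) : Cone D x e (κ / d) r0 := by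
  have hd' : (0 : ℝ) < d := by exact_mod_cast hd
  have hd1 : (1 : ℝ) ≤ d := by exact_mod_cast hd
  refine ⟨by positivity, by rw [div_le_one hd']; linarith, h0, he, ?_⟩
  intro t ht htT y hy
  apply h t ht htT
  have := norm_sub_le_of_mem_cube (by positivity) hy
  have e : d * (κ / d * t / 2) = κ * t / 2 := by field_simp
  rw [e] at this
  have : 0 < κ * t := by positivity
  linarith

lemma lipschitz_cones {d : ℕ} (hd : 0 < d) {D : Set (Eu d)} (hD : IsLipschitzDomain D) :
    ∃ c r0, HasCones D c r0 := by
  obtain ⟨hopen, -, -, δ, R, hδ, hR, H⟩ := hD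
  have hd' : (0 : ℝ) < d := by exact_mod_cast hd
  have hd1 : (1 : ℝ) ≤ d := by exact_mod_cast hd
  set κ : ℝ := 1 / (2 * (1 + δ)) with hκ
  have hκ0 : 0 < κ := by positivity
  have hκ1 : κ ≤ 1 / 2 := by rw [hκ]; apply div_le_div_of_nonneg_left <;> linarith
  refine ⟨κ / d, R / 32, by positivity, by positivity, by rw [div_le_one hd']; linarith, ?_⟩
  intro a ha
  by_cases hcase : ∃ b ∈ frontier D, ‖b - a‖ ≤ R / 8
  · obtain ⟨b, hb, hba⟩ := hcase
    obtain ⟨g, j, A, hgb, hA, hAj, hgD⟩ := H b hb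
    set L := g.toRealAffineIsometryEquiv with hL
    have hgL : ∀ x, g x = L x := fun x => rfl
    set ej : Eu d := EuclideanSpace.single j 1 with hej
    set e : Eu d := L.linearIsometryEquiv.symm ej with he
    have hne : ‖e‖ = 1 := by rw [he, LinearIsometryEquiv.norm_map, hej]; simp
    have hmove : ∀ x w : Eu d, g (x + w) = g x + L.linearIsometryEquiv w := by
      intro x w
      rw [hgL, hgL, add_comm x w]
      have := L.map_vadd x w
      simp only [vadd_eq_add] at this
      rw [this, add_comm]
    have hdist : ∀ x y, ‖g x - g y‖ = ‖x - y‖ := fun x y => by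
      rw [← dist_eq_norm, ← dist_eq_norm, g.isometry.dist_eq]
    refine ⟨e, fun x hx hxa => cone_of_ball hd hne.le (by positivity) hκ0 (by linarith) ?_⟩
    intro t ht htR y hy
    -- everything happens in the window
    have hxb : ‖g x‖ ≤ R / 8 + R / 32 := by
      have : ‖g x‖ = ‖x - b‖ := by rw [← hdist, hgb, sub_zero]
      rw [this]
      calc ‖x - b‖ ≤ ‖x - a‖ + ‖a - b‖ := norm_sub_le_norm_sub_add_norm_sub _ _ _
        _ ≤ _ := by rw [norm_sub_rev a b]; linarith
    have hgy : ‖g y - (g x + t • ej)‖ < κ * t := by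
      have : g x + t • ej = g (x + t • e) := by
        rw [hmove, map_smul, he, LinearIsometryEquiv.apply_symm_apply]
      rw [this, hdist]; exact hy
    have hgx : g x ∈ (g '' D) ∩ cube 0 R := by
      refine ⟨⟨x, hx, rfl⟩, mem_cube_of_norm ?_⟩
      rw [sub_zero]; linarith
    rw [hgD] at hgx
    have hgyn : ‖g y‖ ≤ R / 2 := by
      have h1 : ‖g y‖ ≤ ‖g y - (g x + t • ej)‖ + (‖g x‖ + ‖t • ej‖) := by
        calc ‖g y‖ = ‖(g y - (g x + t • ej)) + (g x + t • ej)‖ := by congr 1; abel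
          _ ≤ _ := (norm_add_le _ _).trans (by gcongr; exact norm_add_le _ _)
      have h2 : ‖t • ej‖ = t := by rw [norm_smul, hej]; simp [abs_of_pos ht]
      rw [h2] at h1
      nlinarith
    have hgym : g y ∈ {x ∈ cube (0 : Eu d) R | A x < x j} := by
      refine ⟨mem_cube_of_norm (by rw [sub_zero]; exact hgyn), ?_⟩
      have h1 : A (g x) < (g x) j := hgx.2
      have h2 : A (g x + t • ej) = A (g x) := by
        apply hAj
        intro i hi
        simp [hej, hi]
      have h3 : |A (g y) - A (g x + t • ej)| ≤ δ * (κ * t) := by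
        have := hA.dist_le_mul (g y) (g x + t • ej)
        rw [Real.dist_eq, dist_eq_norm, Real.coe_toNNReal _ hδ.le] at this
        exact this.trans (by gcongr)
      have h4 : |(g y) j - (g x + t • ej) j| ≤ κ * t := by
        have := abs_coord_le (g y - (g x + t • ej)) j
        simp only [PiLp.sub_apply] at this
        exact this.trans hgy.le
      have h5 : (g x + t • ej) j = (g x) j + t := by simp [hej]
      have h6 : (1 + δ) * κ = 1 / 2 := by rw [hκ]; field_simp
      rw [h2] at h3
      rw [h5] at h4
      have h3' := (abs_le.1 h3).2
      have h4' := (abs_le.1 h4).1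
      have : (1 + δ) * κ * t = t / 2 := by rw [h6]; ring
      nlinarith
    rw [← hgD] at hgym
    obtain ⟨y', hy', hyy⟩ := hgym.1
    rwa [← g.injective hyy]
  · push Not at hcase
    have hball : ball a (R / 8) ⊆ D := by
      have hpre : IsPreconnected (ball a (R / 8)) := (convex_ball a (R / 8)).isPreconnected
      by_contra hcon
      obtain ⟨y, hy, hyD⟩ := Set.not_subset.1 hcon
      have hcl : ∀ b ∈ ball a (R / 8), b ∈ closure D → b ∈ D := by
        intro b hb hbc
        by_contra hbD
        have hbf : b ∈ frontier D := by rw [hopen.frontier_eq]; exact ⟨hbc, hbD⟩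
        rw [mem_ball, dist_eq_norm] at hb
        exact absurd (hcase b hbf) (by linarith)
      obtain ⟨b, -, hb1, hb2⟩ := hpre D (closure D)ᶜ hopen isClosed_closure.isOpen_compl
        (fun b hb => by
          by_cases h : b ∈ closure D
          · exact Or.inl (hcl b hb h)
          · exact Or.inr h)
        ⟨a, mem_ball_self (by positivity), ha⟩ ⟨y, hy, fun h => hyD (hcl y hy h)⟩
      exact hb2 (subset_closure hb1)
    refine ⟨0, fun x hx hxa => cone_of_ball hd (by simp) (by positivity) hκ0 (by linarith) ?_⟩
    intro t ht htR y hy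
    apply hball
    rw [mem_ball, dist_eq_norm]
    rw [smul_zero, add_zero] at hy
    calc ‖y - a‖ ≤ ‖y - x‖ + ‖x - a‖ := norm_sub_le_norm_sub_add_norm_sub _ _ _
      _ < R / 8 := by nlinarith

/-! ### Global bounds for functions in the Zygmund class -/

/-- a function in the Zygmund space on `D`, with norm at most `M` -/
structure Zyg {d : ℕ} (n : ℕ) (D : Set (Eu d)) (f : Eu d → ℝ) (M : ℝ) : Prop where
  camp : Camp n D f M
  integrable : IntegrableOn f D
  l1 : ∫ x in D, |f x| ≤ M

/-- The geometric data we use -/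
structure Geo {d : ℕ} (D : Set (Eu d)) (c r0 Rd : ℝ) : Prop where
  dpos : 0 < d
  opn : IsOpen D
  cones : HasCones D c r0
  Rpos : 0 < Rd
  diam : ∀ x ∈ D, ∀ y ∈ D, ‖x - y‖ ≤ Rd

lemma Geo.side_le {d : ℕ} {D : Set (Eu d)} {c r0 Rd : ℝ} (hG : Geo D c r0 Rd) {x₀ : Eu d} {l : ℝ} (hl : 0 < l)
    (hQ : cube x₀ l ⊆ D) : l ≤ 2 * Rd := by
  have hx : x₀ ∈ D := hQ (mem_cube_of_norm (by simp; linarith))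
  set y : Eu d := x₀ + (l / 2) • EuclideanSpace.single (⟨0, hG.dpos⟩ : Fin d) (1 : ℝ) with hy
  have e : ‖y - x₀‖ = l / 2 := by
    rw [hy, add_sub_cancel_left, norm_smul]; simp; linarith
  have := hG.diam y (hQ (mem_cube_of_norm e.le)) x₀ hx
  linarith

lemma base_av {d n : ℕ} {D : Set (Eu d)} {c r0 : ℝ} (hD : IsOpen D) {f : Eu d → ℝ} {M : ℝ} (hf : Zyg n D f M) {x e : Eu d}
    (hc : Cone D x e c r0) {P : Eu d → ℝ} (hP : NearB n f M P (x + r0 • e) (c * r0)) :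
    av (x + r0 • e) (c * r0) P ≤ (((c * r0) ^ d)⁻¹ + (c * r0) ^ n) * M := by
  have hs : 0 < c * r0 := mul_pos hc.cpos hc.Tpos
  have hsub := hc.sub r0 hc.Tpos le_rfl
  have hfi := hf.camp.integ _ _ hs hsub
  have h1 := av_add_le hs hfi (hfi.sub (polyLE_intOn hP.1 _ _)) (H := P) (fun y _ => by
      have := abs_sub (f y) (f y - P y)
      have e : f y - (f y - P y) = P y := by ring
      rw [e] at this
      simpa using this)
  refine h1.trans ?_
  have h2 : av (x + r0 • e) (c * r0) f ≤ ((c * r0) ^ d)⁻¹ * M := by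
    unfold av
    refine mul_le_mul_of_nonneg_left (le_trans ?_ hf.l1) (by positivity)
    exact setIntegral_mono_set hf.integrable.abs (ae_of_all _ fun _ => abs_nonneg _) hsub.eventuallyLE
  have h3 := hP.2
  have e2 : av (x + r0 • e) (c * r0) (f - P) = av (x + r0 • e) (c * r0) (fun y => f y - P y) := rfl
  rw [e2, add_mul]
  linarith

lemma zyg_sup {d : ℕ} (n : ℕ) (hn : 0 < n) {D : Set (Eu d)} {c r0 Rd : ℝ} (hG : Geo D c r0 Rd) : ∃ C : ℝ, 0 < C ∧
    ∀ {f : Eu d → ℝ} {M : ℝ} (_ : Zyg n D f M) {x : Eu d} (_ : x ∈ D) (_ : Good f x), |f x| ≤ C * M := by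
  obtain ⟨hr0, hc0, hc1, hcone⟩ := hG.cones
  obtain ⟨C₁, hC₁, h₁⟩ := CH1 d n hn c hc0
  obtain ⟨C₂, hC₂, h₂⟩ := poly_point d n
  refine ⟨C₁ * r0 ^ n + C₂ * (1 + 1 / c) ^ n * (((c * r0) ^ d)⁻¹ + (c * r0) ^ n), by positivity, ?_⟩
  intro f M hf x hx hg
  have hM := hf.camp.nonneg
  obtain ⟨e, he⟩ := hcone x hx
  have hc := he x hx (by simp; exact hr0.le)
  have hs : 0 < c * r0 := by positivity
  obtain ⟨P, hP⟩ := hf.camp.near _ _ hs (hc.sub r0 hr0 le_rfl)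
  have a1 := h₁ hf.camp hc hg hP
  have a2 := h₂ P hP.1 (x + r0 • e) (c * r0) hs x
  have a3 := base_av hG.opn hf hc hP
  have a4 : ‖x - (x + r0 • e)‖ / (c * r0) ≤ 1 / c := by
    rw [norm_sub_rev, add_sub_cancel_left, norm_smul, Real.norm_eq_abs, abs_of_pos hr0,
      div_le_div_iff₀ hs hc0]
    have := hc.vle
    have : r0 * ‖e‖ ≤ r0 * 1 := by gcongr
    nlinarith
  have h5 := av_nonneg (x + r0 • e) hs P
  have a5 : |P x| ≤ C₂ * (1 + 1 / c) ^ n * ((((c * r0) ^ d)⁻¹ + (c * r0) ^ n) * M) := by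
    refine a2.trans ?_
    gcongr
  have a6 : |f x| ≤ |f x - P x| + |P x| := by
    have := abs_add_le (f x - P x) (P x)
    simpa using this
  nlinarith

lemma log_bd {r0 l : ℝ} (hr0 : 0 < r0) (hl : 0 < l) :
    1 + max 0 (Real.log (r0 / l)) ≤ (2 + |Real.log r0|) * max 1 (Real.log (1 / l)) := by
  have h1 : (1 : ℝ) ≤ max 1 (Real.log (1 / l)) := le_max_left _ _
  have h2 : Real.log (1 / l) ≤ max 1 (Real.log (1 / l)) := le_max_right _ _
  have h3 := le_abs_self (Real.log r0)
  have h4 := abs_nonneg (Real.log r0)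
  have e : Real.log (r0 / l) = Real.log r0 + Real.log (1 / l) := by
    rw [Real.log_div hr0.ne' hl.ne', Real.log_div one_ne_zero hl.ne', Real.log_one]; ring
  rcases max_cases 0 (Real.log (r0 / l)) with ⟨h, _⟩ | ⟨h, _⟩
  · rw [h]; nlinarith
  · rw [h, e]; nlinarith

/-- the logarithmic factor -/
def lg (n j : ℕ) (l : ℝ) : ℝ := if j < n then 1 else max 1 (Real.log (1 / l))

lemma one_le_lg (n j : ℕ) (l : ℝ) : 1 ≤ lg n j l := by
  unfold lg; split_ifs
  · exact le_rfl
  · exact le_max_left _ _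

lemma zyg_coef {d : ℕ} (n : ℕ) {D : Set (Eu d)} {c r0 Rd : ℝ} (hG : Geo D c r0 Rd) : ∃ C : ℝ, 0 < C ∧
    ∀ {f : Eu d → ℝ} {M : ℝ} (_ : Zyg n D f M) {x₀ : Eu d} {l : ℝ} (_ : 0 < l) (_ : cube x₀ l ⊆ D)
    {P : Eu d → ℝ} (_ : NearB n f M P x₀ l) {p : MvPolynomial (Fin d) ℝ} (_ : ∀ y, P y = pv p (y - x₀))
    {j : ℕ} (_ : j ≤ n) (w : Eu d), |pv (hc j p) w| ≤ C * M * ‖w‖ ^ j * lg n j l := by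
  obtain ⟨hr0, hc0, hc1, hcone⟩ := hG.cones
  have hR := hG.Rpos
  obtain ⟨C₁, hC₁, h₁⟩ := descent d n c (2 * Rd / r0) hc0 (by positivity)
  obtain ⟨C₂, hC₂, h₂⟩ := poly_hc d n (1 / c) (by positivity)
  set E := C₁ * (1 + r0) ^ n * (2 + |Real.log r0|) +
    C₂ * (1 + 1 / (c * r0)) ^ n * (((c * r0) ^ d)⁻¹ + (c * r0) ^ n) with hE
  have hE0 : 0 < E := by positivity
  refine ⟨E, hE0, ?_⟩
  intro f M hf x₀ l hl hQ P hP p hp j hj w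
  have hM := hf.camp.nonneg
  have hx : x₀ ∈ D := hQ (mem_cube_of_norm (by simp; linarith))
  obtain ⟨e, he⟩ := hcone x₀ hx
  have hcn := he x₀ hx (by simp; exact hr0.le)
  have hs : 0 < c * r0 := by positivity
  obtain ⟨P₀, hP₀⟩ := hf.camp.near _ _ hs (hcn.sub r0 hr0 le_rfl)
  obtain ⟨p₀, hp₀d, hp₀⟩ := polyLE_center hP₀.1 x₀
  have hlR := hG.side_le hl hQ
  have a1 := h₁ hf.camp hcn hl (by rw [div_mul_cancel₀ _ hr0.ne']; exact hlR) hQ hP hP₀ (p := p - p₀) (fun y => by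
    rw [hp, hp₀]; simp [pv]) hj w
  have a3 := base_av hG.opn hf hcn hP₀
  simp only [funext hp₀] at a3
  have e1 : 1 / c * (c * r0) = r0 := by field_simp
  have a2 := h₂ x₀ (x₀ + r0 • e) (c * r0) hs (by
    rw [e1, add_sub_cancel_left, norm_smul, Real.norm_eq_abs, abs_of_pos hr0]
    have := hcn.vle
    nlinarith) p₀ hp₀d j w
  have h5 := av_nonneg (x₀ + r0 • e) hs (fun y => pv p₀ (y - x₀))
  have hsum : pv (hc j p) w = pv (hc j (p - p₀)) w + pv (hc j p₀) w := by
    rw [hc, hc, map_sub]; simp [pv]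
  rw [hsum]
  refine (abs_add_le _ _).trans ?_
  have hlg : LL n j (r0 / l) ≤ (2 + |Real.log r0|) * lg n j l := by
    unfold LL lg
    split_ifs
    · have := abs_nonneg (Real.log r0); linarith
    · exact log_bd hr0 hl
  have hlg1 := one_le_lg n j l
  have b1 : r0 ^ (n - j) ≤ (1 + r0) ^ n := by
    calc r0 ^ (n - j) ≤ (1 + r0) ^ (n - j) := by gcongr; linarith
      _ ≤ _ := pow_le_pow_right₀ (by linarith) (by omega)
  have b2 : (1 / (c * r0)) ^ j ≤ (1 + 1 / (c * r0)) ^ n := by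
    have : 0 < 1 / (c * r0) := by positivity
    calc (1 / (c * r0)) ^ j ≤ (1 + 1 / (c * r0)) ^ j := by gcongr; linarith
      _ ≤ _ := pow_le_pow_right₀ (by linarith) hj
  have hLL0 : 0 ≤ LL n j (r0 / l) := by linarith [one_le_LL n j (r0 / l)]
  have c1 : C₁ * M * ‖w‖ ^ j * r0 ^ (n - j) * LL n j (r0 / l) ≤
      C₁ * M * ‖w‖ ^ j * (1 + r0) ^ n * ((2 + |Real.log r0|) * lg n j l) := by gcongr
  have c2 : C₂ * (‖w‖ / (c * r0)) ^ j * av (x₀ + r0 • e) (c * r0) (fun y => pv p₀ (y - x₀)) ≤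
      C₂ * (1 + 1 / (c * r0)) ^ n * (((c * r0) ^ d)⁻¹ + (c * r0) ^ n) * M * ‖w‖ ^ j * lg n j l := by
    have e3 : (‖w‖ / (c * r0)) ^ j = ‖w‖ ^ j * (1 / (c * r0)) ^ j := by rw [← mul_pow]; congr 1; field_simp
    calc _ ≤ C₂ * (‖w‖ ^ j * (1 + 1 / (c * r0)) ^ n) * ((((c * r0) ^ d)⁻¹ + (c * r0) ^ n) * M) := by
          rw [e3]; gcongr
      _ = C₂ * (1 + 1 / (c * r0)) ^ n * (((c * r0) ^ d)⁻¹ + (c * r0) ^ n) * M * ‖w‖ ^ j * 1 := by ring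
      _ ≤ _ := by gcongr
  have e4 : E * M * ‖w‖ ^ j * lg n j l = C₁ * M * ‖w‖ ^ j * (1 + r0) ^ n * ((2 + |Real.log r0|) * lg n j l) +
    C₂ * (1 + 1 / (c * r0)) ^ n * (((c * r0) ^ d)⁻¹ + (c * r0) ^ n) * M * ‖w‖ ^ j * lg n j l := by rw [hE]; ring
  rw [e4]
  linarith

lemma log_le_two_sqrt {y : ℝ} (hy : 0 < y) : Real.log y ≤ 2 * √y := by
  have h := Real.log_le_sub_one_of_pos (Real.sqrt_pos.2 hy)
  rw [Real.log_sqrt hy.le] at h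
  linarith

set_option maxHeartbeats 1600000 in
lemma zyg_growth {d : ℕ} (n : ℕ) (hn : 0 < n) {D : Set (Eu d)} {c r0 Rd : ℝ} (hG : Geo D c r0 Rd) : ∃ C : ℝ, 0 < C ∧
    ∀ {f : Eu d → ℝ} {M : ℝ} (_ : Zyg n D f M) {x₀ : Eu d} {l : ℝ} (_ : 0 < l) (_ : cube x₀ l ⊆ D)
    {P : Eu d → ℝ} (_ : NearB n f M P x₀ l) {x : Eu d} (_ : x ∈ D) (_ : Good f x) {s : ℝ} (_ : l ≤ s)
    (_ : ‖x - x₀‖ ≤ s), |f x - P x| ≤ C * M * s ^ n * √(s / l) := by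
  obtain ⟨hr0, hc0, hc1, hcone⟩ := hG.cones
  have hR := hG.Rpos
  obtain ⟨C₁, hC₁, h₁⟩ := descent d n c 1 hc0 one_pos
  obtain ⟨C₂, hC₂, h₂⟩ := CH1 d n hn c hc0
  obtain ⟨C₃, hC₃, h₃⟩ := poly_point d n
  obtain ⟨C₄, hC₄, h₄⟩ := zyg_sup n hn hG
  obtain ⟨C₅, hC₅, h₅⟩ := zyg_coef n hG
  set κ := 8 / c with hκ
  have hκ0 : 0 < κ := by positivity
  have hκ1 : 1 ≤ κ := by rw [hκ, le_div_iff₀ hc0]; linarith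
  set E₁ := (C₂ + C₃ * (1 + 2 / c) ^ n * (2 * 2 ^ (n + d)) + (n + 1) * C₁ * 3) * κ ^ n * √κ with hE₁
  set ρ := r0 / κ with hρ
  have hρ0 : 0 < ρ := by positivity
  set E₂ := (C₄ * (√(2 * Rd)) + (n + 1) * C₅ * (1 + Rd) ^ n * (2 + √(2 * Rd))) / (ρ ^ n * √ρ) with hE₂
  have hE₁0 : 0 < E₁ := by positivity
  have hE₂0 : 0 < E₂ := by positivity
  refine ⟨E₁ + E₂, by positivity, ?_⟩
  intro f M hf x₀ l hl hQ P hP x hx hg s hls hxs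
  have hM := hf.camp.nonneg
  have hs : 0 < s := by linarith
  have hx0 : x₀ ∈ D := hQ (mem_cube_of_norm (by simp; linarith))
  have hlR := hG.side_le hl hQ
  rcases le_or_gt (κ * s) r0 with hsm | hbg
  · obtain ⟨e, he⟩ := hcone x₀ hx0
    set T := κ * s with hT
    have hT0 : 0 < T := by positivity
    have hcn := (he x₀ hx0 (by simp; exact hr0.le)).mono hT0 hsm
    have hsT : s ≤ T := by rw [hT]; nlinarith
    have hcx := (he x hx (by linarith)).mono hT0 hsm
    have hcT : 0 < c * T := by positivity
    have hcT8 : c * T = 8 * s := by rw [hT, hκ]; field_simp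
    obtain ⟨P₀, hP₀⟩ := hf.camp.near _ _ hcT (hcn.sub T hT0 le_rfl)
    obtain ⟨P₁, hP₁⟩ := hf.camp.near _ _ hcT (hcx.sub T hT0 le_rfl)
    have a1 := h₂ hf.camp hcx hg hP₁
    -- compare P₁ and P₀
    have a2 : |P₁ x - P₀ x| ≤ C₃ * (1 + 2 / c) ^ n * (2 * 2 ^ (n + d)) * M * T ^ n := by
      have s1 : cube (x + T • e) (c * T / 2) ⊆ cube (x + T • e) (c * T) := by
        apply cube_subset_cube; rw [sub_self, norm_zero]; linarith
      have s2 : cube (x + T • e) (c * T / 2) ⊆ cube (x₀ + T • e) (c * T) := by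
        apply cube_subset_cube; rw [add_sub_add_right_eq_sub]; linarith
      have q := compare (A := 2) hM (by positivity) hcT hcT hP₁ hP₀ (by linarith) (by linarith) s1 s2
        (hf.camp.integ _ _ hcT (hcx.sub T hT0 le_rfl)) (hf.camp.integ _ _ hcT (hcn.sub T hT0 le_rfl))
      have q2 := h₃ _ (polyLE_sub hP₁.1 hP₀.1) (x + T • e) (c * T / 2) (by positivity) x
      have q3 : ‖x - (x + T • e)‖ / (c * T / 2) ≤ 2 / c := by
        rw [norm_sub_rev, add_sub_cancel_left, norm_smul, Real.norm_eq_abs, abs_of_pos hT0,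
          div_le_div_iff₀ (by positivity) hc0]
        have := hcx.vle
        have : T * ‖e‖ ≤ T * 1 := by gcongr
        nlinarith
      have h5 := av_nonneg (x + T • e) (show 0 < c * T / 2 by positivity) (fun y => P₁ y - P₀ y)
      refine q2.trans ?_
      calc _ ≤ C₃ * (1 + 2 / c) ^ n * (2 * 2 ^ (n + d) * M * (c * T / 2) ^ n) := by gcongr
        _ ≤ C₃ * (1 + 2 / c) ^ n * (2 * 2 ^ (n + d) * M * T ^ n) := by
            gcongr; nlinarith
        _ = _ := by ring
    have hlog : 1 + max 0 (Real.log (T / l)) ≤ 3 * √(T / l) := by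
      have hq : 0 < T / l := by positivity
      have h1 := log_le_two_sqrt hq
      have h2 : 1 ≤ √(T / l) := by
        apply Real.le_sqrt_of_sq_le; rw [one_pow, le_div_iff₀ hl]; linarith
      rcases max_cases 0 (Real.log (T / l)) with ⟨h, _⟩ | ⟨h, _⟩ <;> rw [h] <;> linarith
    have hsq : 1 ≤ √(T / l) := by
      apply Real.le_sqrt_of_sq_le; rw [one_pow, le_div_iff₀ hl]; linarith
    have a3 : |P x - P₀ x| ≤ (n + 1) * C₁ * 3 * M * T ^ n * √(T / l) := by
      obtain ⟨p, hpd, hp⟩ := polyLE_center (polyLE_sub hP.1 hP₀.1) x₀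
      rw [hp, pv_eq_sum_hc hpd]
      refine (Finset.abs_sum_le_sum_abs _ _).trans ?_
      have : ∀ j ∈ Finset.range (n + 1), |pv (hc j p) (x - x₀)| ≤ C₁ * 3 * M * T ^ n * √(T / l) := by
        intro j hj
        have hj' : j ≤ n := by simp at hj; omega
        refine (h₁ hf.camp hcn hl (by linarith) hQ hP hP₀ hp hj' (x - x₀)).trans ?_
        have e3 : T ^ n = T ^ j * T ^ (n - j) := by rw [← pow_add]; congr 1; omega
        have hLL1 : 0 ≤ LL n j (T / l) := by linarith [one_le_LL n j (T / l)]
        have : LL n j (T / l) ≤ 3 * √(T / l) := (LL_le _ _ _).trans hlog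
        calc _ ≤ C₁ * M * T ^ j * T ^ (n - j) * (3 * √(T / l)) := by
              gcongr; linarith
          _ = _ := by rw [e3]; ring
      refine (Finset.sum_le_sum this).trans (le_of_eq ?_)
      simp; ring
    have e5 : T ^ n * √(T / l) = κ ^ n * √κ * (s ^ n * √(s / l)) := by
      rw [hT, mul_pow, mul_div_assoc, Real.sqrt_mul hκ0.le]; ring
    have tri : |f x - P x| ≤ |f x - P₁ x| + |P₁ x - P₀ x| + |P x - P₀ x| := by
      have e : f x - P x = (f x - P₁ x) + (P₁ x - P₀ x) - (P x - P₀ x) := by ring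
      rw [e]
      have := abs_sub ((f x - P₁ x) + (P₁ x - P₀ x)) (P x - P₀ x)
      have := abs_add_le (f x - P₁ x) (P₁ x - P₀ x)
      linarith
    have b0 : 0 ≤ M * T ^ n := by positivity
    have b1 : C₂ * M * T ^ n ≤ C₂ * (M * (T ^ n * √(T / l))) := by
      have : M * T ^ n * 1 ≤ M * T ^ n * √(T / l) := by gcongr
      nlinarith
    have b2 : C₃ * (1 + 2 / c) ^ n * (2 * 2 ^ (n + d)) * M * T ^ n ≤
        C₃ * (1 + 2 / c) ^ n * (2 * 2 ^ (n + d)) * (M * (T ^ n * √(T / l))) := by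
      have h7 : M * T ^ n * 1 ≤ M * T ^ n * √(T / l) := by gcongr
      calc _ = C₃ * (1 + 2 / c) ^ n * (2 * 2 ^ (n + d)) * (M * T ^ n * 1) := by ring
        _ ≤ C₃ * (1 + 2 / c) ^ n * (2 * 2 ^ (n + d)) * (M * T ^ n * √(T / l)) := by gcongr
        _ = _ := by ring
    calc |f x - P x| ≤ (C₂ + C₃ * (1 + 2 / c) ^ n * (2 * 2 ^ (n + d)) + (n + 1) * C₁ * 3) *
          (M * (T ^ n * √(T / l))) := by nlinarith
      _ = E₁ * M * s ^ n * √(s / l) := by rw [e5, hE₁]; ring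
      _ ≤ _ := by
        have : 0 ≤ E₂ * M * s ^ n * √(s / l) := by positivity
        linarith [add_mul (E₁) E₂ (M * s ^ n * √(s / l))]
  · have hsρ : ρ ≤ s := by rw [hρ, div_le_iff₀ hκ0]; linarith
    have a1 := h₄ hf hx hg
    obtain ⟨p, hpd, hp⟩ := polyLE_center hP.1 x₀
    have hsl : 0 < √l := Real.sqrt_pos.2 hl
    have hs2 : 1 ≤ √(2 * Rd) / √l := by
      rw [one_le_div hsl]; exact Real.sqrt_le_sqrt hlR
    have hlgb : ∀ j, lg n j l ≤ (2 + √(2 * Rd)) / √l := by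
      intro j
      have h0 : 0 < √(2 * Rd) := by positivity
      have h1 := log_le_two_sqrt (show 0 < 1 / l by positivity)
      rw [Real.sqrt_div' _ hl.le, Real.sqrt_one] at h1
      have e : (2 + √(2 * Rd)) / √l = 2 * (1 / √l) + √(2 * Rd) / √l := by ring
      have : 0 < 1 / √l := by positivity
      rw [e]
      unfold lg; split_ifs
      · linarith
      · apply max_le <;> linarith
    have a2 : |P x| ≤ (n + 1) * C₅ * (1 + Rd) ^ n * ((2 + √(2 * Rd)) / √l) * M := by
      rw [hp, pv_eq_sum_hc hpd]
      refine (Finset.abs_sum_le_sum_abs _ _).trans ?_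
      have : ∀ j ∈ Finset.range (n + 1), |pv (hc j p) (x - x₀)| ≤ C₅ * M * (1 + Rd) ^ n * ((2 + √(2 * Rd)) / √l) := by
        intro j hj
        have hj' : j ≤ n := by simp at hj; omega
        refine (h₅ hf hl hQ hP hp hj' (x - x₀)).trans ?_
        have b1 : ‖x - x₀‖ ^ j ≤ (1 + Rd) ^ n := by
          calc ‖x - x₀‖ ^ j ≤ (1 + Rd) ^ j := by gcongr; linarith [hG.diam x hx x₀ hx0]
            _ ≤ _ := pow_le_pow_right₀ (by linarith) hj'
        have := one_le_lg n j l
        have := hlgb j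
        gcongr
      refine (Finset.sum_le_sum this).trans (le_of_eq ?_)
      simp; ring
    have b1 : 1 ≤ s ^ n * √s / (ρ ^ n * √ρ) := by
      rw [one_le_div (by positivity)]
      have := Real.sqrt_le_sqrt hsρ
      gcongr
    have tri : |f x - P x| ≤ |f x| + |P x| := abs_sub _ _
    have e : √(s / l) = √s / √l := Real.sqrt_div' _ hl.le
    have b2 : |f x - P x| ≤ (C₄ * (√(2 * Rd)) + (n + 1) * C₅ * (1 + Rd) ^ n * (2 + √(2 * Rd))) * M / √l := by
      have h7 : C₄ * M * 1 ≤ C₄ * M * (√(2 * Rd) / √l) := by gcongr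
      calc _ ≤ C₄ * M * (√(2 * Rd) / √l) + (n + 1) * C₅ * (1 + Rd) ^ n * ((2 + √(2 * Rd)) / √l) * M := by linarith
        _ = _ := by ring
    have b3 : 0 ≤ (C₄ * (√(2 * Rd)) + (n + 1) * C₅ * (1 + Rd) ^ n * (2 + √(2 * Rd))) * M / √l := by positivity
    calc |f x - P x| ≤ (C₄ * (√(2 * Rd)) + (n + 1) * C₅ * (1 + Rd) ^ n * (2 + √(2 * Rd))) * M / √l * 1 := by linarith
      _ ≤ (C₄ * (√(2 * Rd)) + (n + 1) * C₅ * (1 + Rd) ^ n * (2 + √(2 * Rd))) * M / √l * (s ^ n * √s / (ρ ^ n * √ρ)) := by gcongr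
      _ = E₂ * M * s ^ n * √(s / l) := by rw [hE₂, e]; field_simp
      _ ≤ _ := by
        have : 0 ≤ E₁ * M * s ^ n * √(s / l) := by positivity
        linarith [add_mul (E₁) E₂ (M * s ^ n * √(s / l))]

/-! ### Taylor polynomials and kernel facts -/

def tay {d : ℕ} (n : ℕ) (f : Eu d → ℝ) (x y : Eu d) : ℝ :=
  ∑ k ∈ Finset.range (n + 1), ((k.factorial : ℝ))⁻¹ * iteratedFDeriv ℝ k f x (fun _ => y)

def tc {d : ℕ} (f : Eu d → ℝ) (k : ℕ) (r : Fin k → Fin d) (x : Eu d) : ℝ :=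
  ((k.factorial : ℝ))⁻¹ * iteratedFDeriv ℝ k f x (fun i => EuclideanSpace.single (r i) (1 : ℝ))

lemma taylor_bound {d n : ℕ} {f : Eu d → ℝ} {x y : Eu d} {M : ℝ}
    (hf : ∀ t ∈ Set.Icc (0 : ℝ) 1, ContDiffAt ℝ (n + 1) f (x + t • y))
    (hM : ∀ t ∈ Set.Icc (0 : ℝ) 1, ‖iteratedFDeriv ℝ (n + 1) f (x + t • y)‖ ≤ M) :
    |f (x + y) - tay n f x y| ≤ M * ‖y‖ ^ (n + 1) := by
  rw [map_add_eq_sum_add_integral_iteratedFDeriv hf]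
  have e : (∑ k ∈ Finset.range (n + 1), ((k.factorial : ℝ))⁻¹ • iteratedFDeriv ℝ k f x (fun _ => y)) =
    tay n f x y := rfl
  rw [e, add_sub_cancel_left]
  have hM0 : 0 ≤ M := le_trans (norm_nonneg _) (hM 0 (by simp))
  have h1 : ‖∫ t in (0 : ℝ)..1, (1 - t) ^ n • iteratedFDeriv ℝ (n + 1) f (x + t • y) (fun _ => y)‖ ≤
      M * ‖y‖ ^ (n + 1) * |1 - 0| := by
    apply intervalIntegral.norm_integral_le_of_norm_le_const
    intro t ht
    rw [Set.uIoc_of_le zero_le_one] at ht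
    have ht' : t ∈ Set.Icc (0 : ℝ) 1 := ⟨ht.1.le, ht.2⟩
    rw [norm_smul]
    have h2 : ‖(1 - t) ^ n‖ ≤ 1 := by
      rw [norm_pow]
      apply pow_le_one₀ (norm_nonneg _)
      rw [Real.norm_eq_abs, abs_le]; constructor <;> linarith [ht.1, ht.2]
    have h3 : ‖iteratedFDeriv ℝ (n + 1) f (x + t • y) (fun _ => y)‖ ≤ M * ‖y‖ ^ (n + 1) := by
      refine (ContinuousMultilinearMap.le_opNorm _ _).trans ?_
      simp only [Finset.prod_const, Finset.card_univ, Fintype.card_fin]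
      exact mul_le_mul_of_nonneg_right (hM t ht') (by positivity)
    calc _ ≤ 1 * (M * ‖y‖ ^ (n + 1)) := mul_le_mul h2 h3 (norm_nonneg _) zero_le_one
      _ = _ := one_mul _
  rw [smul_eq_mul, abs_mul]
  rw [sub_zero, abs_one, mul_one, Real.norm_eq_abs] at h1
  have h4 : |((n.factorial : ℝ))⁻¹| ≤ 1 := by
    rw [abs_of_nonneg (by positivity)]
    apply inv_le_one_of_one_le₀
    exact_mod_cast Nat.factorial_pos n
  calc _ ≤ 1 * (M * ‖y‖ ^ (n + 1)) := mul_le_mul h4 h1 (abs_nonneg _) zero_le_one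
    _ = _ := one_mul _

lemma tay_eq {d n : ℕ} (f : Eu d → ℝ) (x y : Eu d) :
    tay n f x y = ∑ k ∈ Finset.range (n + 1), ∑ r : Fin k → Fin d, tc f k r x * ∏ i, y (r i) := by
  unfold tay
  refine Finset.sum_congr rfl fun k _ => ?_
  have hy : y = ∑ j, y j • EuclideanSpace.single j (1 : ℝ) := by
    ext i
    simp [Finset.sum_apply, Pi.single_apply]
  have h1 : iteratedFDeriv ℝ k f x (fun _ => y) =
      ∑ r : Fin k → Fin d, (∏ i, y (r i)) * iteratedFDeriv ℝ k f x (fun i => EuclideanSpace.single (r i) (1 : ℝ)) := by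
    conv_lhs => rw [hy]
    have := (iteratedFDeriv ℝ k f x).toMultilinearMap.map_sum (fun (_ : Fin k) (j : Fin d) => y j • EuclideanSpace.single j (1 : ℝ))
    simp only [ContinuousMultilinearMap.coe_coe] at this
    rw [this]
    refine Finset.sum_congr rfl fun r _ => ?_
    have := (iteratedFDeriv ℝ k f x).toMultilinearMap.map_smul_univ (fun i => y (r i)) (fun i => EuclideanSpace.single (r i) (1 : ℝ))
    simpa using this
  rw [h1, Finset.mul_sum]
  refine Finset.sum_congr rfl fun r _ => ?_
  unfold tc; ring

lemma prod_polyLE {d n k : ℕ} (hk : k ≤ n) (r : Fin k → Fin d) (x₀ : Eu d) :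
    (fun y : Eu d => ∏ i, (y - x₀) (r i)) ∈ PolyLE d n := by
  have : (fun y : Eu d => ∏ i, (y - x₀) (r i)) = fun y => pv (∏ i, MvPolynomial.X (r i)) (y - x₀) := by
    funext y; simp [pv]
  rw [this]
  apply pv_center_mem
  refine (MvPolynomial.totalDegree_finsetProd _ _).trans ?_
  simpa using hk

lemma tay_polyLE {d n : ℕ} (f : Eu d → ℝ) (x : Eu d) : (fun y => tay n f x (y - x)) ∈ PolyLE d n := by
  simp only [tay_eq]
  refine polyLE_sum _ _ fun k hk => ?_
  refine polyLE_sum _ _ fun r _ => ?_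
  exact polyLE_smul _ (prod_polyLE (by simp at hk; omega) r x)

structure Ker (d n : ℕ) (K : Eu d → ℝ) (C : ℝ) : Prop where
  pos : 0 < C
  cont : ContinuousOn K {x | x ≠ 0}
  bd : ∀ z, |K z| ≤ C * (‖z‖ ^ d)⁻¹
  taylor : ∃ kc : (k : ℕ) → (Fin k → Fin d) → Eu d → ℝ,
    (∀ k ≤ n, ∀ r, ContinuousOn (kc k r) {x | x ≠ 0}) ∧
    (∀ k ≤ n, ∀ r, ∃ C', ∀ w, w ≠ 0 → |kc k r w| ≤ C' * (‖w‖ ^ (d + k))⁻¹) ∧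
    ∀ w v : Eu d, w ≠ 0 → ‖v‖ ≤ ‖w‖ / 2 →
      |K (w + v) - ∑ k ∈ Finset.range (n + 1), ∑ r : Fin k → Fin d, kc k r w * ∏ i, v (r i)| ≤
        C * ‖v‖ ^ (n + 1) / ‖w‖ ^ (d + n + 1)
  zero : ∀ a b : ℝ, 0 < a → ∫ z in {z : Eu d | a < ‖z‖ ∧ ‖z‖ < b}, K z = 0

lemma polar_zero {d : ℕ} (hd : 0 < d) {Ω : Eu d → ℝ} (hom : ∀ c : ℝ, 0 < c → ∀ x, Ω (c • x) = Ω x)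
    (mz : ∫ x : Metric.sphere (0 : Eu d) 1, Ω x ∂((volume : Measure (Eu d)).toSphere) = 0) (h : ℝ → ℝ) :
    ∫ z : Eu d, Ω z * h ‖z‖ = 0 := by
  have : Nonempty (Fin d) := ⟨⟨0, hd⟩⟩
  have : Nontrivial (Eu d) := by infer_instance
  calc ∫ z : Eu d, Ω z * h ‖z‖
      = ∫ x : ({(0)}ᶜ : Set (Eu d)), Ω x.1 * h (‖x.1‖) ∂((volume : Measure (Eu d)).comap (↑)) := by
        rw [integral_subtype_comap (measurableSet_singleton _).compl fun x ↦ Ω x * h (‖x‖),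
          restrict_compl_singleton]
    _ = ∫ x : ({(0)}ᶜ : Set (Eu d)), (fun p : Metric.sphere (0 : Eu d) 1 × Set.Ioi (0 : ℝ) => Ω p.1 * h p.2)
          (homeomorphUnitSphereProd (Eu d) x) ∂((volume : Measure (Eu d)).comap (↑)) := by
        refine integral_congr_ae (ae_of_all _ fun x => ?_)
        have hx : 0 < ‖(x : Eu d)‖ := norm_pos_iff.2 x.2
        simp only [homeomorphUnitSphereProd_apply_snd_coe, homeomorphUnitSphereProd_apply_fst_coe]
        rw [hom _ (inv_pos.2 hx)]
    _ = ∫ p, Ω p.1 * h p.2 ∂((volume : Measure (Eu d)).toSphere.prod (Measure.volumeIoiPow (Module.finrank ℝ (Eu d) - 1))) :=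
        ((volume : Measure (Eu d)).measurePreserving_homeomorphUnitSphereProd).integral_comp
          (Homeomorph.measurableEmbedding _)
          (fun p : Metric.sphere (0 : Eu d) 1 × Set.Ioi (0 : ℝ) => Ω p.1 * h p.2)
    _ = 0 := by
        rw [integral_prod_mul (fun s : Metric.sphere (0 : Eu d) 1 => Ω s) (fun r : Set.Ioi (0 : ℝ) => h r), mz, zero_mul]

set_option maxHeartbeats 1600000 in
lemma ker_of {d n : ℕ} (hd : 0 < d) {Ω K : Eu d → ℝ} (hΩ : IsCZDensity d ((n : ℕ∞) + 1) Ω)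
    (hK : K = fun x => Ω x / ‖x‖ ^ d) : ∃ C, Ker d n K C := by
  have hopen : IsOpen {x : Eu d | x ≠ 0} := isOpen_ne
  have hsm : ∀ x : Eu d, x ≠ 0 → ContDiffAt ℝ (n + 1) K x := by
    intro x hx
    rw [hK]
    have h1 : ContDiffAt ℝ (n + 1) Ω x := by
      have := hΩ.smooth.contDiffAt (hopen.mem_nhds hx)
      exact_mod_cast this
    have h2 : ContDiffAt ℝ (n + 1) (fun x : Eu d => ‖x‖ ^ d) x := (contDiffAt_norm ℝ hx).pow d
    exact h1.div h2 (by have := norm_pos_iff.2 hx; positivity)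
  have hcont : ContinuousOn K {x | x ≠ 0} := fun x hx => (hsm x hx).continuousAt.continuousWithinAt
  have hcon2 : ∀ k ≤ n + 1, ContinuousOn (iteratedFDeriv ℝ k K) {x | x ≠ 0} := by
    intro k hk
    have h0 : ContDiffOn ℝ (n + 1) K {x | x ≠ 0} := fun x hx => (hsm x hx).contDiffWithinAt
    have h1 := h0.continuousOn_iteratedFDerivWithin (m := k) (by exact_mod_cast hk) hopen.uniqueDiffOn
    exact h1.congr fun x hx => (iteratedFDerivWithin_of_isOpen k hopen hx).symm
  have hhom : ∀ c : ℝ, 0 < c → ∀ x, K (c • x) = (c ^ d)⁻¹ * K x := by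
    intro c hc x
    simp only [hK]
    rw [hΩ.homog c hc, norm_smul, mul_pow, Real.norm_of_nonneg hc.le]; field_simp
  have hcomp : ∀ (G : Eu d → ℝ), ContinuousOn G {x | x ≠ 0} → ∃ B, 0 < B ∧ ∀ z, 1 / 2 ≤ ‖z‖ → ‖z‖ ≤ 2 → |G z| ≤ B := by
    intro G hGc
    have hcpt : IsCompact {z : Eu d | 1 / 2 ≤ ‖z‖ ∧ ‖z‖ ≤ 2} := by
      refine (isCompact_closedBall (0 : Eu d) 2).of_isClosed_subset ?_ ?_
      · exact (isClosed_le continuous_const continuous_norm).inter (isClosed_le continuous_norm continuous_const)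
      · intro z hz; simpa using hz.2
    obtain ⟨B, hB⟩ := hcpt.exists_bound_of_continuousOn (f := G) (hGc.mono fun z hz h0 => by
      have := hz.1; rw [h0, norm_zero] at this; norm_num at this)
    refine ⟨max B 1, by positivity, fun z h1 h2 => (hB z ⟨h1, h2⟩).trans (le_max_left _ _)⟩
  obtain ⟨B₀, hB₀, hb₀⟩ := hcomp K hcont
  obtain ⟨B₁, hB₁, hb₁⟩ := hcomp _ (hcon2 (n + 1) le_rfl).norm
  have hunit : ∀ w : Eu d, w ≠ 0 → ‖‖w‖⁻¹ • w‖ = 1 := by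
    intro w hw
    rw [norm_smul, norm_inv, norm_norm, inv_mul_cancel₀ (norm_ne_zero_iff.2 hw)]
  have hne : ∀ w : Eu d, w ≠ 0 → ‖w‖⁻¹ • w ≠ 0 := fun w hw h => by
    have := hunit w hw; rw [h, norm_zero] at this; norm_num at this
  refine ⟨max B₀ B₁, by positivity, hcont, ?_, ?_, ?_⟩
  · intro z
    by_cases hz : z = 0
    · subst hz
      have : K 0 = 0 := by simp [hK, hd.ne']
      rw [this, abs_zero]; positivity
    · have hz0 := norm_pos_iff.2 hz
      have e : K z = (‖z‖ ^ d)⁻¹ * K (‖z‖⁻¹ • z) := by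
        rw [← hhom _ hz0, smul_inv_smul₀ hz0.ne']
      rw [e, abs_mul, abs_of_nonneg (by positivity : 0 ≤ (‖z‖ ^ d)⁻¹), mul_comm]
      apply mul_le_mul_of_nonneg_right _ (by positivity)
      exact (hb₀ _ (by rw [hunit z hz]; norm_num) (by rw [hunit z hz]; norm_num)).trans (le_max_left _ _)
  · refine ⟨fun k r w => (‖w‖ ^ (d + k))⁻¹ * tc K k r (‖w‖⁻¹ • w), ?_, ?_, ?_⟩
    · intro k hk r
      have h1 : ContinuousOn (tc K k r) {x | x ≠ 0} := by
        unfold tc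
        refine continuousOn_const.mul ?_
        intro x hx
        exact ((hcon2 k (by omega)) x hx).eval_const _
      have h2 : ContinuousOn (fun w : Eu d => ‖w‖⁻¹ • w) {x | x ≠ 0} :=
        (continuous_norm.continuousOn.inv₀ fun x hx => norm_ne_zero_iff.2 hx).smul continuousOn_id
      refine ContinuousOn.mul ?_ (h1.comp h2 fun w hw => hne w hw)
      exact (continuous_norm.pow _).continuousOn.inv₀ fun x hx =>
        pow_ne_zero _ (norm_ne_zero_iff.2 hx)
    · intro k hk r
      have h1 : ContinuousOn (tc K k r) {x | x ≠ 0} := by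
        unfold tc
        refine continuousOn_const.mul ?_
        intro x hx
        exact ((hcon2 k (by omega)) x hx).eval_const _
      obtain ⟨B, hB, hb⟩ := hcomp _ h1
      refine ⟨B, fun w hw => ?_⟩
      have hw0 := norm_pos_iff.2 hw
      rw [abs_mul, abs_of_nonneg (by positivity : 0 ≤ (‖w‖ ^ (d + k))⁻¹), mul_comm]
      apply mul_le_mul_of_nonneg_right _ (by positivity)
      exact (hb _ (by rw [hunit w hw]; norm_num) (by rw [hunit w hw]; norm_num))
    · intro w v hw hv
      have hw0 := norm_pos_iff.2 hw
      have hnv : ‖‖w‖⁻¹ • v‖ ≤ 1 / 2 := by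
        rw [norm_smul, norm_inv, norm_norm, inv_mul_le_iff₀ hw0]; linarith
      have hseg : ∀ t ∈ Set.Icc (0 : ℝ) 1, 1 / 2 ≤ ‖‖w‖⁻¹ • w + t • ‖w‖⁻¹ • v‖ ∧
          ‖‖w‖⁻¹ • w + t • ‖w‖⁻¹ • v‖ ≤ 2 := by
        intro t ht
        have h3 : ‖t • ‖w‖⁻¹ • v‖ ≤ 1 / 2 := by
          rw [norm_smul, Real.norm_of_nonneg ht.1]
          calc t * ‖‖w‖⁻¹ • v‖ ≤ 1 * (1 / 2) := mul_le_mul ht.2 hnv (norm_nonneg _) zero_le_one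
            _ = _ := one_mul _
        have h4 := norm_add_le (‖w‖⁻¹ • w) (t • ‖w‖⁻¹ • v)
        have h5 := norm_sub_le_norm_add (‖w‖⁻¹ • w) (t • ‖w‖⁻¹ • v)
        rw [hunit w hw] at h4 h5
        constructor <;> linarith
      have hT := taylor_bound (n := n) (f := K) (x := ‖w‖⁻¹ • w) (y := ‖w‖⁻¹ • v) (M := B₁)
        (fun t ht => hsm _ fun h0 => by have := (hseg t ht).1; rw [h0, norm_zero] at this; norm_num at this)
        (fun t ht => by simpa using hb₁ _ (hseg t ht).1 (hseg t ht).2)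
      rw [← smul_add] at hT
      have e1 : K (w + v) = (‖w‖ ^ d)⁻¹ * K (‖w‖⁻¹ • (w + v)) := by
        rw [← hhom _ hw0, smul_inv_smul₀ hw0.ne']
      have e2 : ∑ k ∈ Finset.range (n + 1), ∑ r : Fin k → Fin d,
          (‖w‖ ^ (d + k))⁻¹ * tc K k r (‖w‖⁻¹ • w) * ∏ i, v (r i) =
          (‖w‖ ^ d)⁻¹ * tay n K (‖w‖⁻¹ • w) (‖w‖⁻¹ • v) := by
        rw [tay_eq, Finset.mul_sum]
        refine Finset.sum_congr rfl fun k _ => ?_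
        rw [Finset.mul_sum]
        refine Finset.sum_congr rfl fun r _ => ?_
        simp only [PiLp.smul_apply, smul_eq_mul, Finset.prod_mul_distrib, Finset.prod_const, Finset.card_univ,
          Fintype.card_fin]
        rw [pow_add, mul_inv, inv_pow]; ring
      rw [e1, e2, ← mul_sub, abs_mul, abs_of_nonneg (by positivity : 0 ≤ (‖w‖ ^ d)⁻¹)]
      have e3 : ‖‖w‖⁻¹ • v‖ ^ (n + 1) = ‖v‖ ^ (n + 1) * (‖w‖ ^ (n + 1))⁻¹ := by
        rw [norm_smul, norm_inv, norm_norm, mul_pow, inv_pow, mul_comm]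
      rw [e3] at hT
      calc _ ≤ (‖w‖ ^ d)⁻¹ * (B₁ * (‖v‖ ^ (n + 1) * (‖w‖ ^ (n + 1))⁻¹)) :=
            mul_le_mul_of_nonneg_left hT (by positivity)
        _ = B₁ * ‖v‖ ^ (n + 1) / ‖w‖ ^ (d + n + 1) := by
            rw [add_assoc, pow_add ‖w‖ d]; field_simp
        _ ≤ _ := by gcongr; exact le_max_right _ _
  · intro a b ha
    have hm : MeasurableSet {z : Eu d | a < ‖z‖ ∧ ‖z‖ < b} :=
      ((isOpen_lt continuous_const continuous_norm).inter (isOpen_lt continuous_norm continuous_const)).measurableSet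
    rw [← integral_indicator hm]
    rw [← polar_zero hd hΩ.homog hΩ.meanZero (fun t => (Set.Ioo a b).indicator (fun t => (t ^ d)⁻¹) t)]
    congr 1
    funext z
    by_cases hz : a < ‖z‖ ∧ ‖z‖ < b
    · rw [indicator_of_mem (show z ∈ {z : Eu d | a < ‖z‖ ∧ ‖z‖ < b} from hz), indicator_of_mem (show ‖z‖ ∈ Set.Ioo a b from hz), hK]; rfl
    · rw [indicator_of_notMem (show z ∉ {z : Eu d | a < ‖z‖ ∧ ‖z‖ < b} from hz), indicator_of_notMem (show ‖z‖ ∉ Set.Ioo a b from hz), mul_zero]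

/-! ### Radial integrals -/

def cd (d : ℕ) : ℝ := d * (volume : Measure (Eu d)).real (ball 0 1)

lemma cd_nonneg (d : ℕ) : 0 ≤ cd d := by unfold cd; positivity

lemma radial_int {d : ℕ} (hd : 0 < d) {S : Set ℝ} (hS : MeasurableSet S) (f : ℝ → ℝ) (a : ℝ)
    (hf : ∀ y ∈ S, 0 < y → y ^ (d - 1) * f y = y ^ a) (hi : IntegrableOn (fun y : ℝ => y ^ a) (S ∩ Ioi 0)) :
    IntegrableOn (fun x : Eu d => f ‖x‖) {x | ‖x‖ ∈ S} ∧
    ∫ x in {x : Eu d | ‖x‖ ∈ S}, f ‖x‖ = cd d * ∫ y in S ∩ Ioi 0, y ^ a := by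
  have : Nonempty (Fin d) := ⟨⟨0, hd⟩⟩
  have : Nontrivial (Eu d) := by infer_instance
  have hm : MeasurableSet {x : Eu d | ‖x‖ ∈ S} := measurable_norm hS
  have e0 : (fun x : Eu d => S.indicator f ‖x‖) = {x : Eu d | ‖x‖ ∈ S}.indicator (fun x => f ‖x‖) := by
    funext x; by_cases h : ‖x‖ ∈ S
    · rw [indicator_of_mem h, indicator_of_mem (show x ∈ {x : Eu d | ‖x‖ ∈ S} from h)]
    · rw [indicator_of_notMem h, indicator_of_notMem (show x ∉ {x : Eu d | ‖x‖ ∈ S} from h)]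
  have e1 : ∀ y ∈ Ioi (0 : ℝ), y ^ (Module.finrank ℝ (Eu d) - 1) • S.indicator f y = S.indicator (fun y => y ^ a) y := by
    intro y hy
    by_cases h : y ∈ S
    · rw [indicator_of_mem h, indicator_of_mem h]; simpa using hf y h hy
    · rw [indicator_of_notMem h, indicator_of_notMem h, smul_zero]
  constructor
  · rw [← integrable_indicator_iff hm, ← e0, integrable_fun_norm_addHaar volume (f := S.indicator f)]
    refine IntegrableOn.congr_fun ?_ (fun y hy => (e1 y hy).symm) measurableSet_Ioi
    rw [IntegrableOn, integrable_indicator_iff hS, IntegrableOn, Measure.restrict_restrict hS]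
    exact hi
  · rw [← integral_indicator hm, ← e0, integral_fun_norm_addHaar volume (S.indicator f)]
    rw [setIntegral_congr_fun measurableSet_Ioi e1, integral_indicator hS, Measure.restrict_restrict hS]
    simp [cd, mul_assoc]

lemma pow_sqrt_a {d : ℕ} (hd : 0 < d) {y : ℝ} (hy : 0 < y) :
    y ^ (d - 1) * (√y * (y ^ d)⁻¹) = y ^ (-(1 / 2) : ℝ) := by
  obtain ⟨m, rfl⟩ : ∃ m, d = m + 1 := ⟨d - 1, by omega⟩
  have e : (-(1 / 2) : ℝ) = 1 / 2 - 1 := by norm_num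
  rw [e, Real.rpow_sub hy, ← Real.sqrt_eq_rpow, Real.rpow_one, Nat.add_sub_cancel, pow_succ]
  field_simp

lemma pow_sqrt_b {d : ℕ} (hd : 0 < d) {y : ℝ} (hy : 0 < y) :
    y ^ (d - 1) * (√y * (y ^ (d + 1))⁻¹) = y ^ (-(3 / 2) : ℝ) := by
  obtain ⟨m, rfl⟩ : ∃ m, d = m + 1 := ⟨d - 1, by omega⟩
  have e : (-(3 / 2) : ℝ) = 1 / 2 - 2 := by norm_num
  rw [e, Real.rpow_sub hy, ← Real.sqrt_eq_rpow, Real.rpow_two, Nat.add_sub_cancel, pow_succ, pow_succ]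
  field_simp

lemma rad_in {d : ℕ} (hd : 0 < d) {R : ℝ} (hR : 0 < R) :
    IntegrableOn (fun x : Eu d => √‖x‖ * (‖x‖ ^ d)⁻¹) (ball 0 R) ∧
    ∫ x in ball (0 : Eu d) R, √‖x‖ * (‖x‖ ^ d)⁻¹ ≤ 2 * cd d * √R := by
  have e : Iio R ∩ Ioi 0 = Ioo 0 R := by ext; simp [and_comm]
  have hi : IntegrableOn (fun y : ℝ => y ^ (-(1 / 2) : ℝ)) (Ioc 0 R) := by
    rw [← intervalIntegrable_iff_integrableOn_Ioc_of_le hR.le]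
    exact intervalIntegral.intervalIntegrable_rpow' (by norm_num)
  have h := radial_int hd (S := Iio R) measurableSet_Iio (fun y => √y * (y ^ d)⁻¹) (-(1 / 2))
    (fun y _ hy => pow_sqrt_a hd hy) (by rw [e]; exact hi.mono_set Ioo_subset_Ioc_self)
  have e2 : {x : Eu d | ‖x‖ ∈ Iio R} = ball 0 R := by ext; simp
  rw [e2, e] at h
  refine ⟨h.1, h.2.le.trans ?_⟩
  rw [← integral_Ioc_eq_integral_Ioo, ← intervalIntegral.integral_of_le hR.le, integral_rpow (by left; norm_num)]
  have e3 : (-(1 / 2) + 1 : ℝ) = 1 / 2 := by norm_num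
  rw [e3, ← Real.sqrt_eq_rpow, Real.zero_rpow (by norm_num)]
  apply le_of_eq; ring

lemma rad_out {d : ℕ} (hd : 0 < d) {ρ : ℝ} (hρ : 0 < ρ) :
    IntegrableOn (fun x : Eu d => √‖x‖ * (‖x‖ ^ (d + 1))⁻¹) {x | ρ ≤ ‖x‖} ∧
    ∫ x in {x : Eu d | ρ ≤ ‖x‖}, √‖x‖ * (‖x‖ ^ (d + 1))⁻¹ ≤ 2 * cd d / √ρ := by
  have e : Ici ρ ∩ Ioi 0 = Ici ρ := by ext x; simp; intro h; linarith
  have hi : IntegrableOn (fun y : ℝ => y ^ (-(3 / 2) : ℝ)) (Ioi ρ) :=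
    integrableOn_Ioi_rpow_of_lt (by norm_num) hρ
  have h := radial_int hd (S := Ici ρ) measurableSet_Ici (fun y => √y * (y ^ (d + 1))⁻¹) (-(3 / 2))
    (fun y _ hy => pow_sqrt_b hd hy) (by rw [e]; exact (integrableOn_Ici_iff_integrableOn_Ioi (by simp)).2 hi)
  rw [e] at h
  refine ⟨h.1, h.2.le.trans ?_⟩
  rw [integral_Ici_eq_integral_Ioi, integral_Ioi_rpow_of_lt (by norm_num) hρ]
  have e3 : (-(3 / 2) + 1 : ℝ) = - (1 / 2) := by norm_num
  rw [e3, Real.rpow_neg hρ.le, ← Real.sqrt_eq_rpow]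
  apply le_of_eq; field_simp

lemma rad_in1 {d : ℕ} (hd : 0 < d) {R : ℝ} (hR : 0 < R) :
    ∫⁻ x in ball (0 : Eu d) R, ENNReal.ofReal (‖x‖ * (‖x‖ ^ d)⁻¹) ≤ ENNReal.ofReal (2 * cd d * R) := by
  obtain ⟨h1, h2⟩ := rad_in hd hR
  calc ∫⁻ x in ball (0 : Eu d) R, ENNReal.ofReal (‖x‖ * (‖x‖ ^ d)⁻¹)
      ≤ ∫⁻ x in ball (0 : Eu d) R, ENNReal.ofReal (√R * (√‖x‖ * (‖x‖ ^ d)⁻¹)) := by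
        refine setLIntegral_mono' measurableSet_ball fun x hx => ENNReal.ofReal_le_ofReal ?_
        have hx' : ‖x‖ ≤ R := by simpa using (mem_ball.1 hx).le
        rw [← mul_assoc]
        refine mul_le_mul_of_nonneg_right ?_ (by positivity)
        calc ‖x‖ = √‖x‖ * √‖x‖ := (Real.mul_self_sqrt (norm_nonneg _)).symm
          _ ≤ _ := by gcongr
    _ = ENNReal.ofReal (∫ x in ball (0 : Eu d) R, √R * (√‖x‖ * (‖x‖ ^ d)⁻¹)) := by
        rw [ofReal_integral_eq_lintegral_ofReal (h1.const_mul _) (ae_of_all _ fun x => by positivity)]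
    _ ≤ _ := by
        refine ENNReal.ofReal_le_ofReal ?_
        rw [integral_const_mul]
        calc √R * _ ≤ √R * (2 * cd d * √R) := by gcongr
          _ = 2 * cd d * (√R * √R) := by ring
          _ = _ := by rw [Real.mul_self_sqrt hR.le]

/-! ### Truncated operators and the boundary weight -/

def wk {d : ℕ} (v : Eu d) : ℝ≥0∞ := ENNReal.ofReal ((‖v‖ ^ d)⁻¹)

lemma measurable_wk {d : ℕ} : Measurable (wk : Eu d → ℝ≥0∞) := by
  unfold wk; fun_prop

def WW {d : ℕ} (x₀ : Eu d) (l R : ℝ) (y : Eu d) : ℝ≥0∞ := ∫⁻ x in ball y R \ cube x₀ l, wk (x - y)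

lemma cube_shift_vol {d : ℕ} (x₀ : Eu d) {l : ℝ} (hl : 0 < l) (hd : 0 < d) (v : Eu d) :
    volume {y | y ∈ cube x₀ l ∧ y + v ∉ cube x₀ l} ≤ ENNReal.ofReal (d * l ^ (d - 1) * ‖v‖) := by
  have e0 : l ^ d = l ^ (d - 1) * l := by rw [← pow_succ]; congr 1; omega
  have hd1 : (1 : ℝ) ≤ d := by exact_mod_cast hd
  rcases le_total l ‖v‖ with h | h
  · calc volume {y | y ∈ cube x₀ l ∧ y + v ∉ cube x₀ l} ≤ volume (cube x₀ l) := measure_mono fun y hy => hy.1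
      _ = ENNReal.ofReal (l ^ d) := volume_cube x₀ hl.le
      _ ≤ _ := by
        refine ENNReal.ofReal_le_ofReal ?_
        rw [e0]
        have : 0 ≤ l ^ (d - 1) := by positivity
        calc l ^ (d - 1) * l ≤ l ^ (d - 1) * ‖v‖ := by gcongr
          _ ≤ d * (l ^ (d - 1) * ‖v‖) := le_mul_of_one_le_left (by positivity) hd1
          _ = _ := by ring
  · set Q' := cube (x₀ - (1 / 2 : ℝ) • v) (l - ‖v‖) with hQ'
    have hs1 : Q' ⊆ cube x₀ l := by
      apply cube_subset_cube
      have : ‖x₀ - (1 / 2 : ℝ) • v - x₀‖ = ‖v‖ / 2 := by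
        rw [sub_sub_cancel_left, norm_neg, norm_smul]; norm_num; ring
      rw [this]; linarith
    have hs2 : ∀ y ∈ Q', y + v ∈ cube x₀ l := by
      intro y hy
      rw [hQ', mem_cube] at hy
      rw [mem_cube]
      intro i
      have h1 := hy i
      have h2 := abs_coord_le v i
      simp only [PiLp.sub_apply, PiLp.smul_apply, smul_eq_mul, PiLp.add_apply] at h1 ⊢
      rw [abs_le] at *
      constructor <;> linarith [h1.1, h1.2, h2.1, h2.2]
    calc volume {y | y ∈ cube x₀ l ∧ y + v ∉ cube x₀ l} ≤ volume (cube x₀ l \ Q') :=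
          measure_mono fun y hy => ⟨hy.1, fun hy' => hy.2 (hs2 y hy')⟩
      _ = volume (cube x₀ l) - volume Q' := by
          apply measure_sdiff hs1 (measurableSet_cube _ _).nullMeasurableSet
          rw [hQ', volume_cube _ (by linarith)]; exact ENNReal.ofReal_ne_top
      _ = ENNReal.ofReal (l ^ d - (l - ‖v‖) ^ d) := by
          rw [hQ', volume_cube x₀ hl.le, volume_cube _ (by linarith), ENNReal.ofReal_sub]
          have : 0 ≤ l - ‖v‖ := by linarith
          positivity
      _ ≤ _ := by
          refine ENNReal.ofReal_le_ofReal ?_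
          have h3 : ‖v‖ / l ≤ 1 := by rw [div_le_one hl]; exact h
          have h4 := one_add_mul_le_pow (a := -(‖v‖ / l)) (by linarith) d
          have e1 : l - ‖v‖ = l * (1 + -(‖v‖ / l)) := by field_simp; ring
          rw [e1, mul_pow]
          have h5 : l ^ d * (1 + d * -(‖v‖ / l)) ≤ l ^ d * (1 + -(‖v‖ / l)) ^ d := by gcongr
          have e2 : l ^ d * (1 + d * -(‖v‖ / l)) = l ^ d - d * l ^ (d - 1) * ‖v‖ := by
            rw [e0]; field_simp; ring
          linarith

lemma WW_shift {d : ℕ} (x₀ : Eu d) (l R : ℝ) (y : Eu d) :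
    WW x₀ l R y = ∫⁻ v in ball (0 : Eu d) R, {p : Eu d × Eu d | p.1 + p.2 ∉ cube x₀ l}.indicator (fun p => wk p.2) (y, v) := by
  unfold WW
  rw [← lintegral_indicator (measurableSet_ball.diff (measurableSet_cube _ _)), ← lintegral_indicator measurableSet_ball,
    ← lintegral_add_left_eq_self _ y]
  congr 1
  funext v
  by_cases h1 : v ∈ ball (0 : Eu d) R
  · have h1' : y + v ∈ ball y R := by simpa using h1
    by_cases h2 : y + v ∈ cube x₀ l
    · rw [indicator_of_notMem (by simp [h2]), indicator_of_mem h1, indicator_of_notMem (by simpa using h2)]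
    · rw [indicator_of_mem (show y + v ∈ ball y R \ cube x₀ l from ⟨h1', h2⟩), indicator_of_mem h1, indicator_of_mem (by simpa using h2), add_sub_cancel_left]
  · have h1' : y + v ∉ ball y R := by simpa using h1
    rw [indicator_of_notMem (fun h => h1' h.1), indicator_of_notMem h1]

lemma WW_bound {d : ℕ} (hd : 0 < d) (x₀ : Eu d) {l R : ℝ} (hl : 0 < l) (hR : 0 < R) :
    ∫⁻ y in cube x₀ l, WW x₀ l R y ≤ ENNReal.ofReal (2 * d * cd d * l ^ (d - 1) * R) := by
  have hmS : MeasurableSet {p : Eu d × Eu d | p.1 + p.2 ∉ cube x₀ l} :=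
    (measurable_fst.add measurable_snd) (measurableSet_cube x₀ l).compl
  have hm : Measurable (fun p : Eu d × Eu d => {p : Eu d × Eu d | p.1 + p.2 ∉ cube x₀ l}.indicator (fun p => wk p.2) p) :=
    (measurable_wk.comp measurable_snd).indicator hmS
  simp only [WW_shift]
  rw [lintegral_lintegral_swap hm.aemeasurable]
  calc _ ≤ ∫⁻ v in ball (0 : Eu d) R, ENNReal.ofReal (d * l ^ (d - 1)) * ENNReal.ofReal (‖v‖ * (‖v‖ ^ d)⁻¹) := by
        refine setLIntegral_mono' measurableSet_ball fun v hv => ?_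
        have e : ∀ y, {p : Eu d × Eu d | p.1 + p.2 ∉ cube x₀ l}.indicator (fun p => wk p.2) (y, v) =
            {y | y + v ∉ cube x₀ l}.indicator (fun _ => wk v) y := fun y => by
          by_cases h : y + v ∈ cube x₀ l
          · rw [indicator_of_notMem (by simpa using h), indicator_of_notMem (by simpa using h)]
          · rw [indicator_of_mem (by simpa using h), indicator_of_mem (by simpa using h)]
        have hm2 : MeasurableSet {y : Eu d | y + v ∉ cube x₀ l} :=
          (measurable_id.add_const v) (measurableSet_cube x₀ l).compl
        simp only [e]
        rw [lintegral_indicator hm2, setLIntegral_const, Measure.restrict_apply hm2]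
        have h1 : volume ({y | y + v ∉ cube x₀ l} ∩ cube x₀ l) ≤ ENNReal.ofReal (d * l ^ (d - 1) * ‖v‖) := by
          refine le_trans (measure_mono fun y hy => ?_) (cube_shift_vol x₀ hl hd v)
          exact ⟨hy.2, hy.1⟩
        calc wk v * volume ({y | y + v ∉ cube x₀ l} ∩ cube x₀ l) ≤ wk v * ENNReal.ofReal (d * l ^ (d - 1) * ‖v‖) :=
              mul_le_mul_right h1 _
          _ = _ := by
              unfold wk
              rw [← ENNReal.ofReal_mul (by positivity), ← ENNReal.ofReal_mul (by positivity)]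
              congr 1; ring
    _ ≤ ENNReal.ofReal (d * l ^ (d - 1)) * ENNReal.ofReal (2 * cd d * R) := by
        rw [lintegral_const_mul' _ _ ENNReal.ofReal_ne_top]
        exact mul_le_mul_right (rad_in1 hd hR) _
    _ = _ := by
        rw [← ENNReal.ofReal_mul (by positivity)]; congr 1; ring

def tr {d : ℕ} (D : Set (Eu d)) (K f : Eu d → ℝ) (ε : ℝ) (y : Eu d) : ℝ :=
  ∫ x in {x ∈ D | ε < dist y x}, f x * K (y - x)

lemma Ker.meas {d n : ℕ} {K : Eu d → ℝ} {C : ℝ} (h : Ker d n K C) : Measurable K := by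
  have : MeasurableSet {x : Eu d | x ≠ 0} := isOpen_ne.measurableSet
  refine measurable_of_measurable_on_compl_singleton 0 ?_
  exact (continuousOn_iff_continuous_domRestrict.1 h.cont).measurable

lemma Ker.int {d n : ℕ} {K : Eu d → ℝ} {C : ℝ} (h : Ker d n K C) {u : Eu d → ℝ} {S : Set (Eu d)} (hu : IntegrableOn u S)
    (hS : MeasurableSet S) {y : Eu d} {ε : ℝ} (hε : 0 < ε) (hy : ∀ x ∈ S, ε ≤ dist y x) :
    IntegrableOn (fun x => u x * K (y - x)) S := by
  have h1 : Measurable fun x => K (y - x) := h.meas.comp (measurable_const.sub measurable_id)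
  refine Integrable.mul_bdd (c := C * (ε ^ d)⁻¹) hu h1.aestronglyMeasurable ?_
  refine (ae_restrict_iff' hS).2 (ae_of_all _ fun x hx => ?_)
  refine (h.bd _).trans ?_
  have h2 := hy x hx
  rw [dist_eq_norm] at h2
  have := h.pos
  gcongr

lemma mS_tr {d : ℕ} {D : Set (Eu d)} (hD : IsOpen D) (ε : ℝ) (y : Eu d) : MeasurableSet {x ∈ D | ε < dist y x} :=
  (hD.inter (isOpen_lt continuous_const (continuous_const.dist continuous_id))).measurableSet

lemma tr_int {d n : ℕ} {K : Eu d → ℝ} {C : ℝ} (h : Ker d n K C) {D : Set (Eu d)} (hD : IsOpen D) {u : Eu d → ℝ}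
    (hu : IntegrableOn u D) {ε : ℝ} (hε : 0 < ε) (y : Eu d) :
    IntegrableOn (fun x => u x * K (y - x)) {x ∈ D | ε < dist y x} :=
  h.int (hu.mono_set fun _ hx => hx.1) (mS_tr hD ε y) hε fun _ hx => hx.2.le

lemma tr_lin {d n : ℕ} {K : Eu d → ℝ} {C : ℝ} (h : Ker d n K C) {D : Set (Eu d)} (hD : IsOpen D) {u v : Eu d → ℝ}
    (hu : IntegrableOn u D) (hv : IntegrableOn v D) (a b : ℝ) {ε : ℝ} (hε : 0 < ε) (y : Eu d) :
    tr D K (fun x => a * u x + b * v x) ε y = a * tr D K u ε y + b * tr D K v ε y := by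
  unfold tr
  rw [← integral_const_mul, ← integral_const_mul, ← integral_add ((tr_int h hD hu hε y).const_mul a)
    ((tr_int h hD hv hε y).const_mul b)]
  congr 1; funext x; ring

/-! ### Local estimate -/

lemma lint_ball {d : ℕ} (hd : 0 < d) (y : Eu d) {R : ℝ} (hR : 0 < R) :
    ∫⁻ x in ball y R, ENNReal.ofReal (√‖x - y‖ * (‖x - y‖ ^ d)⁻¹) ≤ ENNReal.ofReal (2 * cd d * √R) := by
  obtain ⟨h1, h2⟩ := rad_in hd hR
  have e : ∫⁻ x in ball y R, ENNReal.ofReal (√‖x - y‖ * (‖x - y‖ ^ d)⁻¹) =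
      ∫⁻ x in ball (0 : Eu d) R, ENNReal.ofReal (√‖x‖ * (‖x‖ ^ d)⁻¹) := by
    rw [← lintegral_indicator measurableSet_ball, ← lintegral_indicator measurableSet_ball,
      ← lintegral_add_left_eq_self _ y]
    congr 1; funext v
    by_cases h1 : v ∈ ball (0 : Eu d) R
    · rw [indicator_of_mem h1, indicator_of_mem (by simpa using h1), add_sub_cancel_left]
    · rw [indicator_of_notMem h1, indicator_of_notMem (by simpa using h1)]
  rw [e, ← ofReal_integral_eq_lintegral_ofReal h1 (ae_of_all _ fun x => by positivity)]
  exact ENNReal.ofReal_le_ofReal h2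

lemma Ker.zero_at {d n : ℕ} {K : Eu d → ℝ} {C : ℝ} (h : Ker d n K C) (y : Eu d) {a : ℝ} (b : ℝ) (ha : 0 < a) :
    ∫ x in {x | a < dist y x ∧ dist y x < b}, K (y - x) = 0 := by
  have hm : MeasurableSet {z : Eu d | a < ‖z‖ ∧ ‖z‖ < b} :=
    ((isOpen_lt continuous_const continuous_norm).inter (isOpen_lt continuous_norm continuous_const)).measurableSet
  have hc : Continuous fun x : Eu d => dist y x := continuous_const.dist continuous_id
  have hm2 : MeasurableSet {x : Eu d | a < dist y x ∧ dist y x < b} :=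
    ((isOpen_lt continuous_const hc).inter (isOpen_lt hc continuous_const)).measurableSet
  rw [← h.zero a b ha, ← integral_indicator hm, ← integral_indicator hm2,
    ← integral_sub_left_eq_self ({z : Eu d | a < ‖z‖ ∧ ‖z‖ < b}.indicator K) volume y]
  refine integral_congr_ae (ae_of_all _ fun x => ?_)
  beta_reduce
  by_cases h1 : a < ‖y - x‖ ∧ ‖y - x‖ < b
  · rw [indicator_of_mem (show y - x ∈ {z : Eu d | a < ‖z‖ ∧ ‖z‖ < b} from h1),
      indicator_of_mem (show x ∈ {x : Eu d | a < dist y x ∧ dist y x < b} by simpa [dist_eq_norm] using h1)]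
  · rw [indicator_of_notMem (show y - x ∉ {z : Eu d | a < ‖z‖ ∧ ‖z‖ < b} from h1),
      indicator_of_notMem (show x ∉ {x : Eu d | a < dist y x ∧ dist y x < b} by simpa [dist_eq_norm] using h1)]

lemma Ker.enorm_le {d n : ℕ} {K : Eu d → ℝ} {C : ℝ} (h : Ker d n K C) (x y : Eu d) {a A : ℝ} (ha : |a| ≤ A) :
    ‖a * K (y - x)‖ₑ ≤ ENNReal.ofReal (A * C) * wk (x - y) := by
  rw [← ofReal_norm, wk, ← ENNReal.ofReal_mul (mul_nonneg ((abs_nonneg _).trans ha) h.pos.le)]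
  refine ENNReal.ofReal_le_ofReal ?_
  rw [norm_mul, mul_assoc, norm_sub_rev x y]
  exact mul_le_mul ha (h.bd _) (norm_nonneg _) ((abs_nonneg _).trans ha)

set_option maxHeartbeats 1600000 in
lemma local_bound {d n : ℕ} (hd : 0 < d) {K : Eu d → ℝ} {CK : ℝ} (hK : Ker d n K CK) : ∃ C : ℝ, 0 < C ∧
    ∀ {D : Set (Eu d)} (_ : IsOpen D) {x₀ : Eu d} {l : ℝ} (_ : 0 < l) (_ : cube x₀ l ⊆ D) {u : Eu d → ℝ}
    (_ : IntegrableOn u D) {B : ℝ} (_ : 0 ≤ B)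
    (_ : ∀ᵐ x ∂volume.restrict D, ‖x - x₀‖ < 2 * d * l → |u x| ≤ B)
    {y : Eu d} (_ : y ∈ cube x₀ l) (_ : |u y| ≤ B)
    (_ : ∀ᵐ x ∂volume.restrict (cube x₀ l), |u x - u y| ≤ B * √(‖x - y‖ / l)) {ε : ℝ} (_ : 0 < ε),
    ‖∫ x in {x ∈ D | ε < dist y x ∧ ‖x - x₀‖ < 2 * d * l}, u x * K (y - x)‖ₑ ≤
      ENNReal.ofReal (C * B) * (1 + WW x₀ l (3 * d * l) y) := by
  have hCK := hK.pos
  have hcd := cd_nonneg d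
  have hd1 : (1 : ℝ) ≤ d := by exact_mod_cast hd
  refine ⟨2 * CK + 2 * CK * cd d * √(3 * d), by positivity, ?_⟩
  intro D hD x₀ l hl hQ u hu B hB hub y hy huy hh ε hε
  have hdl : 0 < d * l := by positivity
  set R := 3 * d * l with hR
  have hR0 : 0 < R := by positivity
  set Q := cube x₀ l with hQdef
  have hQm : MeasurableSet Q := measurableSet_cube _ _
  set S := {x ∈ D | ε < dist y x ∧ ‖x - x₀‖ < 2 * d * l} with hS
  have hc : Continuous fun x : Eu d => dist y x := continuous_const.dist continuous_id
  have hSm : MeasurableSet S := (hD.inter ((isOpen_lt continuous_const hc).inter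
    (isOpen_lt (continuous_id.sub continuous_const).norm continuous_const))).measurableSet
  set E := {x : Eu d | ε < dist y x ∧ dist y x < R} with hE
  have hEm : MeasurableSet E := ((isOpen_lt continuous_const hc).inter (isOpen_lt hc continuous_const)).measurableSet
  have hyx := norm_sub_le_of_mem_cube hl.le hy
  have hSQ : S ∩ Q = E ∩ Q := by
    ext x
    constructor
    · rintro ⟨hx, hxQ⟩
      refine ⟨⟨hx.2.1, ?_⟩, hxQ⟩
      have := norm_sub_le_of_mem_cube hl.le hxQ
      have h2 := dist_triangle_right y x x₀
      rw [dist_eq_norm y x₀, dist_eq_norm x x₀] at h2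
      rw [hR]; linarith
    · rintro ⟨hx, hxQ⟩
      have := norm_sub_le_of_mem_cube hl.le hxQ
      exact ⟨⟨hQ hxQ, hx.1, by linarith⟩, hxQ⟩
  have hSball : S \ Q ⊆ ball y R \ Q := by
    rintro x ⟨hx, hxQ⟩
    refine ⟨?_, hxQ⟩
    have h2 := dist_triangle_right y x x₀
    rw [dist_eq_norm y x₀, dist_eq_norm x x₀] at h2
    rw [mem_ball, dist_comm, hR]
    have := hx.2.2
    linarith
  have hEball : E ⊆ ball y R := fun x hx => by rw [mem_ball, dist_comm]; exact hx.2
  have hSi : IntegrableOn (fun x => u x * K (y - x)) S :=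
    hK.int (hu.mono_set fun _ hx => hx.1) hSm hε fun x hx => hx.2.1.le
  have hEK : IntegrableOn (fun x => K (y - x)) E := by
    have h1 : IntegrableOn (fun _ : Eu d => (1 : ℝ)) E :=
      integrableOn_const (ne_top_of_le_ne_top measure_ball_lt_top.ne (measure_mono hEball))
    have := hK.int h1 hEm hε fun x hx => hx.1.le
    simpa using this
  have hEQK : IntegrableOn (fun x => u y * K (y - x)) (E ∩ Q) := (hEK.mono_set inter_subset_left).const_mul _
  have hEQu : IntegrableOn (fun x => u x * K (y - x)) (E ∩ Q) := by rw [← hSQ]; exact hSi.mono_set inter_subset_left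
  -- far from the cube
  have a1 : ‖∫ x in S \ Q, u x * K (y - x)‖ₑ ≤ ENNReal.ofReal (B * CK) * WW x₀ l R y := by
    refine (enorm_integral_le_lintegral_enorm _).trans ?_
    calc _ ≤ ∫⁻ x in S \ Q, ENNReal.ofReal (B * CK) * wk (x - y) := by
          refine lintegral_mono_ae ?_
          have h1 : ∀ᵐ x ∂volume.restrict (S \ Q), ‖x - x₀‖ < 2 * d * l → |u x| ≤ B :=
            ae_restrict_of_ae_restrict_of_subset (fun x hx => hx.1.1) hub
          filter_upwards [h1, ae_restrict_mem (hSm.diff hQm)] with x hx hxS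
          exact hK.enorm_le x y (hx hxS.1.2.2)
      _ ≤ ∫⁻ x in ball y R \ Q, ENNReal.ofReal (B * CK) * wk (x - y) := lintegral_mono_set hSball
      _ = _ := by rw [lintegral_const_mul' _ _ ENNReal.ofReal_ne_top]; rfl
  have a2 : ‖∫ x in E \ Q, u y * K (y - x)‖ₑ ≤ ENNReal.ofReal (B * CK) * WW x₀ l R y := by
    refine (enorm_integral_le_lintegral_enorm _).trans ?_
    calc _ ≤ ∫⁻ x in E \ Q, ENNReal.ofReal (B * CK) * wk (x - y) :=
          lintegral_mono fun x => hK.enorm_le x y huy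
      _ ≤ ∫⁻ x in ball y R \ Q, ENNReal.ofReal (B * CK) * wk (x - y) :=
          lintegral_mono_set (sdiff_subset_sdiff_left hEball)
      _ = _ := by rw [lintegral_const_mul' _ _ ENNReal.ofReal_ne_top]; rfl
  have a3 : ‖∫ x in E ∩ Q, (u x - u y) * K (y - x)‖ₑ ≤ ENNReal.ofReal (B * CK * (2 * cd d * √(3 * d))) := by
    refine (enorm_integral_le_lintegral_enorm _).trans ?_
    calc _ ≤ ∫⁻ x in E ∩ Q, ENNReal.ofReal (B * CK / √l) * ENNReal.ofReal (√‖x - y‖ * (‖x - y‖ ^ d)⁻¹) := by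
          refine lintegral_mono_ae ?_
          filter_upwards [ae_restrict_of_ae_restrict_of_subset inter_subset_right hh] with x hx
          refine (hK.enorm_le x y hx).trans (le_of_eq ?_)
          rw [wk, ← ENNReal.ofReal_mul (by positivity), ← ENNReal.ofReal_mul (by positivity)]
          congr 1
          rw [Real.sqrt_div' _ hl.le]; ring
      _ ≤ ∫⁻ x in ball y R, ENNReal.ofReal (B * CK / √l) * ENNReal.ofReal (√‖x - y‖ * (‖x - y‖ ^ d)⁻¹) :=
          lintegral_mono_set (inter_subset_left.trans hEball)
      _ ≤ ENNReal.ofReal (B * CK / √l) * ENNReal.ofReal (2 * cd d * √R) := by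
          rw [lintegral_const_mul' _ _ ENNReal.ofReal_ne_top]
          exact mul_le_mul_right (lint_ball hd y hR0) _
      _ = _ := by
          rw [← ENNReal.ofReal_mul (by positivity)]
          congr 1
          rw [hR, Real.sqrt_mul (by positivity)]
          have : √l ≠ 0 := (Real.sqrt_pos.2 hl).ne'
          field_simp
  have e1 : ∫ x in S, u x * K (y - x) = (∫ x in E ∩ Q, (u x - u y) * K (y - x)) - (∫ x in E \ Q, u y * K (y - x)) +
      ∫ x in S \ Q, u x * K (y - x) := by
    rw [← integral_inter_add_sdiff hQm hSi, hSQ]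
    congr 1
    have h1 : ∫ x in E ∩ Q, (u x - u y) * K (y - x) = (∫ x in E ∩ Q, u x * K (y - x)) - ∫ x in E ∩ Q, u y * K (y - x) := by
      rw [← integral_sub hEQu hEQK]; congr 1; funext x; ring
    have h2 := integral_inter_add_sdiff hQm (hEK.const_mul (u y))
    have h3 : ∫ x in E, u y * K (y - x) = 0 := by rw [integral_const_mul, hK.zero_at y R hε, mul_zero]
    rw [h3] at h2
    rw [h1]; linarith
  rw [e1]
  calc _ ≤ ENNReal.ofReal (B * CK * (2 * cd d * √(3 * d))) + ENNReal.ofReal (B * CK) * WW x₀ l R y +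
        ENNReal.ofReal (B * CK) * WW x₀ l R y := by
        refine (enorm_add_le _ _).trans (add_le_add ((enorm_sub_le).trans (add_le_add a3 a2)) a1)
    _ = ENNReal.ofReal (B * CK * (2 * cd d * √(3 * d))) + ENNReal.ofReal (2 * (B * CK)) * WW x₀ l R y := by
        rw [ENNReal.ofReal_mul zero_le_two, add_assoc, ← two_mul, mul_assoc]; simp [mul_assoc]
    _ ≤ ENNReal.ofReal ((2 * CK + 2 * CK * cd d * √(3 * d)) * B) * 1 +
        ENNReal.ofReal ((2 * CK + 2 * CK * cd d * √(3 * d)) * B) * WW x₀ l R y := by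
        rw [mul_one]
        have h0 : 0 ≤ 2 * CK * B := by positivity
        have h1 : 0 ≤ 2 * CK * cd d * √(3 * d) * B := by positivity
        refine add_le_add (ENNReal.ofReal_le_ofReal ?_) (mul_le_mul_left (ENNReal.ofReal_le_ofReal ?_) _)
        · linarith
        · linarith
    _ = _ := by rw [mul_add]

/-! ### Far estimate and combination -/

set_option maxHeartbeats 1600000 in
lemma far_bound {d n : ℕ} (hd : 0 < d) {K : Eu d → ℝ} {CK : ℝ} (hK : Ker d n K CK) : ∃ C : ℝ, 0 < C ∧
    ∀ {D : Set (Eu d)} (_ : IsOpen D) {x₀ : Eu d} {l : ℝ} (_ : 0 < l) {u : Eu d → ℝ}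
    (_ : IntegrableOn u D) {B : ℝ} (_ : 0 ≤ B)
    (_ : ∀ᵐ x ∂volume.restrict D, 2 * d * l ≤ ‖x - x₀‖ → |u x| ≤ B * ‖x - x₀‖ ^ n * √(‖x - x₀‖ / l)),
    ∃ S ∈ PolyLE d n, ∀ y ∈ cube x₀ l,
    |(∫ x in {x ∈ D | 2 * d * l ≤ ‖x - x₀‖}, u x * K (y - x)) - S y| ≤ C * B * l ^ n := by
  have hCK := hK.pos
  have hcd := cd_nonneg d
  have hd1 : (1 : ℝ) ≤ d := by exact_mod_cast hd
  obtain ⟨kc, hkc, hkb, hkt⟩ := hK.taylor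
  refine ⟨CK * d ^ (n + 1) * (2 * cd d) + 1, by positivity, ?_⟩
  intro D hD x₀ l hl u hu B hB hub
  have hdl : 0 < d * l := by positivity
  set ρ := 2 * d * l with hρ
  have hρ0 : 0 < ρ := by positivity
  set F := {x ∈ D | ρ ≤ ‖x - x₀‖} with hF
  have hFm : MeasurableSet F :=
    hD.measurableSet.inter (isClosed_le continuous_const (continuous_id.sub continuous_const).norm).measurableSet
  have huF : IntegrableOn u F := hu.mono_set fun _ hx => hx.1
  have hne : ∀ x ∈ F, x₀ - x ≠ 0 := by
    intro x hx h0
    have h1 := hx.2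
    rw [norm_sub_rev, h0, norm_zero] at h1; linarith
  have hki : ∀ k ≤ n, ∀ r : Fin k → Fin d, IntegrableOn (fun x => u x * kc k r (x₀ - x)) F := by
    intro k hk r
    obtain ⟨C', hC'⟩ := hkb k hk r
    have h1 : ContinuousOn (fun x => kc k r (x₀ - x)) F :=
      (hkc k hk r).comp (continuous_const.sub continuous_id).continuousOn fun x hx => hne x hx
    refine Integrable.mul_bdd (c := |C'| * (ρ ^ (d + k))⁻¹) huF (h1.aestronglyMeasurable hFm) ?_
    refine (ae_restrict_iff' hFm).2 (ae_of_all _ fun x hx => ?_)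
    refine (hC' _ (hne x hx)).trans ?_
    have h3 := hx.2
    rw [norm_sub_rev] at h3
    calc C' * (‖x₀ - x‖ ^ (d + k))⁻¹ ≤ |C'| * (‖x₀ - x‖ ^ (d + k))⁻¹ := by gcongr; exact le_abs_self _
      _ ≤ _ := by gcongr
  refine ⟨fun y => ∑ k ∈ Finset.range (n + 1), ∑ r : Fin k → Fin d,
    (∫ x in F, u x * kc k r (x₀ - x)) * ∏ i, (y - x₀) (r i), ?_, ?_⟩
  · refine polyLE_sum _ _ fun k hk => polyLE_sum _ _ fun r _ => ?_
    exact polyLE_smul _ (prod_polyLE (by simp at hk; omega) r x₀)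
  intro y hy
  have hyx := norm_sub_le_of_mem_cube hl.le hy
  have hKi : IntegrableOn (fun x => u x * K (y - x)) F := by
    refine hK.int huF hFm hdl fun x hx => ?_
    have h2 := dist_triangle_right x x₀ y
    have h3 := hx.2
    rw [dist_eq_norm x x₀, dist_comm x y, dist_comm x₀ y, dist_eq_norm y x₀] at h2
    linarith
  have hTi : ∀ k ∈ Finset.range (n + 1), ∀ r : Fin k → Fin d,
      IntegrableOn (fun x => (u x * kc k r (x₀ - x)) * ∏ i, (y - x₀) (r i)) F := by
    intro k hk r
    exact (hki k (by simp at hk; omega) r).mul_const _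
  have hTi2 : ∀ k ∈ Finset.range (n + 1), IntegrableOn (fun x => ∑ r : Fin k → Fin d, (u x * kc k r (x₀ - x)) * ∏ i, (y - x₀) (r i)) F :=
    fun k hk => integrable_finset_sum _ fun r _ => hTi k hk r
  have e1 : ∑ k ∈ Finset.range (n + 1), ∑ r : Fin k → Fin d,
      (∫ x in F, u x * kc k r (x₀ - x)) * ∏ i, (y - x₀) (r i) =
      ∫ x in F, ∑ k ∈ Finset.range (n + 1), ∑ r : Fin k → Fin d, (u x * kc k r (x₀ - x)) * ∏ i, (y - x₀) (r i) := by
    rw [integral_finset_sum _ hTi2]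
    refine Finset.sum_congr rfl fun k hk => ?_
    rw [integral_finset_sum _ fun r _ => hTi k hk r]
    refine Finset.sum_congr rfl fun r _ => ?_
    rw [integral_mul_const]
  have hTi3 : IntegrableOn (fun x => ∑ k ∈ Finset.range (n + 1), ∑ r : Fin k → Fin d, (u x * kc k r (x₀ - x)) * ∏ i, (y - x₀) (r i)) F :=
    integrable_finset_sum _ hTi2
  beta_reduce
  rw [e1, ← integral_sub hKi hTi3]
  obtain ⟨hr1, hr2⟩ := rad_out hd hρ0
  have hsh : IntegrableOn (fun x => √‖x - x₀‖ * (‖x - x₀‖ ^ (d + 1))⁻¹) {x | ρ ≤ ‖x - x₀‖} ∧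
      ∫ x in {x | ρ ≤ ‖x - x₀‖}, √‖x - x₀‖ * (‖x - x₀‖ ^ (d + 1))⁻¹ ≤ 2 * cd d / √ρ := by
    have hm1 : MeasurableSet {x : Eu d | ρ ≤ ‖x‖} := (isClosed_le continuous_const continuous_norm).measurableSet
    have hm2 : MeasurableSet {x : Eu d | ρ ≤ ‖x - x₀‖} :=
      (isClosed_le continuous_const (continuous_id.sub continuous_const).norm).measurableSet
    have e : ({x : Eu d | ρ ≤ ‖x - x₀‖}.indicator fun x => √‖x - x₀‖ * (‖x - x₀‖ ^ (d + 1))⁻¹) =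
      fun x => ({x : Eu d | ρ ≤ ‖x‖}.indicator fun x => √‖x‖ * (‖x‖ ^ (d + 1))⁻¹) (x - x₀) := by
      funext x; rfl
    constructor
    · rw [← integrable_indicator_iff hm2, e]
      exact ((integrable_indicator_iff hm1).2 hr1).comp_sub_right x₀
    · rw [← integral_indicator hm2, e, integral_sub_right_eq_self _ x₀, integral_indicator hm1]; exact hr2
  set c1 := B * CK * (d * l) ^ (n + 1) / √l with hc1
  have hc10 : 0 ≤ c1 := by positivity
  have hfin : ∫ x in F, c1 * (√‖x - x₀‖ * (‖x - x₀‖ ^ (d + 1))⁻¹) ≤ (CK * d ^ (n + 1) * (2 * cd d) + 1) * B * l ^ n := by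
    calc _ ≤ ∫ x in {x | ρ ≤ ‖x - x₀‖}, c1 * (√‖x - x₀‖ * (‖x - x₀‖ ^ (d + 1))⁻¹) := by
          refine setIntegral_mono_set (hsh.1.const_mul _) (ae_of_all _ fun x => ?_) (HasSubset.Subset.eventuallyLE fun x hx => hx.2)
          show (0 : ℝ) ≤ _
          positivity
      _ ≤ c1 * (2 * cd d / √ρ) := by
          rw [integral_const_mul]; exact mul_le_mul_of_nonneg_left hsh.2 hc10
      _ ≤ c1 * (2 * cd d / √l) := by
          gcongr
          rw [hρ]; nlinarith
      _ = CK * d ^ (n + 1) * (2 * cd d) * B * l ^ n := by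
          rw [hc1, mul_pow]
          have h1 : √l * √l = l := Real.mul_self_sqrt hl.le
          have h2 : √l ≠ 0 := (Real.sqrt_pos.2 hl).ne'
          have : B * CK * (d ^ (n + 1) * l ^ (n + 1)) / √l * (2 * cd d / √l) = B * CK * (d ^ (n + 1) * l ^ (n + 1)) * (2 * cd d) / (√l * √l) := by
            field_simp
          rw [this, h1, pow_succ l n]; field_simp
      _ ≤ _ := by
          have : 0 ≤ B * l ^ n := by positivity
          nlinarith
  refine le_trans ?_ hfin
  rw [← Real.norm_eq_abs]
  refine norm_integral_le_of_norm_le ((hsh.1.mono_set fun x hx => hx.2).const_mul _) ?_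
  filter_upwards [ae_restrict_of_ae_restrict_of_subset (fun x hx => hx.1) hub, ae_restrict_mem hFm] with x hx hxF
  have hs0 : 0 < ‖x - x₀‖ := lt_of_lt_of_le hρ0 hxF.2
  have h1 := hkt (x₀ - x) (y - x₀) (hne x hxF) (by rw [norm_sub_rev x₀ x]; have := hxF.2; linarith)
  have e2 : x₀ - x + (y - x₀) = y - x := by abel
  rw [e2, norm_sub_rev x₀ x] at h1
  have e3 : u x * K (y - x) - ∑ k ∈ Finset.range (n + 1), ∑ r : Fin k → Fin d, (u x * kc k r (x₀ - x)) * ∏ i, (y - x₀) (r i) =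
      u x * (K (y - x) - ∑ k ∈ Finset.range (n + 1), ∑ r : Fin k → Fin d, kc k r (x₀ - x) * ∏ i, (y - x₀) (r i)) := by
    rw [mul_sub, Finset.mul_sum]
    congr 1
    refine Finset.sum_congr rfl fun k _ => ?_
    rw [Finset.mul_sum]
    refine Finset.sum_congr rfl fun r _ => ?_
    ring
  rw [e3, norm_mul, Real.norm_eq_abs, Real.norm_eq_abs]
  have hyx2 : ‖y - x₀‖ ≤ d * l := by linarith
  calc _ ≤ (B * ‖x - x₀‖ ^ n * √(‖x - x₀‖ / l)) * (CK * (d * l) ^ (n + 1) / ‖x - x₀‖ ^ (d + n + 1)) := by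
        refine mul_le_mul (hx hxF.2) (h1.trans ?_) (abs_nonneg _) (by positivity)
        gcongr
    _ = _ := by
        rw [hc1, Real.sqrt_div' _ hl.le, (by ring : d + n + 1 = n + (d + 1)), pow_add ‖x - x₀‖ n]
        field_simp

set_option maxHeartbeats 1600000 in
/-- The main oscillation estimate for `T_D u` on a cube. -/
lemma cz_osc {d n : ℕ} (hd : 0 < d) {K : Eu d → ℝ} {CK : ℝ} (hK : Ker d n K CK) : ∃ C : ℝ, 0 < C ∧
    ∀ {D : Set (Eu d)} (_ : IsOpen D) {x₀ : Eu d} {l : ℝ} (_ : 0 < l) (_ : cube x₀ l ⊆ D) {u : Eu d → ℝ}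
    (_ : IntegrableOn u D) {B : ℝ} (_ : 0 ≤ B)
    (_ : ∀ᵐ x ∂volume.restrict D, ‖x - x₀‖ < 2 * d * l → |u x| ≤ B * l ^ n)
    (_ : ∀ᵐ x ∂volume.restrict D, 2 * d * l ≤ ‖x - x₀‖ → |u x| ≤ B * ‖x - x₀‖ ^ n * √(‖x - x₀‖ / l))
    (_ : ∀ᵐ y ∂volume.restrict (cube x₀ l), |u y| ≤ B * l ^ n ∧ ∀ᵐ x ∂volume.restrict (cube x₀ l),
      |u x - u y| ≤ B * l ^ n * √(‖x - y‖ / l))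
    {g : Eu d → ℝ} (_ : ∀ᵐ y ∂volume.restrict (cube x₀ l), Tendsto (fun ε => tr D K u ε y) (𝓝[>] 0) (𝓝 (g y))),
    ∃ S ∈ PolyLE d n, (∫⁻ y in cube x₀ l, ENNReal.ofReal |g y - S y| ≤ ENNReal.ofReal (C * B * l ^ n * l ^ d)) ∧
      ∀ y ∈ cube x₀ l, |S y| ≤ C * B * l ^ n + C * (l ^ d)⁻¹ * ∫ x in D, |u x| := by
  have hCK := hK.pos
  have hcd := cd_nonneg d
  have hd1 : (1 : ℝ) ≤ d := by exact_mod_cast hd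
  obtain ⟨C₁, hC₁, h₁⟩ := local_bound hd hK
  obtain ⟨C₂, hC₂, h₂⟩ := far_bound hd hK
  refine ⟨(C₂ + C₁ + C₁ * (6 * d ^ 2 * cd d)) + CK, by positivity, ?_⟩
  intro D hD x₀ l hl hQ u hu B hB hu1 hu2 hu3 g hg
  obtain ⟨S, hS, hSb⟩ := h₂ hD (x₀ := x₀) hl hu hB hu2
  have hdl : 0 < d * l := by positivity
  set F := {x ∈ D | 2 * d * l ≤ ‖x - x₀‖} with hF
  have hFm : MeasurableSet F :=
    hD.measurableSet.inter (isClosed_le continuous_const (continuous_id.sub continuous_const).norm).measurableSet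
  have huF : IntegrableOn u F := hu.mono_set fun _ hx => hx.1
  have hfar : ∀ y ∈ cube x₀ l, ∀ x ∈ F, d * l ≤ dist y x - d * l / 2 := by
    intro y hy x hx
    have hyx := norm_sub_le_of_mem_cube hl.le hy
    have h2 := dist_triangle_right x x₀ y
    have h3 := hx.2
    rw [dist_eq_norm x x₀, dist_comm x y, dist_comm x₀ y, dist_eq_norm y x₀] at h2
    linarith
  have hpt : ∀ᵐ y ∂volume.restrict (cube x₀ l), ENNReal.ofReal |g y - S y| ≤
      ENNReal.ofReal (C₂ * B * l ^ n) + ENNReal.ofReal (C₁ * (B * l ^ n)) * (1 + WW x₀ l (3 * d * l) y) := by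
    filter_upwards [hg, hu3, ae_restrict_mem (measurableSet_cube x₀ l)] with y hgy huy hy
    have hlim : Tendsto (fun ε => ENNReal.ofReal |tr D K u ε y - S y|) (𝓝[>] 0) (𝓝 (ENNReal.ofReal |g y - S y|)) :=
      ENNReal.tendsto_ofReal ((hgy.sub_const _).abs)
    refine le_of_tendsto hlim ?_
    filter_upwards [Ioo_mem_nhdsGT hdl] with ε hε
    have hi := tr_int hK hD hu hε.1 y
    have hc : Continuous fun x : Eu d => dist y x := continuous_const.dist continuous_id
    have hG : MeasurableSet {x : Eu d | ‖x - x₀‖ < 2 * d * l} :=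
      (isOpen_lt (continuous_id.sub continuous_const).norm continuous_const).measurableSet
    have e0 : tr D K u ε y = (∫ x in {x ∈ D | ε < dist y x ∧ ‖x - x₀‖ < 2 * d * l}, u x * K (y - x)) +
        ∫ x in F, u x * K (y - x) := by
      unfold tr
      rw [← integral_inter_add_sdiff hG hi]
      have q1 : {x ∈ D | ε < dist y x} ∩ {x : Eu d | ‖x - x₀‖ < 2 * d * l} =
          {x ∈ D | ε < dist y x ∧ ‖x - x₀‖ < 2 * d * l} := by
        ext x; constructor
        · rintro ⟨⟨h1, h2⟩, h3⟩; exact ⟨h1, h2, h3⟩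
        · rintro ⟨h1, h2, h3⟩; exact ⟨⟨h1, h2⟩, h3⟩
      have q2 : {x ∈ D | ε < dist y x} \ {x : Eu d | ‖x - x₀‖ < 2 * d * l} = F := by
        ext x; constructor
        · rintro ⟨⟨h1, h2⟩, h3⟩; exact ⟨h1, not_lt.1 h3⟩
        · rintro ⟨h1, h3⟩
          have := hfar y hy x ⟨h1, h3⟩
          exact ⟨⟨h1, by linarith [hε.2]⟩, not_lt.2 h3⟩
      rw [q1, q2]
    rw [e0, add_sub_assoc]
    have h5 := h₁ hD hl hQ hu (by positivity : 0 ≤ B * l ^ n) hu1 hy huy.1 huy.2 hε.1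
    have h6 := hSb y hy
    calc _ = ‖(∫ x in {x ∈ D | ε < dist y x ∧ ‖x - x₀‖ < 2 * d * l}, u x * K (y - x)) +
          ((∫ x in F, u x * K (y - x)) - S y)‖ₑ := by rw [← ofReal_norm, Real.norm_eq_abs]
      _ ≤ _ := enorm_add_le _ _
      _ ≤ ENNReal.ofReal (C₁ * (B * l ^ n)) * (1 + WW x₀ l (3 * d * l) y) + ENNReal.ofReal (C₂ * B * l ^ n) := by
          refine add_le_add h5 ?_
          rw [← ofReal_norm, Real.norm_eq_abs]
          exact ENNReal.ofReal_le_ofReal h6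
      _ = _ := add_comm _ _
  refine ⟨S, hS, ?_, ?_⟩
  · calc _ ≤ ∫⁻ y in cube x₀ l, (ENNReal.ofReal (C₂ * B * l ^ n) + ENNReal.ofReal (C₁ * (B * l ^ n)) * (1 + WW x₀ l (3 * d * l) y)) :=
          lintegral_mono_ae hpt
      _ = ENNReal.ofReal (C₂ * B * l ^ n) * ENNReal.ofReal (l ^ d) + ENNReal.ofReal (C₁ * (B * l ^ n)) *
          (ENNReal.ofReal (l ^ d) + ∫⁻ y in cube x₀ l, WW x₀ l (3 * d * l) y) := by
          rw [lintegral_add_left measurable_const, lintegral_const_mul' _ _ ENNReal.ofReal_ne_top,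
            lintegral_add_left measurable_const, setLIntegral_const, setLIntegral_const, volume_cube x₀ hl.le, one_mul]
      _ ≤ ENNReal.ofReal (C₂ * B * l ^ n) * ENNReal.ofReal (l ^ d) + ENNReal.ofReal (C₁ * (B * l ^ n)) *
          (ENNReal.ofReal (l ^ d) + ENNReal.ofReal (2 * d * cd d * l ^ (d - 1) * (3 * d * l))) := by
          gcongr
          exact WW_bound hd x₀ hl (by positivity)
      _ = ENNReal.ofReal ((C₂ + C₁ + C₁ * (6 * d ^ 2 * cd d)) * B * l ^ n * l ^ d) := by
          rw [← ENNReal.ofReal_mul (by positivity), ← ENNReal.ofReal_add (by positivity) (by positivity),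
            ← ENNReal.ofReal_mul (by positivity), ← ENNReal.ofReal_add (by positivity) (by positivity)]
          congr 1
          have e0 : l ^ d = l ^ (d - 1) * l := by rw [← pow_succ]; congr 1; omega
          rw [e0]; ring
      _ ≤ _ := by
          refine ENNReal.ofReal_le_ofReal ?_
          have : 0 ≤ CK * B * l ^ n * l ^ d := by positivity
          nlinarith
  · intro y hy
    have h6 := hSb y hy
    have hF2 : |∫ x in F, u x * K (y - x)| ≤ CK * (l ^ d)⁻¹ * ∫ x in D, |u x| := by
      rw [← Real.norm_eq_abs]
      calc _ ≤ ∫ x in F, CK * (l ^ d)⁻¹ * |u x| := by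
            refine norm_integral_le_of_norm_le (huF.abs.const_mul _) ?_
            filter_upwards [ae_restrict_mem hFm] with x hx
            rw [norm_mul, Real.norm_eq_abs, Real.norm_eq_abs, mul_comm]
            refine mul_le_mul_of_nonneg_right ((hK.bd _).trans ?_) (abs_nonneg _)
            have h7 := hfar y hy x hx
            rw [dist_eq_norm] at h7
            have h8 : l ≤ ‖y - x‖ := by nlinarith
            gcongr
        _ ≤ ∫ x in D, CK * (l ^ d)⁻¹ * |u x| := by
            refine setIntegral_mono_set (hu.abs.const_mul _) (ae_of_all _ fun x => ?_) (HasSubset.Subset.eventuallyLE fun x hx => hx.1)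
            show (0 : ℝ) ≤ _
            positivity
        _ = _ := integral_const_mul _ _
    have h9 : |S y| ≤ C₂ * B * l ^ n + CK * (l ^ d)⁻¹ * ∫ x in D, |u x| := by
      have := abs_sub_abs_le_abs_sub (S y) (∫ x in F, u x * K (y - x))
      rw [abs_sub_comm] at this
      linarith
    have hI : 0 ≤ (l ^ d)⁻¹ * ∫ x in D, |u x| := mul_nonneg (by positivity) (integral_nonneg fun _ => abs_nonneg _)
    have hBl : 0 ≤ B * l ^ n := by positivity
    refine h9.trans ?_
    rw [mul_assoc C₂, mul_assoc CK, mul_assoc _ B, mul_assoc _ (l ^ d)⁻¹]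
    have p1 : 0 ≤ C₁ * (6 * d ^ 2 * cd d) := by positivity
    refine add_le_add (mul_le_mul_of_nonneg_right ?_ hBl) (mul_le_mul_of_nonneg_right ?_ hI)
    · linarith
    · linarith

set_option maxHeartbeats 1600000 in
lemma pv_exists {d n : ℕ} (hd : 0 < d) {K : Eu d → ℝ} {CK : ℝ} (hK : Ker d n K CK) {D : Set (Eu d)} (hD : IsOpen D)
    {f : Eu d → ℝ} (hf : IntegrableOn f D) {y : Eu d} (hy : y ∈ D) {L r₁ : ℝ} (hr₁ : 0 < r₁)
    (hh : ∀ x, ‖x - y‖ < r₁ → |f x - f y| ≤ L * √‖x - y‖) :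
    ∃ g, Tendsto (fun ε => tr D K f ε y) (𝓝[>] 0) (𝓝 g) := by
  obtain ⟨r₂, hr₂, hb⟩ := Metric.isOpen_iff.1 hD y hy
  set r := min r₁ r₂ with hr
  have hr0 : 0 < r := lt_min hr₁ hr₂
  have hbD : ball y r ⊆ D := (ball_subset_ball (min_le_right _ _)).trans hb
  have hc : Continuous fun x : Eu d => dist y x := continuous_const.dist continuous_id
  set h : Eu d → ℝ := fun x => f x * K (y - x) - (ball y r).indicator (fun x => f y * K (y - x)) x with hhdef
  have hKm : Measurable fun x => K (y - x) := hK.meas.comp (measurable_const.sub measurable_id)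
  have hmb : MeasurableSet (ball y r) := measurableSet_ball
  have i1 : IntegrableOn h (ball y r) := by
    constructor
    · refine AEStronglyMeasurable.sub ((hf.mono_set hbD).aestronglyMeasurable.mul hKm.aestronglyMeasurable) ?_
      exact ((hKm.const_mul (f y)).indicator hmb).aestronglyMeasurable
    · have hL0 : 0 ≤ max L 0 := le_max_right _ _
      calc ∫⁻ x in ball y r, ‖h x‖ₑ ≤ ∫⁻ x in ball y r, ENNReal.ofReal (max L 0 * CK) *
            ENNReal.ofReal (√‖x - y‖ * (‖x - y‖ ^ d)⁻¹) := by
            refine setLIntegral_mono' hmb fun x hx => ?_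
            have e : h x = (f x - f y) * K (y - x) := by
              simp only [hhdef, indicator_of_mem hx]; ring
            have hx1 : ‖x - y‖ < r₁ := by
              rw [mem_ball, dist_eq_norm] at hx; exact hx.trans_le (min_le_left _ _)
            rw [e, ← ofReal_norm, ← ENNReal.ofReal_mul (mul_nonneg hL0 hK.pos.le)]
            refine ENNReal.ofReal_le_ofReal ?_
            rw [norm_mul, Real.norm_eq_abs, Real.norm_eq_abs]
            have h1 := hh x hx1
            have h2 := hK.bd (y - x)
            rw [norm_sub_rev y x] at h2
            have h3 : |f x - f y| ≤ max L 0 * √‖x - y‖ := h1.trans (mul_le_mul_of_nonneg_right (le_max_left _ _) (Real.sqrt_nonneg _))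
            calc _ ≤ (max L 0 * √‖x - y‖) * (CK * (‖x - y‖ ^ d)⁻¹) :=
                  mul_le_mul h3 h2 (abs_nonneg _) (by positivity)
              _ = _ := by ring
        _ ≤ ENNReal.ofReal (max L 0 * CK) * ENNReal.ofReal (2 * cd d * √r) := by
            rw [lintegral_const_mul' _ _ ENNReal.ofReal_ne_top]
            exact mul_le_mul_right (lint_ball hd y hr0) _
        _ < ⊤ := ENNReal.mul_lt_top ENNReal.ofReal_lt_top ENNReal.ofReal_lt_top
  have i2 : IntegrableOn h (D \ ball y r) := by
    have := hK.int (hf.mono_set (sdiff_subset (t := ball y r))) (hD.measurableSet.diff hmb) hr0 (y := y)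
      (fun x hx => by
        have := hx.2
        rw [mem_ball, not_lt, dist_comm] at this
        exact this)
    refine this.congr_fun (fun x hx => ?_) (hD.measurableSet.diff hmb)
    simp [hhdef, indicator_of_notMem hx.2]
  have i3 : IntegrableOn h D := by
    have := i1.union i2
    rwa [union_sdiff_cancel hbD] at this
  refine ⟨∫ x in D, h x, ?_⟩
  have key : ∀ᶠ ε in 𝓝[>] (0 : ℝ), ∫ x in D, {x | ε < dist y x}.indicator h x = tr D K f ε y := by
    filter_upwards [Ioo_mem_nhdsGT hr0] with ε hε
    have hm : MeasurableSet {x : Eu d | ε < dist y x} := (isOpen_lt continuous_const hc).measurableSet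
    rw [setIntegral_indicator hm]
    have e : D ∩ {x | ε < dist y x} = {x ∈ D | ε < dist y x} := rfl
    rw [e]
    have hEm : MeasurableSet {x : Eu d | ε < dist y x ∧ dist y x < r} :=
      ((isOpen_lt continuous_const hc).inter (isOpen_lt hc continuous_const)).measurableSet
    have hE : {x ∈ D | ε < dist y x} ∩ ball y r = {x : Eu d | ε < dist y x ∧ dist y x < r} := by
      ext x
      constructor
      · rintro ⟨⟨_, h2⟩, h3⟩
        rw [mem_ball, dist_comm] at h3
        exact ⟨h2, h3⟩
      · rintro ⟨h2, h3⟩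
        rw [dist_comm] at h3
        exact ⟨⟨hbD h3, by exact h2⟩, h3⟩
    have j2 : IntegrableOn (fun x => f y * K (y - x)) ({x ∈ D | ε < dist y x} ∩ ball y r) := by
      rw [hE]
      refine hK.int (u := fun _ => f y) (integrableOn_const (ne_top_of_le_ne_top (measure_ball_lt_top (x := y) (r := r)).ne
        (measure_mono fun x hx => ?_))) hEm hε.1 (fun x hx => hx.1.le)
      rw [mem_ball, dist_comm]; exact hx.2
    have j3 : IntegrableOn ((ball y r).indicator (fun x => f y * K (y - x))) {x ∈ D | ε < dist y x} := by
      rw [IntegrableOn, integrable_indicator_iff hmb, IntegrableOn, Measure.restrict_restrict hmb, inter_comm]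
      exact j2
    rw [hhdef, integral_sub (tr_int hK hD hf hε.1 y) j3, setIntegral_indicator hmb, hE, integral_const_mul,
      hK.zero_at y r hε.1, mul_zero, sub_zero]
    rfl
  refine Tendsto.congr' key ?_
  refine tendsto_integral_filter_of_dominated_convergence (fun x => ‖h x‖) ?_ ?_ i3.norm ?_
  · refine Eventually.of_forall fun ε => ?_
    exact i3.aestronglyMeasurable.indicator (isOpen_lt continuous_const hc).measurableSet
  · exact Eventually.of_forall fun ε => ae_of_all _ fun x => norm_indicator_le_norm_self _ _
  · have hne : ∀ᵐ x ∂(volume.restrict D), x ≠ y := by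
      have : Nonempty (Fin d) := ⟨⟨0, hd⟩⟩
      have : Nontrivial (Eu d) := by infer_instance
      refine ae_restrict_of_ae ?_
      rw [ae_iff]; simp
    filter_upwards [hne] with x hx
    refine tendsto_const_nhds.congr' ?_
    have : 0 < dist y x := dist_pos.2 (Ne.symm hx)
    filter_upwards [Ioo_mem_nhdsGT this] with ε hε
    rw [indicator_of_mem]
    exact hε.2

/-- For a function that is locally Lipschitz near every point of `D`, a restricted operator value exists. -/
lemma restr_exists {d n : ℕ} (hd : 0 < d) {K : Eu d → ℝ} {CK : ℝ} (hK : Ker d n K CK) {D : Set (Eu d)} (hD : IsOpen D)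
    {f : Eu d → ℝ} (hf : IntegrableOn f D) (hs : ContDiff ℝ 1 f) :
    ∃ g, IsRestrictedCZ D K f g := by
  classical
  have h : ∀ y ∈ D, ∃ g, Tendsto (fun ε => tr D K f ε y) (𝓝[>] 0) (𝓝 g) := by
    intro y hy
    obtain ⟨L, t, ht, hL⟩ := hs.contDiffAt.exists_lipschitzOnWith (x := y)
    obtain ⟨r, hr, hb⟩ := Metric.mem_nhds_iff.1 ht
    refine pv_exists hd hK hD hf hy (L := L) (r₁ := min r 1) (lt_min hr one_pos) fun x hx => ?_
    have h1 := hL.dist_le_mul x (hb (by rw [mem_ball, dist_eq_norm]; exact hx.trans_le (min_le_left _ _))) y (hb (mem_ball_self hr))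
    rw [Real.dist_eq, dist_eq_norm] at h1
    refine h1.trans (mul_le_mul_of_nonneg_left ?_ L.2)
    exact Real.le_sqrt_of_sq_le (by nlinarith [norm_nonneg (x - y), hx.trans_le (min_le_right r 1)])
  choose! g hg using h
  refine ⟨D.indicator g, fun y hy => indicator_of_notMem hy _, ?_⟩
  filter_upwards [ae_restrict_mem hD.measurableSet] with y hy
  rw [indicator_of_mem hy]
  exact hg y hy

lemma tr_meas {d n : ℕ} {K : Eu d → ℝ} {CK : ℝ} (hK : Ker d n K CK) {D : Set (Eu d)} (hD : IsOpen D)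
    {f : Eu d → ℝ} (hf : IntegrableOn f D) (ε : ℝ) : StronglyMeasurable (fun y => tr D K f ε y) := by
  set F := hf.aestronglyMeasurable.mk f with hF
  have hFm : StronglyMeasurable F := hf.aestronglyMeasurable.stronglyMeasurable_mk
  have hm : MeasurableSet {p : Eu d × Eu d | ε < dist p.1 p.2} :=
    (isOpen_lt continuous_const (continuous_fst.dist continuous_snd)).measurableSet
  have h1 : StronglyMeasurable ({p : Eu d × Eu d | ε < dist p.1 p.2}.indicator fun p => F p.2 * K (p.1 - p.2)) := by
    refine StronglyMeasurable.indicator ?_ hm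
    exact ((hFm.measurable.comp measurable_snd).mul (hK.meas.comp (measurable_fst.sub measurable_snd))).stronglyMeasurable
  have h2 := h1.integral_prod_right' (ν := volume.restrict D)
  convert h2 using 2 with y
  unfold tr
  have e : {x ∈ D | ε < dist y x} = D ∩ {x | ε < dist y x} := rfl
  have hm2 : MeasurableSet {x : Eu d | ε < dist y x} :=
    (isOpen_lt continuous_const (continuous_const.dist continuous_id)).measurableSet
  rw [e, ← setIntegral_indicator hm2]
  refine integral_congr_ae ?_
  filter_upwards [hf.aestronglyMeasurable.ae_eq_mk] with x hx
  by_cases hx2 : ε < dist y x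
  · rw [indicator_of_mem (show x ∈ {x : Eu d | ε < dist y x} from hx2),
      indicator_of_mem (show (y, x) ∈ {p : Eu d × Eu d | ε < dist p.1 p.2} from hx2), hx]
  · rw [indicator_of_notMem (show x ∉ {x : Eu d | ε < dist y x} from hx2),
      indicator_of_notMem (show (y, x) ∉ {p : Eu d × Eu d | ε < dist p.1 p.2} from hx2)]

lemma restr_meas {d n : ℕ} {K : Eu d → ℝ} {CK : ℝ} (hK : Ker d n K CK) {D : Set (Eu d)} (hD : IsOpen D)
    {f g : Eu d → ℝ} (hf : IntegrableOn f D) (hg : IsRestrictedCZ D K f g) :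
    AEStronglyMeasurable g (volume.restrict D) :=
  aestronglyMeasurable_of_tendsto_ae (𝓝[>] (0 : ℝ)) (f := fun ε y => tr D K f ε y)
    (fun ε => (tr_meas hK hD hf ε).aestronglyMeasurable) hg.2

/-- Campanato condition in terms of lower integrals. -/
def LCamp {d : ℕ} (n : ℕ) (D : Set (Eu d)) (g : Eu d → ℝ) (A : ℝ) : Prop :=
  ∀ (z : Eu d) (s : ℝ), 0 < s → cube z s ⊆ D → ∃ P ∈ PolyLE d n,
    ∫⁻ y in cube z s, ENNReal.ofReal |g y - P y| ≤ ENNReal.ofReal (A * s ^ n * s ^ d)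

lemma lcamp_seminorm {d n : ℕ} {D : Set (Eu d)} {g : Eu d → ℝ} {A : ℝ} (hA : 0 ≤ A) (h : LCamp n D g A) :
    zygSeminorm (fun t => t ^ n) n D g ≤ ENNReal.ofReal A := by
  unfold zygSeminorm
  refine iSup_le fun z => iSup_le fun s => iSup_le fun hs => iSup_le fun hQ => ?_
  obtain ⟨P, hP, hb⟩ := h z s hs hQ
  refine (iInf₂_le P hP).trans ?_
  have h1 : 0 < s ^ n * s ^ d := by positivity
  calc _ ≤ (ENNReal.ofReal (s ^ n * s ^ d))⁻¹ * ENNReal.ofReal (A * s ^ n * s ^ d) := mul_le_mul_right hb _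
    _ = ENNReal.ofReal A := by
      rw [← ENNReal.ofReal_inv_of_pos h1, ← ENNReal.ofReal_mul (by positivity)]
      congr 1; field_simp

lemma seminorm_lcamp {d n : ℕ} {D : Set (Eu d)} {g : Eu d → ℝ} {A : ℝ}
    (h : zygSeminorm (fun t => t ^ n) n D g < ENNReal.ofReal A) : LCamp n D g A := by
  intro z s hs hQ
  have h1 : (⨅ (P : EuclideanSpace ℝ (Fin d) → ℝ) (_ : P ∈ PolyLE d n),
      (ENNReal.ofReal (s ^ n * s ^ d))⁻¹ * ∫⁻ x in cube z s, ENNReal.ofReal |g x - P x|) < ENNReal.ofReal A := by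
    refine lt_of_le_of_lt ?_ h
    unfold zygSeminorm
    exact le_iSup_of_le z (le_iSup_of_le s (le_iSup_of_le hs (le_iSup_of_le hQ le_rfl)))
  obtain ⟨P, hP⟩ := iInf_lt_iff.1 h1
  obtain ⟨hP1, hP2⟩ := iInf_lt_iff.1 hP
  refine ⟨P, hP1, ?_⟩
  have h2 : 0 < s ^ n * s ^ d := by positivity
  have hA : 0 < A := ENNReal.ofReal_pos.1 (lt_of_le_of_lt bot_le hP2)
  have h3 := mul_le_mul_right hP2.le (ENNReal.ofReal (s ^ n * s ^ d))
  rw [← mul_assoc, ENNReal.mul_inv_cancel (by simpa using h2) ENNReal.ofReal_ne_top, one_mul,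
    ← ENNReal.ofReal_mul h2.le] at h3
  refine h3.trans_eq ?_
  congr 1; ring

lemma aesm_poly {d n : ℕ} {P : Eu d → ℝ} (hP : P ∈ PolyLE d n) (μ : Measure (Eu d)) : AEStronglyMeasurable P μ :=
  (polyLE_continuous hP).aestronglyMeasurable

lemma lint_eq {d : ℕ} {F : Eu d → ℝ} {S : Set (Eu d)} (hF : IntegrableOn F S) :
    ∫⁻ y in S, ENNReal.ofReal |F y| = ENNReal.ofReal (∫ y in S, |F y|) := by
  rw [ofReal_integral_eq_lintegral_ofReal hF.abs (ae_of_all _ fun x => abs_nonneg _)]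

lemma intOn_of_lint {d : ℕ} {F : Eu d → ℝ} {S : Set (Eu d)} (hm : AEStronglyMeasurable F (volume.restrict S))
    (h : ∫⁻ y in S, ENNReal.ofReal |F y| < ⊤) : IntegrableOn F S := by
  refine ⟨hm, ?_⟩
  rw [HasFiniteIntegral]
  refine lt_of_le_of_lt (lintegral_mono fun x => ?_) h
  rw [← ofReal_norm, Real.norm_eq_abs]

lemma camp_of_lcamp {d n : ℕ} {D : Set (Eu d)} {g : Eu d → ℝ} {A : ℝ} (hA : 0 ≤ A)
    (hm : AEStronglyMeasurable g (volume.restrict D)) (h : LCamp n D g A) : Camp n D g A := by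
  have key : ∀ z s, 0 < s → cube z s ⊆ D → ∀ P ∈ PolyLE d n,
      ∫⁻ y in cube z s, ENNReal.ofReal |g y - P y| ≤ ENNReal.ofReal (A * s ^ n * s ^ d) →
      IntegrableOn (fun y => g y - P y) (cube z s) := fun z s hs hQ P hP hb =>
    intOn_of_lint ((hm.mono_set hQ).sub (aesm_poly hP _)) (lt_of_le_of_lt hb ENNReal.ofReal_lt_top)
  refine ⟨hA, fun z s hs hQ => ?_, fun z s hs hQ => ?_⟩
  · obtain ⟨P, hP, hb⟩ := h z s hs hQ
    have := (key z s hs hQ P hP hb).add (polyLE_intOn hP z s)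
    refine this.congr (ae_of_all _ fun x => ?_)
    simp
  · obtain ⟨P, hP, hb⟩ := h z s hs hQ
    refine ⟨P, hP, ?_⟩
    have h1 : 0 < s ^ d := by positivity
    rw [lint_eq (key z s hs hQ P hP hb), ENNReal.ofReal_le_ofReal_iff (by positivity)] at hb
    unfold av
    rw [inv_mul_le_iff₀ h1]
    linarith

lemma lcamp_of_camp {d n : ℕ} {D : Set (Eu d)} {g : Eu d → ℝ} {A : ℝ} (h : Camp n D g A) : LCamp n D g A := by
  intro z s hs hQ
  obtain ⟨P, hP, hb⟩ := h.near z s hs hQ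
  refine ⟨P, hP, ?_⟩
  rw [lint_eq (F := fun y => g y - P y) ((h.integ z s hs hQ).sub (polyLE_intOn hP z s))]
  refine ENNReal.ofReal_le_ofReal ?_
  have h1 : 0 < s ^ d := by positivity
  unfold av at hb
  rw [inv_mul_le_iff₀ h1] at hb
  linarith

lemma camp_loc {d n : ℕ} {D : Set (Eu d)} (hD : IsOpen D) {g : Eu d → ℝ} {A : ℝ} (h : Camp n D g A) :
    LocallyIntegrableOn g D := by
  intro x hx
  obtain ⟨r, hr, hb⟩ := Metric.isOpen_iff.1 hD x hx
  have hs : 0 < r / (d + 1) := by positivity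
  have hsub : cube x (r / (d + 1)) ⊆ D := by
    intro y hy
    refine hb ?_
    have h1 := norm_sub_le_of_mem_cube hs.le hy
    rw [mem_ball, dist_eq_norm]
    refine h1.trans_lt ?_
    have : (d : ℝ) * (r / (d + 1) / 2) = r * (d / (2 * (d + 1))) := by field_simp
    rw [this]
    have h2 : (d : ℝ) / (2 * (d + 1)) < 1 := by rw [div_lt_one (by positivity)]; linarith [(Nat.cast_nonneg d : (0 : ℝ) ≤ d)]
    nlinarith
  refine ⟨cube x (r / (d + 1)), mem_nhdsWithin_of_mem_nhds ?_, h.integ x _ hs hsub⟩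
  refine Filter.mem_of_superset (Metric.closedBall_mem_nhds x (half_pos hs)) fun y hy => ?_
  rw [mem_closedBall, dist_eq_norm] at hy
  exact mem_cube_of_norm hy

lemma zyg_of {d n : ℕ} {D : Set (Eu d)} {f : Eu d → ℝ} {M : ℝ}
    (hf : LocallyIntegrableOn f D)
    (h : zygSeminorm (fun t => t ^ n) n D f + l1Norm D f < ENNReal.ofReal M) : Zyg n D f M := by
  have hM : 0 < M := ENNReal.ofReal_pos.1 (lt_of_le_of_lt bot_le h)
  have h1 : zygSeminorm (fun t => t ^ n) n D f < ENNReal.ofReal M := lt_of_le_of_lt le_self_add h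
  have h2 : l1Norm D f < ENNReal.ofReal M := lt_of_le_of_lt le_add_self h
  have hm := hf.aestronglyMeasurable
  have hi : IntegrableOn f D := intOn_of_lint hm (h2.trans ENNReal.ofReal_lt_top)
  refine ⟨camp_of_lcamp hM.le hm (seminorm_lcamp h1), hi, ?_⟩
  unfold l1Norm at h2
  rw [lint_eq hi] at h2
  exact (ENNReal.ofReal_le_ofReal_iff hM.le).1 h2.le

lemma Geo.intOn_cont {d : ℕ} {D : Set (Eu d)} {c r0 Rd : ℝ} (hG : Geo D c r0 Rd) {P : Eu d → ℝ} (hP : Continuous P) :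
    IntegrableOn P D := by
  rcases D.eq_empty_or_nonempty with h | ⟨a, ha⟩
  · rw [h]; exact integrableOn_empty
  · refine (hP.continuousOn.integrableOn_compact (isCompact_closedBall a Rd)).mono_set fun x hx => ?_
    rw [mem_closedBall, dist_eq_norm]
    exact hG.diam x hx a ha

lemma Geo.vol_lt {d : ℕ} {D : Set (Eu d)} {c r0 Rd : ℝ} (hG : Geo D c r0 Rd) : volume D < ⊤ := by
  rcases D.eq_empty_or_nonempty with h | ⟨a, ha⟩
  · rw [h]; simp
  · refine lt_of_le_of_lt (measure_mono fun x hx => ?_) (measure_closedBall_lt_top (x := a) (r := Rd))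
    rw [mem_closedBall, dist_eq_norm]
    exact hG.diam x hx a ha

lemma center_mem {d : ℕ} (x₀ : Eu d) {l : ℝ} (hl : 0 < l) : x₀ ∈ cube x₀ l :=
  mem_cube_of_norm (by simp; linarith)

set_option maxHeartbeats 1600000 in
lemma cz_diff {d n : ℕ} (hn : 0 < n) {D : Set (Eu d)} {c r0 Rd : ℝ} (hG : Geo D c r0 Rd)
    {K : Eu d → ℝ} {CK : ℝ} (hK : Ker d n K CK) : ∃ C : ℝ, 0 < C ∧
    ∀ {f : Eu d → ℝ} {M : ℝ} (_ : Zyg n D f M) {x₀ : Eu d} {l : ℝ} (_ : 0 < l) (_ : cube x₀ l ⊆ D)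
    {P : Eu d → ℝ} (_ : NearB n f M P x₀ l)
    {g : Eu d → ℝ} (_ : ∀ᵐ y ∂volume.restrict (cube x₀ l),
      Tendsto (fun ε => tr D K (fun x => f x - P x) ε y) (𝓝[>] 0) (𝓝 (g y))),
    ∃ S ∈ PolyLE d n, ∫⁻ y in cube x₀ l, ENNReal.ofReal |g y - S y| ≤ ENNReal.ofReal (C * M * l ^ n * l ^ d) := by
  have hd := hG.dpos
  obtain ⟨C₀, hC₀, h₀⟩ := cz_osc hd hK
  obtain ⟨C₁, hC₁, h₁⟩ := cube_sup d n hd hn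
  obtain ⟨C₂, hC₂, h₂⟩ := cube_holder d n hd hn
  obtain ⟨C₃, hC₃, h₃⟩ := zyg_growth n hn hG
  have hd1 : (1 : ℝ) ≤ d := by exact_mod_cast hd
  set E := C₃ * (2 * d) ^ n * √(2 * d) with hE
  have hE0 : 0 ≤ E := by positivity
  refine ⟨C₀ * (C₁ + C₂ + C₃ + E), by positivity, ?_⟩
  intro f M hf x₀ l hl hQ P hP g hg
  have hM := hf.camp.nonneg
  have hgood : ∀ᵐ x ∂volume.restrict D, Good f x := ae_good hd hG.opn hf.integrable.locallyIntegrableOn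
  have hgoodQ : ∀ᵐ x ∂volume.restrict (cube x₀ l), Good f x := ae_restrict_of_ae_restrict_of_subset hQ hgood
  have hu : IntegrableOn (fun x => f x - P x) D := hf.integrable.sub (hG.intOn_cont (polyLE_continuous hP.1))
  have hmem := ae_restrict_mem (μ := volume) hG.opn.measurableSet
  have hmemQ := ae_restrict_mem (μ := volume) (measurableSet_cube x₀ l)
  set B := (C₁ + C₂ + C₃ + E) * M with hB
  have hB0 : 0 ≤ B := by positivity
  have b1 : C₁ * M ≤ B := mul_le_mul_of_nonneg_right (by linarith) hM
  have b2 : C₂ * M ≤ B := mul_le_mul_of_nonneg_right (by linarith) hM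
  have b3 : C₃ * M ≤ B := mul_le_mul_of_nonneg_right (by linarith) hM
  have b4 : E * M ≤ B := mul_le_mul_of_nonneg_right (by linarith) hM
  have hln : 0 < l ^ n := by positivity
  refine Exists.elim (h₀ hG.opn hl hQ hu hB0 ?_ ?_ ?_ hg) ?_
  · filter_upwards [hgood, hmem] with x hx hxD hlt
    have := h₃ hf hl hQ hP hxD hx (s := 2 * d * l) (by nlinarith) hlt.le
    refine this.trans ?_
    have e : C₃ * M * (2 * d * l) ^ n * √(2 * d * l / l) = E * M * l ^ n := by
      rw [hE, mul_div_assoc, div_self hl.ne', mul_one, mul_pow]; ring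
    rw [e]
    exact mul_le_mul_of_nonneg_right b4 hln.le
  · filter_upwards [hgood, hmem] with x hx hxD hle
    have := h₃ hf hl hQ hP hxD hx (s := ‖x - x₀‖) (by nlinarith) le_rfl
    refine this.trans ?_
    refine mul_le_mul_of_nonneg_right ?_ (Real.sqrt_nonneg _)
    exact mul_le_mul_of_nonneg_right b3 (by positivity)
  · filter_upwards [hgoodQ, hmemQ] with y hy hyQ
    refine ⟨(h₁ hf.camp hl hQ hP hyQ hy).trans (mul_le_mul_of_nonneg_right b1 hln.le), ?_⟩
    filter_upwards [hgoodQ, hmemQ] with x hx hxQ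
    refine (h₂ hf.camp hl hQ hP hxQ hyQ hx hy).trans ?_
    refine mul_le_mul_of_nonneg_right ?_ (Real.sqrt_nonneg _)
    exact mul_le_mul_of_nonneg_right b2 hln.le
  · rintro S ⟨hS, hS2, -⟩
    refine ⟨S, hS, hS2.trans_eq ?_⟩
    congr 1; rw [hB]; ring

/-- Bound of the mean of `T_D f` over a cube of fixed size. -/
lemma cz_fix {d n : ℕ} (hn : 0 < n) {D : Set (Eu d)} {c r0 Rd : ℝ} (hG : Geo D c r0 Rd)
    {K : Eu d → ℝ} {CK : ℝ} (hK : Ker d n K CK) {l : ℝ} (hl : 0 < l) : ∃ C : ℝ, 0 < C ∧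
    ∀ {f : Eu d → ℝ} {M : ℝ} (_ : Zyg n D f M) {x₀ : Eu d} (_ : cube x₀ l ⊆ D)
    {g : Eu d → ℝ} (_ : IsRestrictedCZ D K f g),
    ∫⁻ y in cube x₀ l, ENNReal.ofReal |g y| ≤ ENNReal.ofReal (C * M) := by
  have hd := hG.dpos
  obtain ⟨C₀, hC₀, h₀⟩ := cz_osc hd hK
  obtain ⟨C₁, hC₁, h₁⟩ := zyg_sup n hn hG
  obtain ⟨C₂, hC₂, h₂⟩ := cube_holder d n hd hn
  obtain ⟨C₃, hC₃, h₃⟩ := poly_lip d n d (by positivity)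
  have hd1 : (1 : ℝ) ≤ d := by exact_mod_cast hd
  have hln : 0 < l ^ n := by positivity
  have hld : 0 < l ^ d := by positivity
  set E := C₃ * √d * ((l ^ d)⁻¹ + l ^ n) with hE
  have hE0 : 0 ≤ E := by positivity
  set F := (C₁ + C₂ * l ^ n + E) / l ^ n with hF
  have hF0 : 0 < F := by positivity
  have hFl : F * l ^ n = C₁ + C₂ * l ^ n + E := by rw [hF]; field_simp
  refine ⟨C₀ * F * l ^ n * l ^ d + l ^ d * (C₀ * F * l ^ n + C₀ * (l ^ d)⁻¹), by positivity, ?_⟩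
  intro f M hf x₀ hQ g hg
  have hM := hf.camp.nonneg
  obtain ⟨P, hP⟩ := hf.camp.near x₀ l hl hQ
  have hgood : ∀ᵐ x ∂volume.restrict D, Good f x := ae_good hd hG.opn hf.integrable.locallyIntegrableOn
  have hgoodQ : ∀ᵐ x ∂volume.restrict (cube x₀ l), Good f x := ae_restrict_of_ae_restrict_of_subset hQ hgood
  have hmem := ae_restrict_mem (μ := volume) hG.opn.measurableSet
  have hmemQ := ae_restrict_mem (μ := volume) (measurableSet_cube x₀ l)
  have c1 : C₁ * M ≤ F * M * l ^ n := by
    calc _ ≤ (F * l ^ n) * M := mul_le_mul_of_nonneg_right (by rw [hFl]; linarith [mul_pos hC₂ hln]) hM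
      _ = _ := by ring
  have avP : av x₀ l P ≤ ((l ^ d)⁻¹ + l ^ n) * M := by
    have hiQ := hf.integrable.mono_set hQ
    have a1 : av x₀ l P ≤ av x₀ l f + av x₀ l (fun x => f x - P x) :=
      av_add_le hl hiQ (hiQ.sub (polyLE_intOn hP.1 _ _)) fun x _ => by
        have := abs_sub (f x) (f x - P x)
        rwa [sub_sub_cancel] at this
    have a2 : av x₀ l f ≤ (l ^ d)⁻¹ * M := by
      refine mul_le_mul_of_nonneg_left ?_ (by positivity)
      exact (setIntegral_mono_set hf.integrable.abs (ae_of_all _ fun _ => abs_nonneg _) (LE.le.eventuallyLE hQ)).trans hf.l1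
    have a3 := hP.2
    linarith
  refine Exists.elim (h₀ hG.opn hl hQ hf.integrable (B := F * M) (by positivity) ?_ ?_ ?_
    (ae_restrict_of_ae_restrict_of_subset hQ hg.2)) ?_
  · filter_upwards [hgood, hmem] with x hx hxD _
    exact (h₁ hf hxD hx).trans c1
  · filter_upwards [hgood, hmem] with x hx hxD hle
    refine (h₁ hf hxD hx).trans (c1.trans ?_)
    have hl2 : l ≤ ‖x - x₀‖ := by nlinarith
    have h5 : 1 ≤ √(‖x - x₀‖ / l) := Real.one_le_sqrt.2 ((one_le_div hl).2 hl2)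
    have h6 : l ^ n ≤ ‖x - x₀‖ ^ n := pow_le_pow_left₀ hl.le hl2 n
    have h7 : F * M * l ^ n ≤ F * M * ‖x - x₀‖ ^ n := mul_le_mul_of_nonneg_left h6 (by positivity)
    exact h7.trans (le_mul_of_one_le_right (by positivity) h5)
  · filter_upwards [hgoodQ, hmemQ] with y hy hyQ
    refine ⟨(h₁ hf (hQ hyQ) hy).trans c1, ?_⟩
    filter_upwards [hgoodQ, hmemQ] with x hx hxQ
    have k1 := h₂ hf.camp hl hQ hP hxQ hyQ hx hy
    have n1 := norm_sub_le_of_mem_cube hl.le hxQ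
    have n2 := norm_sub_le_of_mem_cube hl.le hyQ
    have k2 := h₃ P hP.1 x₀ x y l hl (by nlinarith) (by nlinarith)
    have n3 : ‖x - y‖ ≤ d * l := by
      have := norm_sub_le (x - x₀) (y - x₀)
      rw [sub_sub_sub_cancel_right] at this
      linarith
    have k3 : ‖x - y‖ / l ≤ √d * √(‖x - y‖ / l) := by
      have q0 : 0 ≤ ‖x - y‖ / l := by positivity
      have q1 : ‖x - y‖ / l ≤ d := (div_le_iff₀ hl).2 n3
      calc _ = √(‖x - y‖ / l) * √(‖x - y‖ / l) := (Real.mul_self_sqrt q0).symm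
        _ ≤ √d * √(‖x - y‖ / l) := mul_le_mul_of_nonneg_right (Real.sqrt_le_sqrt q1) (Real.sqrt_nonneg _)
    have k4 : |P x - P y| ≤ E * M * √(‖x - y‖ / l) := by
      calc _ ≤ C₃ * (‖x - y‖ / l) * av x₀ l P := k2
        _ ≤ C₃ * (√d * √(‖x - y‖ / l)) * (((l ^ d)⁻¹ + l ^ n) * M) :=
          mul_le_mul (mul_le_mul_of_nonneg_left k3 hC₃.le) avP (av_nonneg _ hl _) (by positivity)
        _ = _ := by rw [hE]; ring
    have k5 : |f x - f y| ≤ |f x - P x - (f y - P y)| + |P x - P y| := by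
      have := abs_add_le (f x - P x - (f y - P y)) (P x - P y)
      rwa [show f x - P x - (f y - P y) + (P x - P y) = f x - f y by ring] at this
    calc _ ≤ C₂ * M * l ^ n * √(‖x - y‖ / l) + E * M * √(‖x - y‖ / l) := by linarith
      _ = (C₂ * l ^ n + E) * (M * √(‖x - y‖ / l)) := by ring
      _ ≤ (F * l ^ n) * (M * √(‖x - y‖ / l)) := mul_le_mul_of_nonneg_right (by rw [hFl]; linarith) (by positivity)
      _ = _ := by ring
  · rintro S ⟨hS, hS2, hS3⟩
    have hSb : ∀ y ∈ cube x₀ l, |S y| ≤ (C₀ * F * l ^ n + C₀ * (l ^ d)⁻¹) * M := by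
      intro y hy
      refine (hS3 y hy).trans ?_
      have : C₀ * (l ^ d)⁻¹ * ∫ x in D, |f x| ≤ C₀ * (l ^ d)⁻¹ * M := mul_le_mul_of_nonneg_left hf.l1 (by positivity)
      linarith
    calc ∫⁻ y in cube x₀ l, ENNReal.ofReal |g y|
        ≤ ∫⁻ y in cube x₀ l, (ENNReal.ofReal |g y - S y| + ENNReal.ofReal ((C₀ * F * l ^ n + C₀ * (l ^ d)⁻¹) * M)) := by
          refine setLIntegral_mono' (measurableSet_cube _ _) fun y hy => ?_
          rw [← ENNReal.ofReal_add (abs_nonneg _) (by positivity)]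
          refine ENNReal.ofReal_le_ofReal ?_
          have := abs_add_le (g y - S y) (S y)
          rw [sub_add_cancel] at this
          linarith [hSb y hy]
      _ = (∫⁻ y in cube x₀ l, ENNReal.ofReal |g y - S y|) +
          ENNReal.ofReal ((C₀ * F * l ^ n + C₀ * (l ^ d)⁻¹) * M) * ENNReal.ofReal (l ^ d) := by
          rw [lintegral_add_right _ measurable_const, setLIntegral_const, volume_cube _ hl.le]
      _ ≤ ENNReal.ofReal (C₀ * (F * M) * l ^ n * l ^ d) +
          ENNReal.ofReal ((C₀ * F * l ^ n + C₀ * (l ^ d)⁻¹) * M) * ENNReal.ofReal (l ^ d) := add_le_add hS2 le_rfl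
      _ = _ := by
          rw [← ENNReal.ofReal_mul (by positivity), ← ENNReal.ofReal_add (by positivity) (by positivity)]
          congr 1; ring

lemma polyLE_contDiff {d n : ℕ} {P : Eu d → ℝ} (hP : P ∈ PolyLE d n) (k : WithTop ℕ∞) : ContDiff ℝ k P := by
  obtain ⟨p, hp, rfl⟩ := polyLE_exists hP
  have e : pv p = fun w : Eu d => ∑ a : MI d n, p.coeff (miF a) * ∏ i, w i ^ (a i : ℕ) := by
    funext w
    rw [← pv_toPoly, toPoly_coeff hp]
  rw [e]
  refine ContDiff.sum fun a _ => contDiff_const.mul (contDiff_prod fun i _ => ContDiff.pow ?_ _)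
  exact (EuclideanSpace.proj (𝕜 := ℝ) i).contDiff

def eM {d n : ℕ} (a : MI d n) : MvPolynomial (Fin d) ℝ :=
  if (miF a).degree ≤ n then MvPolynomial.monomial (miF a) 1 else 0

lemma eM_deg {d n : ℕ} (a : MI d n) : (eM a).totalDegree ≤ n := by
  unfold eM
  split_ifs with h
  · refine (MvPolynomial.totalDegree_monomial_le _ _).trans ?_
    rw [Finsupp.degree_apply] at h
    exact h
  · simp

lemma pv_eM {d n : ℕ} {p : MvPolynomial (Fin d) ℝ} (hp : p.totalDegree ≤ n) (w : Eu d) :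
    pv p w = ∑ a : MI d n, p.coeff (miF a) * pv (eM a) w := by
  conv_lhs => rw [← toPoly_coeff hp, toPoly, pv_sum]
  refine Finset.sum_congr rfl fun a _ => ?_
  unfold eM
  split_ifs with h
  · unfold pv
    rw [MvPolynomial.eval_monomial, MvPolynomial.eval_monomial, one_mul]
  · have h1 : p.coeff (miF a) = 0 := by
      apply MvPolynomial.coeff_eq_zero_of_totalDegree_lt
      rw [← Finsupp.degree_apply]
      omega
    simp [h1, pv]

lemma poly_basis (d n : ℕ) (z₀ : Eu d) {s₀ : ℝ} (hs₀ : 0 < s₀) : ∃ m : MI d n → Eu d → ℝ,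
    (∀ a, m a ∈ PolyLE d n) ∧ ∃ C : ℝ, 0 < C ∧ ∀ R ∈ PolyLE d n, ∀ B : ℝ, (∀ x ∈ cube z₀ s₀, |R x| ≤ B) →
      ∃ c : MI d n → ℝ, (∀ a, |c a| ≤ C * B) ∧ ∀ x, R x = ∑ a, c a * m a x := by
  obtain ⟨C, hC, h⟩ := coeff_bound d n
  refine ⟨fun a x => pv (eM a) (-(s₀⁻¹ • z₀) + s₀⁻¹ • x), fun a => polyLE_affine (pv_mem (eM_deg a)) _ _, C, hC, ?_⟩
  intro R hR B hB
  obtain ⟨q, hq, hqe⟩ := polyLE_exists (polyLE_affine hR z₀ s₀)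
  have hqe' : ∀ w, pv q w = R (z₀ + s₀ • w) := fun w => (congrFun hqe w).symm
  refine ⟨fun a => q.coeff (miF a), fun a => (h q hq a).trans ?_, fun x => ?_⟩
  · refine mul_le_mul_of_nonneg_left ?_ hC.le
    have h1 := av_le_of_bound (z := (0 : Eu d)) (s := 1) (B := B) one_pos (F := pv q) fun w hw => by
      rw [hqe']
      refine hB _ fun i => ?_
      have := hw i
      simp only [PiLp.zero_apply, sub_zero] at this
      simp only [PiLp.add_apply, PiLp.smul_apply, smul_eq_mul, add_sub_cancel_left, abs_mul, abs_of_pos hs₀]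
      nlinarith
    simpa [av] using h1
  · rw [← pv_eM hq, hqe']
    congr 1
    rw [smul_add, smul_neg, smul_smul, smul_smul, mul_inv_cancel₀ hs₀.ne']
    simp

/-- a.e. principal value limits -/
def Lim {d : ℕ} (D : Set (Eu d)) (K f g : Eu d → ℝ) : Prop :=
  ∀ᵐ y ∂volume.restrict D, Tendsto (fun ε => tr D K f ε y) (𝓝[>] 0) (𝓝 (g y))

lemma Lim.lin {d n : ℕ} {K : Eu d → ℝ} {C : ℝ} (hK : Ker d n K C) {D : Set (Eu d)} (hD : IsOpen D) {u v g h : Eu d → ℝ}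
    (hu : IntegrableOn u D) (hv : IntegrableOn v D) (hg : Lim D K u g) (hh : Lim D K v h) (a b : ℝ) :
    Lim D K (fun x => a * u x + b * v x) (fun x => a * g x + b * h x) := by
  unfold Lim at *
  filter_upwards [hg, hh] with y h1 h2
  refine ((h1.const_mul a).add (h2.const_mul b)).congr' ?_
  filter_upwards [self_mem_nhdsWithin] with ε hε
  exact (tr_lin hK hD hu hv a b hε y).symm

lemma Lim.sum {d n : ℕ} {K : Eu d → ℝ} {C : ℝ} (hK : Ker d n K C) {D : Set (Eu d)} (hD : IsOpen D) {ι : Type*} (s : Finset ι)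
    (c : ι → ℝ) (m G : ι → Eu d → ℝ) (hm : ∀ a, IntegrableOn (m a) D) (hG : ∀ a, Lim D K (m a) (G a)) :
    Lim D K (fun x => ∑ a ∈ s, c a * m a x) (fun x => ∑ a ∈ s, c a * G a x) := by
  classical
  induction s using Finset.induction_on with
  | empty =>
    refine ae_of_all _ fun y => ?_
    simp [tr]
  | insert a s ha ih =>
    have h1 := Lim.lin hK hD (hm a) (integrable_finsetSum s fun i _ => (hm i).const_mul (c i)) (hG a) ih (c a) 1
    simpa [Finset.sum_insert ha] using h1

lemma Lim.unique {d : ℕ} {K : Eu d → ℝ} {D : Set (Eu d)} {u g h : Eu d → ℝ}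
    (hg : Lim D K u g) (hh : Lim D K u h) : g =ᵐ[volume.restrict D] h := by
  unfold Lim at *
  filter_upwards [hg, hh] with y h1 h2
  exact tendsto_nhds_unique h1 h2

/-- approximation on one cube -/
def QA {d : ℕ} (n : ℕ) (g : Eu d → ℝ) (z : Eu d) (s A : ℝ) : Prop :=
  ∃ P ∈ PolyLE d n, ∫⁻ y in cube z s, ENNReal.ofReal |g y - P y| ≤ ENNReal.ofReal (A * s ^ n * s ^ d)

lemma QA.lin {d n : ℕ} {g h : Eu d → ℝ} {z : Eu d} {s A B : ℝ} (hs : 0 < s) (hA : 0 ≤ A) (hB : 0 ≤ B)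
    (mg : AEStronglyMeasurable g (volume.restrict (cube z s))) (hg : QA n g z s A) (hh : QA n h z s B) (a b : ℝ) :
    QA n (fun x => a * g x + b * h x) z s (|a| * A + |b| * B) := by
  obtain ⟨P, hP, h1⟩ := hg
  obtain ⟨Q, hQ, h2⟩ := hh
  refine ⟨_, polyLE_add (polyLE_smul a hP) (polyLE_smul b hQ), ?_⟩
  have mm : AEMeasurable (fun y => ENNReal.ofReal |g y - P y|) (volume.restrict (cube z s)) :=
    (mg.sub (aesm_poly hP _)).aemeasurable.abs.ennreal_ofReal
  calc _ ≤ ∫⁻ y in cube z s, (ENNReal.ofReal |a| * ENNReal.ofReal |g y - P y| + ENNReal.ofReal |b| * ENNReal.ofReal |h y - Q y|) := by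
        refine lintegral_mono fun y => ?_
        rw [← ENNReal.ofReal_mul (abs_nonneg _), ← ENNReal.ofReal_mul (abs_nonneg _), ← ENNReal.ofReal_add (by positivity) (by positivity)]
        refine ENNReal.ofReal_le_ofReal ?_
        rw [← abs_mul, ← abs_mul]
        refine le_trans (le_of_eq ?_) (abs_add_le _ _)
        congr 1; ring
    _ = ENNReal.ofReal |a| * (∫⁻ y in cube z s, ENNReal.ofReal |g y - P y|) +
        ENNReal.ofReal |b| * ∫⁻ y in cube z s, ENNReal.ofReal |h y - Q y| := by
        rw [lintegral_add_left' (mm.const_mul _), lintegral_const_mul' _ _ ENNReal.ofReal_ne_top,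
          lintegral_const_mul' _ _ ENNReal.ofReal_ne_top]
    _ ≤ ENNReal.ofReal |a| * ENNReal.ofReal (A * s ^ n * s ^ d) + ENNReal.ofReal |b| * ENNReal.ofReal (B * s ^ n * s ^ d) :=
        add_le_add (mul_le_mul_right h1 _) (mul_le_mul_right h2 _)
    _ = _ := by
        rw [← ENNReal.ofReal_mul (abs_nonneg _), ← ENNReal.ofReal_mul (abs_nonneg _), ← ENNReal.ofReal_add (by positivity) (by positivity)]
        congr 1; ring

lemma QA.mono {d n : ℕ} {g : Eu d → ℝ} {z : Eu d} {s A B : ℝ} (hs : 0 < s) (hg : QA n g z s A) (h : A ≤ B) : QA n g z s B := by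
  obtain ⟨P, hP, h1⟩ := hg
  refine ⟨P, hP, h1.trans (ENNReal.ofReal_le_ofReal ?_)⟩
  have : 0 ≤ s ^ n * s ^ d := by positivity
  rw [mul_assoc, mul_assoc]
  exact mul_le_mul_of_nonneg_right h this

lemma QA.congr {d n : ℕ} {g h : Eu d → ℝ} {z : Eu d} {s A : ℝ} {D : Set (Eu d)} (hQ : cube z s ⊆ D) (hg : QA n g z s A)
    (e : g =ᵐ[volume.restrict D] h) : QA n h z s A := by
  obtain ⟨P, hP, h1⟩ := hg
  refine ⟨P, hP, le_trans (le_of_eq ?_) h1⟩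
  refine lintegral_congr_ae ?_
  filter_upwards [ae_restrict_of_ae_restrict_of_subset hQ e] with y hy
  rw [hy]

lemma QA.sum {d n : ℕ} {z : Eu d} {s : ℝ} (hs : 0 < s) {ι : Type*} (t : Finset ι) (c A : ι → ℝ) (hA : ∀ a, 0 ≤ A a)
    (G : ι → Eu d → ℝ) (mG : ∀ a, AEStronglyMeasurable (G a) (volume.restrict (cube z s)))
    (hG : ∀ a, QA n (G a) z s (A a)) : QA n (fun x => ∑ a ∈ t, c a * G a x) z s (∑ a ∈ t, |c a| * A a) := by
  classical
  induction t using Finset.induction_on with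
  | empty =>
    refine ⟨fun _ => 0, polyLE_const 0, ?_⟩
    simp
  | insert a t ha ih =>
    have h1 := QA.lin hs (hA a) (Finset.sum_nonneg fun i _ => mul_nonneg (abs_nonneg _) (hA i)) (mG a) (hG a) ih (c a) 1
    simpa [Finset.sum_insert ha] using h1

set_option maxHeartbeats 1600000 in
lemma poly_part {d n : ℕ} {D : Set (Eu d)} {c r0 Rd : ℝ} (hG : Geo D c r0 Rd) (hne : D.Nonempty)
    {K : Eu d → ℝ} {CK : ℝ} (hK : Ker d n K CK)
    (hi : ∀ P ∈ PolyLE d n, ∀ g : Eu d → ℝ, IsRestrictedCZ D K P g →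
        LocallyIntegrableOn g D ∧ zygSeminorm (fun t => t ^ n) n D g < ⊤) {C : ℝ} (hC : 0 < C)
    (hii : ∀ (x₀ : Eu d) (l : ℝ), 0 < l → cube x₀ l ⊆ D →
        ∀ P : Eu d → ℝ,
          (∃ p : MvPolynomial (Fin d) ℝ, p.IsHomogeneous n ∧
            ∀ x, P x = MvPolynomial.eval (fun i => x i - x₀ i) p) →
          ∀ g : Eu d → ℝ, IsRestrictedCZ D K P g →
            ∃ S ∈ PolyLE d n,
              (ENNReal.ofReal (l ^ d))⁻¹ *
                  ∫⁻ x in cube x₀ l, ENNReal.ofReal |g x - S x| ≤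
                ENNReal.ofReal (C * sSup ((fun x => |P x|) '' D) *
                  (l ^ n / max 1 (Real.log (1 / l))))) : ∃ C' : ℝ, 0 < C' ∧
    ∀ {x₀ : Eu d} {l : ℝ} (_ : 0 < l) (_ : cube x₀ l ⊆ D) {p : MvPolynomial (Fin d) ℝ} (_ : p.totalDegree ≤ n)
    {A : ℝ} (_ : 0 ≤ A) (_ : ∀ j ≤ n, ∀ w : Eu d, |pv (hc j p) w| ≤ A * ‖w‖ ^ j * lg n j l)
    {g : Eu d → ℝ} (_ : Lim D K (fun y => pv p (y - x₀)) g), QA n g x₀ l (C' * A) := by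
  have hd := hG.dpos
  obtain ⟨a₀, ha₀⟩ := hne
  obtain ⟨hr0, hc0, hc1, hcone⟩ := hG.cones
  obtain ⟨e, he⟩ := hcone a₀ ha₀
  have hcn := he a₀ ha₀ (by simp; exact hr0.le)
  have hs₀ : 0 < c * r0 := by positivity
  have hQ₀ := hcn.sub r0 hr0 le_rfl
  obtain ⟨m, hm, Cb, hCb, hbas⟩ := poly_basis d n (a₀ + r0 • e) hs₀
  have hmi : ∀ a, IntegrableOn (m a) D := fun a => hG.intOn_cont (polyLE_continuous (hm a))
  have h1 : ∀ a, ∃ g, IsRestrictedCZ D K (m a) g := fun a => restr_exists hd hK hG.opn (hmi a) (polyLE_contDiff (hm a) 1)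
  choose G hGr using h1
  have hGm : ∀ a, AEStronglyMeasurable (G a) (volume.restrict D) := fun a => restr_meas hK hG.opn (hmi a) (hGr a)
  have h2 : ∀ a, ∃ N : ℝ, 0 ≤ N ∧ LCamp n D (G a) N := by
    intro a
    have h3 := (hi (m a) (hm a) (G a) (hGr a)).2
    refine ⟨(zygSeminorm (fun t => t ^ n) n D (G a)).toReal + 1, by positivity, seminorm_lcamp ?_⟩
    rw [ENNReal.ofReal_add ENNReal.toReal_nonneg zero_le_one, ENNReal.ofReal_toReal h3.ne, ENNReal.ofReal_one]
    exact ENNReal.lt_add_right h3.ne one_ne_zero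
  choose N hN hNL using h2
  set b := n * (max 1 Rd) ^ n with hb
  have hb0 : 0 ≤ b := by positivity
  have hSN : 0 ≤ ∑ a, N a := Finset.sum_nonneg fun a _ => hN a
  have hRp := hG.Rpos
  refine ⟨C * Rd ^ n + Cb * b * ∑ a, N a, by positivity, ?_⟩
  intro x₀ l hl hQ p hp A hA hpb g hg
  have hx₀ : x₀ ∈ D := hQ (center_mem x₀ hl)
  have hpn : (hc n p).totalDegree ≤ n := hc_degree le_rfl
  have hPn := pv_center_mem hpn x₀
  have hPni := hG.intOn_cont (polyLE_continuous hPn)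
  obtain ⟨gn, hgn⟩ := restr_exists hd hK hG.opn hPni (polyLE_contDiff hPn 1)
  have hmax : 0 < max 1 (Real.log (1 / l)) := lt_of_lt_of_le one_pos (le_max_left _ _)
  have top : QA n gn x₀ l (C * Rd ^ n * A) := by
    obtain ⟨S, hS, hS2⟩ := hii x₀ l hl hQ _ ⟨hc n p, MvPolynomial.homogeneousComponent_isHomogeneous n p, fun x => rfl⟩ gn hgn
    refine ⟨S, hS, ?_⟩
    have hld : 0 < l ^ d := by positivity
    have h3 := mul_le_mul_right hS2 (ENNReal.ofReal (l ^ d))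
    rw [← mul_assoc, ENNReal.mul_inv_cancel (by simpa using hld) ENNReal.ofReal_ne_top, one_mul,
      ← ENNReal.ofReal_mul hld.le] at h3
    refine h3.trans (ENNReal.ofReal_le_ofReal ?_)
    have h4 : sSup ((fun x => |pv (hc n p) (x - x₀)|) '' D) ≤ A * Rd ^ n * max 1 (Real.log (1 / l)) := by
      refine csSup_le ⟨_, mem_image_of_mem _ hx₀⟩ ?_
      rintro _ ⟨x, hx, rfl⟩
      refine (hpb n le_rfl (x - x₀)).trans ?_
      have : lg n n l = max 1 (Real.log (1 / l)) := by simp [lg]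
      rw [this]
      refine mul_le_mul_of_nonneg_right (mul_le_mul_of_nonneg_left ?_ hA) hmax.le
      exact pow_le_pow_left₀ (norm_nonneg _) (hG.diam x hx x₀ hx₀) n
    calc _ ≤ l ^ d * (C * (A * Rd ^ n * max 1 (Real.log (1 / l))) * (l ^ n / max 1 (Real.log (1 / l)))) := by
          refine mul_le_mul_of_nonneg_left ?_ hld.le
          refine mul_le_mul_of_nonneg_right ?_ (by positivity)
          exact mul_le_mul_of_nonneg_left h4 hC.le
      _ = _ := by field_simp
  set R : Eu d → ℝ := fun x => pv p (x - x₀) - pv (hc n p) (x - x₀) with hR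
  have hRm : R ∈ PolyLE d n := polyLE_sub (pv_center_mem hp x₀) hPn
  have hRb : ∀ x ∈ cube (a₀ + r0 • e) (c * r0), |R x| ≤ b * A := by
    intro x hx
    have hxx := hG.diam x (hQ₀ hx) x₀ hx₀
    have e1 : R x = ∑ j ∈ Finset.range n, pv (hc j p) (x - x₀) := by
      rw [hR]; dsimp only
      rw [pv_eq_sum_hc hp, Finset.sum_range_succ]; ring
    rw [e1]
    refine (Finset.abs_sum_le_sum_abs _ _).trans ?_
    have e2 : ∀ j ∈ Finset.range n, |pv (hc j p) (x - x₀)| ≤ A * (max 1 Rd) ^ n := by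
      intro j hj
      have hj := Finset.mem_range.1 hj
      refine (hpb j hj.le (x - x₀)).trans ?_
      have : lg n j l = 1 := by simp [lg, hj]
      rw [this, mul_one]
      refine mul_le_mul_of_nonneg_left ?_ hA
      calc ‖x - x₀‖ ^ j ≤ (max 1 Rd) ^ j := pow_le_pow_left₀ (norm_nonneg _) (hxx.trans (le_max_right _ _)) j
        _ ≤ _ := pow_le_pow_right₀ (le_max_left _ _) hj.le
    refine (Finset.sum_le_sum e2).trans ?_
    rw [Finset.sum_const, Finset.card_range, nsmul_eq_mul, hb]
    linarith
  obtain ⟨cf, hcf, hRe⟩ := hbas R hRm _ hRb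
  have hgR : Lim D K R (fun y => ∑ a, cf a * G a y) := by
    have := Lim.sum hK hG.opn Finset.univ cf m G hmi (fun a => (hGr a).2)
    convert this using 2 with x
    exact hRe x
  have hRi := hG.intOn_cont (polyLE_continuous hRm)
  have hsum := Lim.lin hK hG.opn hPni hRi hgn.2 hgR 1 1
  have hfe : (fun x => 1 * pv (hc n p) (x - x₀) + 1 * R x) = fun y => pv p (y - x₀) := by
    funext x; rw [hR]; ring
  rw [hfe] at hsum
  have low := QA.sum hl Finset.univ cf N hN G (fun a => (hGm a).mono_set hQ) (fun a => hNL a x₀ l hl hQ)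
  have tot := QA.lin hl (by positivity) (Finset.sum_nonneg fun a _ => mul_nonneg (abs_nonneg _) (hN a))
    ((restr_meas hK hG.opn hPni hgn).mono_set hQ) top low 1 1
  refine (tot.mono hl ?_).congr hQ (hsum.unique hg)
  rw [abs_one, one_mul, one_mul, add_mul]
  refine add_le_add (le_of_eq (by ring)) ?_
  calc ∑ a, |cf a| * N a ≤ ∑ a, Cb * (b * A) * N a := Finset.sum_le_sum fun a _ => mul_le_mul_of_nonneg_right (hcf a) (hN a)
    _ = _ := by rw [← Finset.mul_sum]; ring

set_option maxHeartbeats 1600000 in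
lemma sup_bound {d n : ℕ} (hn : 0 < n) {D : Set (Eu d)} {c r0 Rd : ℝ} (hG : Geo D c r0 Rd)
    {K : Eu d → ℝ} {CK : ℝ} (hK : Ker d n K CK) {C₁ : ℝ} (hC₁ : 0 < C₁) : ∃ C : ℝ, 0 < C ∧
    ∀ {f : Eu d → ℝ} {M : ℝ} (_ : Zyg n D f M) {g : Eu d → ℝ} (_ : IsRestrictedCZ D K f g) (_ : Camp n D g (C₁ * M)),
    ∀ᵐ x ∂volume.restrict D, |g x| ≤ C * M := by
  have hd := hG.dpos
  obtain ⟨hr0, hc0, hc1, hcone⟩ := hG.cones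
  have hs₀ : 0 < c * r0 := by positivity
  obtain ⟨C₂, hC₂, h₂⟩ := cz_fix hn hG hK hs₀
  obtain ⟨C₃, hC₃, h₃⟩ := CH1 d n hn c hc0
  obtain ⟨C₄, hC₄, h₄⟩ := poly_point d n
  refine ⟨C₃ * C₁ * r0 ^ n + C₄ * (1 + 1 / c) ^ n * (((c * r0) ^ d)⁻¹ * C₂ + C₁ * (c * r0) ^ n), by positivity, ?_⟩
  intro f M hf g hg hcg
  have hM := hf.camp.nonneg
  filter_upwards [ae_good hd hG.opn (camp_loc hG.opn hcg), ae_restrict_mem (μ := volume) hG.opn.measurableSet] with x hx hxD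
  obtain ⟨e, he⟩ := hcone x hxD
  have hcn := he x hxD (by simp; exact hr0.le)
  have hQ := hcn.sub r0 hr0 le_rfl
  obtain ⟨P, hP⟩ := hcg.near _ _ hs₀ hQ
  have k1 := h₃ hcg hcn hx hP
  have k2 := h₄ P hP.1 (x + r0 • e) (c * r0) hs₀ x
  have hgi := hcg.integ _ _ hs₀ hQ
  have k3 : av (x + r0 • e) (c * r0) P ≤ av (x + r0 • e) (c * r0) g + av (x + r0 • e) (c * r0) (fun x => g x - P x) :=
    av_add_le hs₀ hgi (hgi.sub (polyLE_intOn hP.1 _ _)) fun x _ => by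
      have := abs_sub (g x) (g x - P x)
      rwa [sub_sub_cancel] at this
  have k4 : ∫ y in cube (x + r0 • e) (c * r0), |g y| ≤ C₂ * M := by
    have := h₂ hf hQ hg
    rw [lint_eq hgi] at this
    exact (ENNReal.ofReal_le_ofReal_iff (by positivity)).1 this
  have k5 : av (x + r0 • e) (c * r0) g ≤ ((c * r0) ^ d)⁻¹ * (C₂ * M) := mul_le_mul_of_nonneg_left k4 (by positivity)
  have k6 := hP.2
  have k7 : ‖x - (x + r0 • e)‖ / (c * r0) ≤ 1 / c := by
    rw [sub_add_cancel_left, norm_neg, norm_smul, Real.norm_of_nonneg hr0.le]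
    have := hcn.vle
    rw [div_le_div_iff₀ hs₀ hc0]
    nlinarith [mul_nonneg hr0.le hc0.le]
  have k8 : (1 + ‖x - (x + r0 • e)‖ / (c * r0)) ^ n ≤ (1 + 1 / c) ^ n :=
    pow_le_pow_left₀ (by positivity) (by linarith) n
  have k9 : |P x| ≤ C₄ * (1 + 1 / c) ^ n * ((((c * r0) ^ d)⁻¹ * C₂ + C₁ * (c * r0) ^ n) * M) := by
    refine k2.trans (mul_le_mul (mul_le_mul_of_nonneg_left k8 hC₄.le) ?_ (av_nonneg _ hs₀ _) (by positivity))
    refine k3.trans ?_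
    calc _ ≤ ((c * r0) ^ d)⁻¹ * (C₂ * M) + C₁ * M * (c * r0) ^ n := add_le_add k5 k6
      _ = _ := by ring
  have k10 := abs_add_le (g x - P x) (P x)
  rw [sub_add_cancel] at k10
  calc |g x| ≤ C₃ * (C₁ * M) * r0 ^ n + C₄ * (1 + 1 / c) ^ n * ((((c * r0) ^ d)⁻¹ * C₂ + C₁ * (c * r0) ^ n) * M) := by linarith
    _ = _ := by ring

set_option maxHeartbeats 1600000 in
lemma backward {d n : ℕ} (hn : 0 < n) {D : Set (Eu d)} {c r0 Rd : ℝ} (hG : Geo D c r0 Rd) (hne : D.Nonempty)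
    {K : Eu d → ℝ} {CK : ℝ} (hK : Ker d n K CK)
    (hi : ∀ P ∈ PolyLE d n, ∀ g : Eu d → ℝ, IsRestrictedCZ D K P g →
        LocallyIntegrableOn g D ∧ zygSeminorm (fun t => t ^ n) n D g < ⊤) {C : ℝ} (hC : 0 < C)
    (hii : ∀ (x₀ : Eu d) (l : ℝ), 0 < l → cube x₀ l ⊆ D →
        ∀ P : Eu d → ℝ,
          (∃ p : MvPolynomial (Fin d) ℝ, p.IsHomogeneous n ∧
            ∀ x, P x = MvPolynomial.eval (fun i => x i - x₀ i) p) →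
          ∀ g : Eu d → ℝ, IsRestrictedCZ D K P g →
            ∃ S ∈ PolyLE d n,
              (ENNReal.ofReal (l ^ d))⁻¹ *
                  ∫⁻ x in cube x₀ l, ENNReal.ofReal |g x - S x| ≤
                ENNReal.ofReal (C * sSup ((fun x => |P x|) '' D) *
                  (l ^ n / max 1 (Real.log (1 / l))))) : ∃ C' : ℝ, 0 < C' ∧
    ∀ f g : Eu d → ℝ,
        LocallyIntegrableOn f D → zygSeminorm (fun t => t ^ n) n D f < ⊤ →
        l1Norm D f < ⊤ → IsRestrictedCZ D K f g →
        LocallyIntegrableOn g D ∧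
          zygSeminorm (fun t => t ^ n) n D g + l1Norm D g ≤
            ENNReal.ofReal C' * (zygSeminorm (fun t => t ^ n) n D f + l1Norm D f) := by
  have hd := hG.dpos
  obtain ⟨C₁, hC₁, h₁⟩ := cz_diff hn hG hK
  obtain ⟨C₂, hC₂, h₂⟩ := poly_part hG hne hK hi hC hii
  obtain ⟨C₃, hC₃, h₃⟩ := zyg_coef n hG
  have hC₄ : 0 < C₁ + C₂ * C₃ := by positivity
  obtain ⟨C₅, hC₅, h₅⟩ := sup_bound hn hG hK hC₄
  have main : ∀ f g : Eu d → ℝ, ∀ M : ℝ, Zyg n D f M → IsRestrictedCZ D K f g → LocallyIntegrableOn g D ∧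
      zygSeminorm (fun t => t ^ n) n D g + l1Norm D g ≤ ENNReal.ofReal ((C₁ + C₂ * C₃ + C₅ * volume.real D) * M) := by
    intro f g M hf hg
    have hM := hf.camp.nonneg
    have hgm := restr_meas hK hG.opn hf.integrable hg
    have hL : LCamp n D g ((C₁ + C₂ * C₃) * M) := by
      intro z s hs hQ
      obtain ⟨P, hP⟩ := hf.camp.near z s hs hQ
      obtain ⟨p, hp, hpe⟩ := polyLE_center hP.1 z
      have hPi := hG.intOn_cont (polyLE_continuous hP.1)
      obtain ⟨gP, hgP⟩ := restr_exists hd hK hG.opn hPi (polyLE_contDiff hP.1 1)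
      have hgPm := restr_meas hK hG.opn hPi hgP
      have q1 : QA n gP z s (C₂ * (C₃ * M)) := by
        refine h₂ hs hQ hp (by positivity) (fun j hj w => h₃ hf hs hQ hP hpe hj w) ?_
        have : (fun y => pv p (y - z)) = P := by funext y; exact (hpe y).symm
        rw [this]; exact hgP.2
      have q2 := Lim.lin hK hG.opn hf.integrable hPi hg.2 hgP.2 1 (-1)
      have e2 : (fun x => 1 * f x + -1 * P x) = fun x => f x - P x := by funext x; ring
      rw [e2] at q2
      have q3 : QA n (fun x => 1 * g x + -1 * gP x) z s (C₁ * M) :=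
        h₁ hf hs hQ hP (ae_restrict_of_ae_restrict_of_subset hQ q2)
      have q4 := QA.lin (g := fun x => 1 * g x + -1 * gP x) hs (by positivity) (by positivity) ((((hgm.const_mul 1).add (hgPm.const_mul (-1)))).mono_set hQ) q3 q1 1 1
      have e4 : (fun x => 1 * (1 * g x + -1 * gP x) + 1 * gP x) = g := by funext x; ring
      rw [e4] at q4
      exact q4.mono hs (by rw [abs_one]; exact le_of_eq (by ring))
    have hcg := camp_of_lcamp (by positivity) hgm hL
    refine ⟨camp_loc hG.opn hcg, ?_⟩
    have hl1 : l1Norm D g ≤ ENNReal.ofReal (C₅ * M * volume.real D) := by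
      unfold l1Norm
      calc _ ≤ ∫⁻ x in D, ENNReal.ofReal (C₅ * M) := by
            refine lintegral_mono_ae ?_
            filter_upwards [h₅ hf hg hcg] with x hx
            exact ENNReal.ofReal_le_ofReal hx
        _ = _ := by
            rw [setLIntegral_const, ENNReal.ofReal_mul (p := C₅ * M) (q := volume.real D) (by positivity), Measure.real, ENNReal.ofReal_toReal hG.vol_lt.ne]
    refine (add_le_add (lcamp_seminorm (by positivity) hL) hl1).trans ?_
    rw [← ENNReal.ofReal_add (by positivity) (by positivity)]
    exact ENNReal.ofReal_le_ofReal (le_of_eq (by ring))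
  set C' := C₁ + C₂ * C₃ + C₅ * volume.real D with hC'
  have hC'0 : 0 < C' := by positivity
  refine ⟨C', hC'0, ?_⟩
  intro f g hf hs hl hg
  set t := zygSeminorm (fun t => t ^ n) n D f + l1Norm D f with ht
  have htt : t < ⊤ := ENNReal.add_lt_top.2 ⟨hs, hl⟩
  have hz : ∀ δ : ℝ, 0 < δ → Zyg n D f (t.toReal + δ) := by
    intro δ hδ
    refine zyg_of hf ?_
    rw [ENNReal.ofReal_add ENNReal.toReal_nonneg hδ.le, ENNReal.ofReal_toReal htt.ne]
    exact ENNReal.lt_add_right htt.ne (by simpa using hδ)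
  refine ⟨(main f g _ (hz 1 one_pos) hg).1, ?_⟩
  refine ENNReal.le_of_forall_pos_le_add fun ε hε _ => ?_
  have hδ : 0 < (ε : ℝ) / C' := by positivity
  refine (main f g _ (hz _ hδ) hg).2.trans (le_of_eq ?_)
  rw [mul_add, mul_div_cancel₀ _ hC'0.ne', ENNReal.ofReal_add (by positivity) (by positivity),
    ENNReal.ofReal_mul hC'0.le, ENNReal.ofReal_toReal htt.ne, ENNReal.ofReal_coe_nnreal]

lemma min_sum {t : ℝ} (ht : 0 < t) (m : ℕ) :
    ((2 : ℝ) ^ m ≤ 2 * t → ∑ k ∈ Finset.range m, min (t / 2 ^ k) (2 ^ k / t) ≤ 2 ^ m / t) ∧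
    (2 * t < (2 : ℝ) ^ m → ∑ k ∈ Finset.range m, min (t / 2 ^ k) (2 ^ k / t) ≤ 4 - 2 * t / 2 ^ m) := by
  induction m with
  | zero => 
    refine ⟨fun _ => by simp; exact ht.le, fun h => ?_⟩
    simp only [Finset.range_zero, Finset.sum_empty, pow_zero, div_one] at h ⊢
    linarith
  | succ m ih =>
    have hp : (0 : ℝ) < 2 ^ m := by positivity
    rw [Finset.sum_range_succ, pow_succ]
    refine ⟨fun h => ?_, fun h => ?_⟩
    · have h1 := ih.1 (by linarith)
      have h2 := min_le_right (t / 2 ^ m) (2 ^ m / t)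
      calc _ ≤ 2 ^ m / t + 2 ^ m / t := add_le_add h1 h2
        _ = _ := by ring
    · have h2 := min_le_left (t / 2 ^ m) (2 ^ m / t)
      have e : 2 * t / (2 ^ m * 2) = t / 2 ^ m := by field_simp
      rw [e]
      have h5 : t / 2 ^ m < 1 := by rw [div_lt_one hp]; linarith
      rcases le_or_gt ((2 : ℝ) ^ m) (2 * t) with h3 | h3
      · have h1 := ih.1 h3
        have h4 : 2 ^ m / t ≤ 2 := by rw [div_le_iff₀ ht]; exact h3
        linarith
      · have h1 := ih.2 h3
        have e2 : 2 * t / 2 ^ m = 2 * (t / 2 ^ m) := by ring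
        rw [e2] at h1
        linarith

lemma min_sum_le {t : ℝ} (ht : 0 < t) (m : ℕ) : ∑ k ∈ Finset.range m, min (t / 2 ^ k) (2 ^ k / t) ≤ 4 := by
  rcases le_or_gt ((2 : ℝ) ^ m) (2 * t) with h3 | h3
  · have h1 := (min_sum ht m).1 h3
    have h4 : 2 ^ m / t ≤ 2 := by rw [div_le_iff₀ ht]; exact h3
    linarith
  · have h1 := (min_sum ht m).2 h3
    have : 0 < 2 * t / 2 ^ m := by positivity
    linarith

lemma sq_le_two_pow (m : ℕ) : ((m : ℝ) + 1) ^ 2 ≤ 16 * 2 ^ m := by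
  induction m with
  | zero => norm_num
  | succ m ih =>
    push_cast
    rw [pow_succ (2 : ℝ) m]
    rcases Nat.lt_or_ge m 2 with h | h
    · interval_cases m <;> norm_num
    · have : (2 : ℝ) ≤ m := by exact_mod_cast h
      nlinarith

open Classical in
lemma count_sum {t : ℝ} (m : ℕ) :
    ∑ k ∈ Finset.range m, (if (2 : ℝ) ^ k < t then (1 : ℝ) else 0) ≤ 4 * √t := by
  induction m with
  | zero => simp
  | succ m ih =>
    by_cases h : (2 : ℝ) ^ m < t
    · have h1 : ∑ k ∈ Finset.range (m + 1), (if (2 : ℝ) ^ k < t then (1 : ℝ) else 0) ≤ (m : ℝ) + 1 := by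
        refine (Finset.sum_le_card_nsmul _ _ 1 fun k _ => by split_ifs <;> norm_num).trans ?_
        simp
      refine h1.trans ?_
      have h2 := sq_le_two_pow m
      have h3 : (m : ℝ) + 1 ≤ √(16 * t) := Real.le_sqrt_of_sq_le (h2.trans (by linarith))
      have e : √(16 * t) = 4 * √t := by
        rw [Real.sqrt_mul (by norm_num), show (16 : ℝ) = 4 ^ 2 by norm_num, Real.sqrt_sq (by norm_num)]
      linarith
    · rw [Finset.sum_range_succ, if_neg h, add_zero]; exact ih

lemma pow_sum {ρ : ℝ} (hρ : 0 < ρ) {n : ℕ} (hn : 0 < n) (m : ℕ) :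
    ∑ k ∈ Finset.range m, (2 ^ k * ρ) ^ n ≤ (2 ^ m * ρ) ^ n := by
  induction m with
  | zero => simp; positivity
  | succ m ih =>
    rw [Finset.sum_range_succ]
    have e : (2 ^ (m + 1) * ρ) ^ n = 2 ^ n * (2 ^ m * ρ) ^ n := by
      rw [← mul_pow]; congr 1; ring
    have h2 : (2 : ℝ) ≤ 2 ^ n := by
      calc (2 : ℝ) = 2 ^ 1 := by norm_num
        _ ≤ 2 ^ n := pow_le_pow_right₀ (by norm_num) hn
    have h3 : 0 < (2 ^ m * ρ) ^ n := by positivity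
    rw [e]
    nlinarith

lemma choose_m {l : ℝ} (hl : 0 < l) : ∃ m : ℕ, max 1 (Real.log (1 / l)) ≤ m + 1 ∧ 2 ^ m * l ≤ l + 1 := by
  refine ⟨Nat.log 2 ⌊1 / l⌋₊, ?_, ?_⟩
  · refine max_le (by linarith [(Nat.cast_nonneg (Nat.log 2 ⌊1 / l⌋₊) : (0 : ℝ) ≤ _)]) ?_
    set m := Nat.log 2 ⌊1 / l⌋₊ with hm
    have h1 : 1 / l < ⌊1 / l⌋₊ + 1 := Nat.lt_floor_add_one _
    have h2 : ⌊1 / l⌋₊ < 2 ^ (m + 1) := Nat.lt_pow_succ_log_self (by norm_num) _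
    have h3 : (⌊1 / l⌋₊ : ℝ) + 1 ≤ 2 ^ (m + 1) := by exact_mod_cast h2
    have h4 : Real.log (1 / l) ≤ Real.log (2 ^ (m + 1)) := Real.log_le_log (by positivity) (by linarith)
    rw [Real.log_pow] at h4
    have h5 : Real.log 2 ≤ 1 := by linarith [Real.log_two_lt_d9]
    push_cast at h4
    nlinarith [(Nat.cast_nonneg m : (0 : ℝ) ≤ m)]
  · rcases Nat.eq_zero_or_pos ⌊1 / l⌋₊ with h | h
    · rw [h]; simp
    · have h1 : 2 ^ (Nat.log 2 ⌊1 / l⌋₊) ≤ ⌊1 / l⌋₊ := Nat.pow_log_le_self 2 h.ne'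
      have h2 : ((2 : ℝ) ^ (Nat.log 2 ⌊1 / l⌋₊)) ≤ ⌊1 / l⌋₊ := by exact_mod_cast h1
      have h3 : (⌊1 / l⌋₊ : ℝ) ≤ 1 / l := Nat.floor_le (by positivity)
      have h4 := mul_le_mul_of_nonneg_right (h2.trans h3) hl.le
      have h5 : 1 / l * l = 1 := by field_simp
      rw [h5] at h4
      linarith

/-- a smooth cut-off -/
def bmp (d : ℕ) : ContDiffBump (0 : Eu d) := ⟨1, 2, by norm_num, by norm_num⟩

structure Phi (d n : ℕ) (q : MvPolynomial (Fin d) ℝ) (M : ℝ) : Prop where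
  pos : 0 < M
  q_le : ∀ w : Eu d, |pv q w| ≤ M * ‖w‖ ^ n
  bd : ∀ w : Eu d, |pv q w * bmp d w| ≤ M
  der : ∀ w : Eu d, ‖iteratedFDeriv ℝ (n + 1) (fun w : Eu d => pv q w * bmp d w) w‖ ≤ M

lemma phi_smooth {d : ℕ} (q : MvPolynomial (Fin d) ℝ) (k : ℕ) : ContDiff ℝ k (fun w : Eu d => pv q w * bmp d w) :=
  (polyLE_contDiff (pv_mem (le_refl q.totalDegree)) _).mul (bmp d).contDiff

lemma phi_exists {d n : ℕ} {q : MvPolynomial (Fin d) ℝ} (hq : q.IsHomogeneous n) : ∃ M, Phi d n q M := by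
  have hcs : HasCompactSupport (fun w : Eu d => pv q w * bmp d w) := (bmp d).hasCompactSupport.mul_left
  obtain ⟨M₁, h₁⟩ := hcs.exists_bound_of_continuous (phi_smooth q 0).continuous
  obtain ⟨M₂, h₂⟩ := (hcs.iteratedFDeriv (𝕜 := ℝ) (n + 1)).exists_bound_of_continuous
    ((phi_smooth q (n + 1)).continuous_iteratedFDeriv (m := n + 1) le_rfl)
  obtain ⟨M₃, h₃⟩ := (isCompact_closedBall (0 : Eu d) 1).exists_bound_of_continuousOn (continuous_pv q).continuousOn
  refine ⟨|M₁| + |M₂| + |M₃| + 1, by positivity, fun w => ?_, fun w => ?_, fun w => ?_⟩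
  · by_cases hw : w = 0
    · rcases Nat.eq_zero_or_pos n with h | h
      · have := h₃ 0 (by simp)
        rw [Real.norm_eq_abs] at this
        rw [hw, h]; simp
        linarith [le_abs_self M₃, abs_nonneg M₁, abs_nonneg M₂]
      · have := pv_homog hq 0 (0 : Eu d)
        rw [zero_smul, zero_pow h.ne', zero_mul] at this
        rw [hw, this, abs_zero]; positivity
    · have hn : 0 < ‖w‖ := norm_pos_iff.2 hw
      have e : w = ‖w‖ • (‖w‖⁻¹ • w) := by rw [smul_smul, mul_inv_cancel₀ hn.ne', one_smul]
      have h4 := h₃ (‖w‖⁻¹ • w) (by simp [norm_smul, inv_mul_cancel₀ hn.ne'])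
      rw [Real.norm_eq_abs] at h4
      conv_lhs => rw [e, pv_homog hq]
      rw [abs_mul, abs_of_pos (by positivity), mul_comm]
      refine mul_le_mul_of_nonneg_right ?_ (by positivity)
      linarith [le_abs_self M₃, abs_nonneg M₁, abs_nonneg M₂]
  · have := h₁ w
    rw [Real.norm_eq_abs] at this
    linarith [le_abs_self M₁, abs_nonneg M₃, abs_nonneg M₂]
  · have := h₂ w
    linarith [le_abs_self M₂, abs_nonneg M₃, abs_nonneg M₁]

/-- one dyadic term -/
def term {d : ℕ} (q : MvPolynomial (Fin d) ℝ) (x₀ : Eu d) (τ : ℝ) (x : Eu d) : ℝ :=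
  pv q (x - x₀) * bmp d (τ⁻¹ • (x - x₀))

lemma term_eq {d n : ℕ} {q : MvPolynomial (Fin d) ℝ} (hq : q.IsHomogeneous n) (x₀ : Eu d) {τ : ℝ} (hτ : 0 < τ) (x : Eu d) :
    term q x₀ τ x = τ ^ n * (pv q (τ⁻¹ • (x - x₀)) * bmp d (τ⁻¹ • (x - x₀))) := by
  unfold term
  have e : x - x₀ = τ • (τ⁻¹ • (x - x₀)) := by rw [smul_smul, mul_inv_cancel₀ hτ.ne', one_smul]
  conv_lhs => enter [1]; rw [e, pv_homog hq]
  ring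

lemma term_smooth {d : ℕ} (q : MvPolynomial (Fin d) ℝ) (x₀ : Eu d) (τ : ℝ) (k : ℕ) : ContDiff ℝ k (term q x₀ τ) := by
  unfold term
  refine ContDiff.mul ?_ ?_
  · exact (polyLE_contDiff (pv_mem (le_refl q.totalDegree)) _).comp (contDiff_id.sub contDiff_const)
  · exact (bmp d).contDiff.comp ((contDiff_id.sub contDiff_const).const_smul _)

set_option maxHeartbeats 1600000 in
lemma term_approx {d n : ℕ} (hd : 0 < d) (hn : 0 < n) {q : MvPolynomial (Fin d) ℝ} (hq : q.IsHomogeneous n) {M : ℝ} (hM : Phi d n q M)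
    (x₀ z : Eu d) {τ s : ℝ} (hτ : 0 < τ) (hs : 0 < s) : ∃ P ∈ PolyLE d n, ∀ x ∈ cube z s,
    |term q x₀ τ x - P x| ≤ M * d ^ (n + 1) * s ^ n * min (s / τ) (τ / s) := by
  have hMp := hM.pos
  have hd1 : (1 : ℝ) ≤ d := by exact_mod_cast hd
  have hdn : (1 : ℝ) ≤ d ^ (n + 1) := one_le_pow₀ hd1
  rcases le_or_gt s τ with h | h
  · have e : min (s / τ) (τ / s) = s / τ := min_eq_left <| by
      have h1 : s / τ ≤ 1 := by rw [div_le_one hτ]; exact h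
      have h2 : 1 ≤ τ / s := by rw [one_le_div hs]; exact h
      linarith
    rw [e]
    set φ := fun w : Eu d => pv q w * bmp d w with hφ
    set a := τ⁻¹ • (z - x₀) with ha
    have hP1 := polyLE_affine (tay_polyLE (n := n) φ a) (-(τ⁻¹ • x₀)) τ⁻¹
    refine ⟨_, polyLE_smul (τ ^ n) hP1, fun x hx => ?_⟩
    have hx1 : -(τ⁻¹ • x₀) + τ⁻¹ • x = τ⁻¹ • (x - x₀) := by rw [smul_sub]; abel
    have hx2 : τ⁻¹ • (x - x₀) = a + τ⁻¹ • (x - z) := by rw [ha, ← smul_add]; congr 1; abel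
    have ht := taylor_bound (n := n) (f := φ) (x := a) (y := τ⁻¹ • (x - z)) (M := M)
      (fun t _ => (phi_smooth q (n + 1)).contDiffAt) (fun t _ => hM.der _)
    have e2 : term q x₀ τ x = τ ^ n * φ (a + τ⁻¹ • (x - z)) := by rw [term_eq hq x₀ hτ, ← hx2]
    rw [e2, hx1, hx2, add_sub_cancel_left, ← mul_sub, abs_mul, abs_of_pos (by positivity)]
    have hnx := norm_sub_le_of_mem_cube hs.le hx
    have hnx' : ‖τ⁻¹ • (x - z)‖ ≤ d * (s / τ) := by
      rw [norm_smul, norm_inv, Real.norm_of_nonneg hτ.le]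
      calc τ⁻¹ * ‖x - z‖ ≤ τ⁻¹ * (d * (s / 2)) := mul_le_mul_of_nonneg_left hnx (by positivity)
        _ ≤ τ⁻¹ * (d * s) := by
          refine mul_le_mul_of_nonneg_left (mul_le_mul_of_nonneg_left (by linarith) (by positivity)) (by positivity)
        _ = _ := by ring
    calc _ ≤ τ ^ n * (M * (d * (s / τ)) ^ (n + 1)) := by
          refine mul_le_mul_of_nonneg_left (ht.trans ?_) (by positivity)
          exact mul_le_mul_of_nonneg_left (pow_le_pow_left₀ (norm_nonneg _) hnx' _) hMp.le
      _ = _ := by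
          rw [mul_pow, div_pow, pow_succ s, pow_succ τ]
          field_simp
  · have e : min (s / τ) (τ / s) = τ / s := min_eq_right <| by
      have h1 : 1 ≤ s / τ := by rw [one_le_div hτ]; exact h.le
      have h2 : τ / s ≤ 1 := by rw [div_le_one hs]; exact h.le
      linarith
    rw [e]
    refine ⟨fun _ => 0, polyLE_const 0, fun x hx => ?_⟩
    rw [sub_zero, term_eq hq x₀ hτ, abs_mul, abs_of_pos (by positivity)]
    have h2 : τ / s ≤ 1 := by rw [div_le_one hs]; exact h.le
    have h3 : (τ / s) ^ n ≤ τ / s := by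
      calc (τ / s) ^ n ≤ (τ / s) ^ 1 := pow_le_pow_of_le_one (by positivity) h2 hn
        _ = _ := pow_one _
    have e3 : τ ^ n = s ^ n * (τ / s) ^ n := by rw [div_pow]; field_simp
    calc _ ≤ τ ^ n * M := mul_le_mul_of_nonneg_left (hM.bd _) (by positivity)
      _ = M * s ^ n * (τ / s) ^ n := by rw [e3]; ring
      _ ≤ M * s ^ n * (τ / s) := mul_le_mul_of_nonneg_left h3 (by positivity)
      _ ≤ M * d ^ (n + 1) * s ^ n * (τ / s) := by
          refine mul_le_mul_of_nonneg_right (mul_le_mul_of_nonneg_right ?_ (by positivity)) (by positivity)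
          nlinarith

/-- the sum of the dyadic terms -/
def tsm {d : ℕ} (q : MvPolynomial (Fin d) ℝ) (x₀ : Eu d) (ρ : ℝ) (m : ℕ) (x : Eu d) : ℝ :=
  ∑ k ∈ Finset.range m, term q x₀ (2 ^ k * ρ) x

lemma tsm_smooth {d : ℕ} (q : MvPolynomial (Fin d) ℝ) (x₀ : Eu d) (ρ : ℝ) (m k : ℕ) : ContDiff ℝ k (tsm q x₀ ρ m) := by
  unfold tsm
  exact ContDiff.sum fun i _ => term_smooth q x₀ _ k

lemma tsm_approx {d n : ℕ} (hd : 0 < d) (hn : 0 < n) {q : MvPolynomial (Fin d) ℝ} (hq : q.IsHomogeneous n) {M : ℝ} (hM : Phi d n q M)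
    (x₀ z : Eu d) {ρ s : ℝ} (hρ : 0 < ρ) (hs : 0 < s) (m : ℕ) : ∃ P ∈ PolyLE d n, ∀ x ∈ cube z s,
    |tsm q x₀ ρ m x - P x| ≤ M * d ^ (n + 1) * 4 * s ^ n := by
  have hMp := hM.pos
  choose P hP hPb using fun k : ℕ => term_approx hd hn hq hM x₀ z (τ := 2 ^ k * ρ) (by positivity) hs
  refine ⟨_, polyLE_sum (Finset.range m) P fun k _ => hP k, fun x hx => ?_⟩
  have ht : 0 < s / ρ := by positivity
  have h4 := min_sum_le ht m
  unfold tsm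
  rw [← Finset.sum_sub_distrib]
  calc _ ≤ ∑ k ∈ Finset.range m, |term q x₀ (2 ^ k * ρ) x - P k x| := Finset.abs_sum_le_sum_abs _ _
    _ ≤ ∑ k ∈ Finset.range m, M * d ^ (n + 1) * s ^ n * min (s / ρ / 2 ^ k) (2 ^ k / (s / ρ)) := by
        refine Finset.sum_le_sum fun k _ => (hPb k x hx).trans (le_of_eq ?_)
        congr 2
        · field_simp
        · field_simp
    _ = M * d ^ (n + 1) * s ^ n * ∑ k ∈ Finset.range m, min (s / ρ / 2 ^ k) (2 ^ k / (s / ρ)) := by rw [Finset.mul_sum]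
    _ ≤ M * d ^ (n + 1) * s ^ n * 4 := mul_le_mul_of_nonneg_left h4 (by positivity)
    _ = _ := by ring

lemma tsm_bound {d n : ℕ} (hn : 0 < n) {q : MvPolynomial (Fin d) ℝ} (hq : q.IsHomogeneous n) {M : ℝ} (hM : Phi d n q M)
    (x₀ : Eu d) {ρ : ℝ} (hρ : 0 < ρ) (m : ℕ) (x : Eu d) : |tsm q x₀ ρ m x| ≤ M * (2 ^ m * ρ) ^ n := by
  have hMp := hM.pos
  unfold tsm
  calc _ ≤ ∑ k ∈ Finset.range m, |term q x₀ (2 ^ k * ρ) x| := Finset.abs_sum_le_sum_abs _ _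
    _ ≤ ∑ k ∈ Finset.range m, M * (2 ^ k * ρ) ^ n := by
        refine Finset.sum_le_sum fun k _ => ?_
        rw [term_eq hq x₀ (by positivity), abs_mul, abs_of_pos (by positivity), mul_comm]
        exact mul_le_mul_of_nonneg_right (hM.bd _) (by positivity)
    _ = M * ∑ k ∈ Finset.range m, (2 ^ k * ρ) ^ n := by rw [Finset.mul_sum]
    _ ≤ _ := mul_le_mul_of_nonneg_left (pow_sum hρ hn m) hMp.le

lemma tsm_diff {d n : ℕ} {q : MvPolynomial (Fin d) ℝ} {M : ℝ} (hM : Phi d n q M)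
    (x₀ : Eu d) {ρ : ℝ} (hρ : 0 < ρ) (m : ℕ) (x : Eu d) :
    |tsm q x₀ ρ m x - m * pv q (x - x₀)| ≤ 4 * M * ‖x - x₀‖ ^ n * √(‖x - x₀‖ / ρ) := by
  classical
  have hMp := hM.pos
  have e : tsm q x₀ ρ m x - m * pv q (x - x₀) = ∑ k ∈ Finset.range m, pv q (x - x₀) * (bmp d ((2 ^ k * ρ)⁻¹ • (x - x₀)) - 1) := by
    simp only [tsm, term, mul_sub, mul_one, Finset.sum_sub_distrib, Finset.sum_const, Finset.card_range, nsmul_eq_mul]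
  rw [e]
  calc _ ≤ ∑ k ∈ Finset.range m, |pv q (x - x₀) * (bmp d ((2 ^ k * ρ)⁻¹ • (x - x₀)) - 1)| := Finset.abs_sum_le_sum_abs _ _
    _ ≤ ∑ k ∈ Finset.range m, M * ‖x - x₀‖ ^ n * (if (2 : ℝ) ^ k < ‖x - x₀‖ / ρ then (1 : ℝ) else 0) := by
        refine Finset.sum_le_sum fun k _ => ?_
        rw [abs_mul]
        refine mul_le_mul (hM.q_le _) ?_ (abs_nonneg _) (by positivity)
        have b0 := (bmp d).nonneg (x := (2 ^ k * ρ)⁻¹ • (x - x₀))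
        have b1 := (bmp d).le_one (x := (2 ^ k * ρ)⁻¹ • (x - x₀))
        split_ifs with h
        · rw [abs_le]; constructor <;> linarith
        · have hk : (0 : ℝ) < 2 ^ k * ρ := by positivity
          rw [not_lt, div_le_iff₀ hρ] at h
          rw [(bmp d).one_of_mem_closedBall]
          · simp
          · rw [mem_closedBall_zero_iff, norm_smul, norm_inv, Real.norm_of_nonneg hk.le]
            change _ ≤ (1 : ℝ)
            rw [inv_mul_le_iff₀ hk, mul_one]; exact h
    _ = M * ‖x - x₀‖ ^ n * ∑ k ∈ Finset.range m, (if (2 : ℝ) ^ k < ‖x - x₀‖ / ρ then (1 : ℝ) else 0) := by rw [Finset.mul_sum]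
    _ ≤ M * ‖x - x₀‖ ^ n * (4 * √(‖x - x₀‖ / ρ)) := mul_le_mul_of_nonneg_left (count_sum m) (by positivity)
    _ = _ := by ring

lemma tsm_zero {d : ℕ} (q : MvPolynomial (Fin d) ℝ)
    (x₀ : Eu d) {ρ : ℝ} (hρ : 0 < ρ) (m : ℕ) {x : Eu d} (hx : ‖x - x₀‖ ≤ ρ) :
    tsm q x₀ ρ m x - m * pv q (x - x₀) = 0 := by
  have e : tsm q x₀ ρ m x - m * pv q (x - x₀) = ∑ k ∈ Finset.range m, pv q (x - x₀) * (bmp d ((2 ^ k * ρ)⁻¹ • (x - x₀)) - 1) := by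
    simp only [tsm, term, mul_sub, mul_one, Finset.sum_sub_distrib, Finset.sum_const, Finset.card_range, nsmul_eq_mul]
  rw [e]
  refine Finset.sum_eq_zero fun k _ => ?_
  have hk : (0 : ℝ) < 2 ^ k * ρ := by positivity
  have h1 : (1 : ℝ) ≤ 2 ^ k := one_le_pow₀ (by norm_num)
  rw [(bmp d).one_of_mem_closedBall]
  · simp
  · rw [mem_closedBall_zero_iff, norm_smul, norm_inv, Real.norm_of_nonneg hk.le]
    change _ ≤ (1 : ℝ)
    rw [inv_mul_le_iff₀ hk, mul_one]
    nlinarith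

lemma lint_bound {d : ℕ} {F : Eu d → ℝ} {S : Set (Eu d)} (hm : MeasurableSet S) (hS : volume S ≠ ⊤) {B : ℝ} (hB : 0 ≤ B)
    (h : ∀ x ∈ S, |F x| ≤ B) : ∫⁻ x in S, ENNReal.ofReal |F x| ≤ ENNReal.ofReal (B * volume.real S) := by
  calc _ ≤ ∫⁻ x in S, ENNReal.ofReal B := by
        refine setLIntegral_mono' hm fun x hx => ENNReal.ofReal_le_ofReal (h x hx)
    _ = _ := by
        rw [setLIntegral_const, ENNReal.ofReal_mul (p := B) (q := volume.real S) hB, Measure.real, ENNReal.ofReal_toReal hS]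

set_option maxHeartbeats 1600000 in
lemma mono_part {d n : ℕ} (hn : 0 < n) {D : Set (Eu d)} {c r0 Rd : ℝ} (hG : Geo D c r0 Rd)
    {K : Eu d → ℝ} {CK : ℝ} (hK : Ker d n K CK) {C' : ℝ} (hC' : 0 < C')
    (H : ∀ f g : Eu d → ℝ,
        LocallyIntegrableOn f D → zygSeminorm (fun t => t ^ n) n D f < ⊤ →
        l1Norm D f < ⊤ → IsRestrictedCZ D K f g →
        LocallyIntegrableOn g D ∧
          zygSeminorm (fun t => t ^ n) n D g + l1Norm D g ≤
            ENNReal.ofReal C' * (zygSeminorm (fun t => t ^ n) n D f + l1Norm D f))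
    {q : MvPolynomial (Fin d) ℝ} (hq : q.IsHomogeneous n) : ∃ C : ℝ, 0 < C ∧
    ∀ (x₀ : Eu d) (l : ℝ), 0 < l → cube x₀ l ⊆ D → ∀ g : Eu d → ℝ, IsRestrictedCZ D K (fun x => pv q (x - x₀)) g →
      QA n g x₀ l (C / max 1 (Real.log (1 / l))) := by
  have hd := hG.dpos
  have hd1 : (1 : ℝ) ≤ d := by exact_mod_cast hd
  obtain ⟨M, hM⟩ := phi_exists hq
  have hMp := hM.pos
  have hRp := hG.Rpos
  obtain ⟨C₁, hC₁, h₁⟩ := cz_osc hd hK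
  set A₁ := M * d ^ (n + 1) * 4 with hA₁
  set A₂ := M * Rd ^ n + M * (2 * d * (2 * Rd + 1)) ^ n with hA₂
  have hA₁p : 0 < A₁ := by positivity
  have hA₂p : 0 < A₂ := by positivity
  set A₃ := C' * (A₁ + A₂ * volume.real D) + 1 with hA₃
  have hA₃p : 0 < A₃ := by positivity
  refine ⟨A₃ + C₁ * (4 * M), by positivity, ?_⟩
  intro x₀ l hl hQ g hg
  obtain ⟨m, hm1, hm2⟩ := choose_m hl
  set ρ := 2 * d * l with hρ
  have hρ0 : 0 < ρ := by positivity
  have hlR := hG.side_le hl hQ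
  have hx₀ : x₀ ∈ D := hQ (center_mem x₀ hl)
  have hqd : q.totalDegree ≤ n := hq.totalDegree_le
  set P : Eu d → ℝ := fun x => pv q (x - x₀) with hP
  have hPm : P ∈ PolyLE d n := pv_center_mem hqd x₀
  have hPi := hG.intOn_cont (polyLE_continuous hPm)
  set f : Eu d → ℝ := fun x => P x + tsm q x₀ ρ m x with hf
  have hfs : ContDiff ℝ 1 f := (polyLE_contDiff hPm 1).add (by exact_mod_cast tsm_smooth q x₀ ρ m 1)
  have hfi := hG.intOn_cont hfs.continuous
  -- seminorm of f
  have hfL : LCamp n D f A₁ := by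
    intro z s hs hQs
    obtain ⟨R, hR, hRb⟩ := tsm_approx hd hn hq hM x₀ z hρ0 hs m
    refine ⟨_, polyLE_add hPm hR, ?_⟩
    refine (lint_bound (B := A₁ * s ^ n) (measurableSet_cube z s) (isCompact_cube z s).measure_lt_top.ne (by positivity) fun x hx => ?_).trans ?_
    · have e : f x - (P x + R x) = tsm q x₀ ρ m x - R x := by rw [hf]; ring
      rw [e]; exact hRb x hx
    · rw [volume_real_cube _ hs.le]
  have hfsem := lcamp_seminorm hA₁p.le hfL
  have hfl1 : l1Norm D f ≤ ENNReal.ofReal (A₂ * volume.real D) := by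
    refine lint_bound hG.opn.measurableSet hG.vol_lt.ne hA₂p.le fun x hx => ?_
    have h1 := hM.q_le (x - x₀)
    have h2 := tsm_bound hn hq hM x₀ hρ0 m x
    have h3 : ‖x - x₀‖ ≤ Rd := hG.diam x hx x₀ hx₀
    have h4 : M * ‖x - x₀‖ ^ n ≤ M * Rd ^ n := mul_le_mul_of_nonneg_left (pow_le_pow_left₀ (norm_nonneg _) h3 n) hMp.le
    have h5 : 2 ^ m * ρ ≤ 2 * d * (2 * Rd + 1) := by
      calc 2 ^ m * ρ = 2 * d * (2 ^ m * l) := by rw [hρ]; ring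
        _ ≤ _ := mul_le_mul_of_nonneg_left (by linarith) (by positivity)
    have h6 : M * (2 ^ m * ρ) ^ n ≤ M * (2 * d * (2 * Rd + 1)) ^ n :=
      mul_le_mul_of_nonneg_left (pow_le_pow_left₀ (by positivity) h5 n) hMp.le
    calc |f x| ≤ |P x| + |tsm q x₀ ρ m x| := abs_add_le _ _
      _ ≤ _ := add_le_add (h1.trans h4) (h2.trans h6)
  obtain ⟨gf, hgf⟩ := restr_exists hd hK hG.opn hfi hfs
  have hgfm := restr_meas hK hG.opn hfi hgf
  have hgm := restr_meas hK hG.opn hPi hg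
  have hH := (H f gf hfi.locallyIntegrableOn (lt_of_le_of_lt hfsem ENNReal.ofReal_lt_top)
    (lt_of_le_of_lt hfl1 ENNReal.ofReal_lt_top) hgf).2
  have hsem : zygSeminorm (fun t => t ^ n) n D gf < ENNReal.ofReal A₃ := by
    calc _ ≤ _ := le_self_add
      _ ≤ _ := hH
      _ ≤ ENNReal.ofReal C' * (ENNReal.ofReal A₁ + ENNReal.ofReal (A₂ * volume.real D)) :=
          mul_le_mul_right (add_le_add hfsem hfl1) _
      _ = ENNReal.ofReal (C' * (A₁ + A₂ * volume.real D)) := by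
          rw [← ENNReal.ofReal_add (by positivity) (by positivity), ← ENNReal.ofReal_mul hC'.le]
      _ < _ := (ENNReal.ofReal_lt_ofReal_iff hA₃p).2 (by linarith)
  have q1 : QA n gf x₀ l A₃ := seminorm_lcamp hsem x₀ l hl hQ
  -- the difference
  have hu := Lim.lin hK hG.opn hfi hPi hgf.2 hg.2 1 (-((m : ℝ) + 1))
  have eu : ∀ x, 1 * f x + -((m : ℝ) + 1) * P x = tsm q x₀ ρ m x - m * pv q (x - x₀) := by
    intro x; rw [hf, hP]; ring
  have hui : IntegrableOn (fun x => 1 * f x + -((m : ℝ) + 1) * P x) D := (hfi.const_mul 1).add (hPi.const_mul _)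
  have hz : ∀ x, ‖x - x₀‖ ≤ ρ → 1 * f x + -((m : ℝ) + 1) * P x = 0 := fun x hx => by
    rw [eu]; exact tsm_zero q x₀ hρ0 m hx
  have hzc : ∀ x ∈ cube x₀ l, 1 * f x + -((m : ℝ) + 1) * P x = 0 := fun x hx => by
    refine hz x ((norm_sub_le_of_mem_cube hl.le hx).trans ?_)
    rw [hρ]; nlinarith
  have q2 : QA n (fun x => 1 * gf x + -((m : ℝ) + 1) * g x) x₀ l (C₁ * (4 * M)) := by
    obtain ⟨S, hS, hSb, -⟩ := h₁ hG.opn hl hQ hui (B := 4 * M) (by positivity)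
      (ae_of_all _ fun x hx => by rw [hz x hx.le, abs_zero]; positivity)
      (ae_of_all _ fun x hx => by
        rw [eu]
        refine (tsm_diff hM x₀ hρ0 m x).trans ?_
        refine mul_le_mul_of_nonneg_left (Real.sqrt_le_sqrt ?_) (by positivity)
        refine div_le_div_of_nonneg_left (norm_nonneg _) hl ?_
        rw [hρ]; nlinarith)
      (by
        filter_upwards [ae_restrict_mem (measurableSet_cube x₀ l)] with y hy
        refine ⟨by rw [hzc y hy, abs_zero]; positivity, ?_⟩
        filter_upwards [ae_restrict_mem (measurableSet_cube x₀ l)] with x hx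
        rw [hzc y hy, hzc x hx, sub_zero, abs_zero]; positivity)
      (ae_restrict_of_ae_restrict_of_subset hQ hu)
    exact ⟨S, hS, hSb⟩
  have hm0 : (0 : ℝ) < (m : ℝ) + 1 := by positivity
  have q3 := QA.lin hl hA₃p.le (by positivity) (hgfm.mono_set hQ) q1 q2 (1 / ((m : ℝ) + 1)) (-(1 / ((m : ℝ) + 1)))
  have e3 : (fun x => 1 / ((m : ℝ) + 1) * gf x + -(1 / ((m : ℝ) + 1)) * (1 * gf x + -((m : ℝ) + 1) * g x)) = g := by
    funext x; field_simp; ring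
  rw [e3] at q3
  refine q3.mono hl ?_
  rw [abs_neg, abs_of_pos (by positivity), ← mul_add, one_div_mul_eq_div]
  exact div_le_div_of_nonneg_left (by positivity) (lt_of_lt_of_le one_pos (le_max_left _ _)) hm1

def eH {d n : ℕ} (a : MI d n) : MvPolynomial (Fin d) ℝ :=
  if (miF a).degree = n then MvPolynomial.monomial (miF a) 1 else 0

lemma eH_hom {d n : ℕ} (a : MI d n) : (eH a).IsHomogeneous n := by
  unfold eH
  split_ifs with h
  · exact MvPolynomial.isHomogeneous_monomial _ h
  · exact MvPolynomial.isHomogeneous_zero _ _ _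

lemma pv_eH {d n : ℕ} {p : MvPolynomial (Fin d) ℝ} (hp : p.IsHomogeneous n) (w : Eu d) :
    pv p w = ∑ a : MI d n, p.coeff (miF a) * pv (eH a) w := by
  conv_lhs => rw [← toPoly_coeff hp.totalDegree_le, toPoly, pv_sum]
  refine Finset.sum_congr rfl fun a _ => ?_
  unfold eH
  split_ifs with h
  · unfold pv
    rw [MvPolynomial.eval_monomial, MvPolynomial.eval_monomial, one_mul]
  · have h1 : p.coeff (miF a) = 0 := hp.coeff_eq_zero h
    simp [h1, pv]

lemma forward_i {d n : ℕ} {D : Set (Eu d)} {c r0 Rd : ℝ} (hG : Geo D c r0 Rd)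
    {K : Eu d → ℝ} {C' : ℝ}
    (H : ∀ f g : Eu d → ℝ,
        LocallyIntegrableOn f D → zygSeminorm (fun t => t ^ n) n D f < ⊤ →
        l1Norm D f < ⊤ → IsRestrictedCZ D K f g →
        LocallyIntegrableOn g D ∧
          zygSeminorm (fun t => t ^ n) n D g + l1Norm D g ≤
            ENNReal.ofReal C' * (zygSeminorm (fun t => t ^ n) n D f + l1Norm D f))
    {P : Eu d → ℝ} (hP : P ∈ PolyLE d n) {g : Eu d → ℝ} (hg : IsRestrictedCZ D K P g) :
    LocallyIntegrableOn g D ∧ zygSeminorm (fun t => t ^ n) n D g < ⊤ := by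
  have hPi := hG.intOn_cont (polyLE_continuous hP)
  have h1 : zygSeminorm (fun t => t ^ n) n D P < ⊤ := by
    refine lt_of_le_of_lt (lcamp_seminorm (A := 0) le_rfl fun z s _ _ => ⟨P, hP, ?_⟩) ENNReal.ofReal_lt_top
    simp
  have h2 : l1Norm D P < ⊤ := by
    unfold l1Norm
    rw [lint_eq hPi]; exact ENNReal.ofReal_lt_top
  have h3 := H P g hPi.locallyIntegrableOn h1 h2 hg
  refine ⟨h3.1, lt_of_le_of_lt (le_self_add.trans h3.2) ?_⟩
  exact ENNReal.mul_lt_top ENNReal.ofReal_lt_top (ENNReal.add_lt_top.2 ⟨h1, h2⟩)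

set_option maxHeartbeats 1600000 in
lemma forward_ii {d n : ℕ} (hn : 0 < n) {D : Set (Eu d)} {c r0 Rd : ℝ} (hG : Geo D c r0 Rd) (hne : D.Nonempty)
    {K : Eu d → ℝ} {CK : ℝ} (hK : Ker d n K CK) {C' : ℝ} (hC' : 0 < C')
    (H : ∀ f g : Eu d → ℝ,
        LocallyIntegrableOn f D → zygSeminorm (fun t => t ^ n) n D f < ⊤ →
        l1Norm D f < ⊤ → IsRestrictedCZ D K f g →
        LocallyIntegrableOn g D ∧
          zygSeminorm (fun t => t ^ n) n D g + l1Norm D g ≤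
            ENNReal.ofReal C' * (zygSeminorm (fun t => t ^ n) n D f + l1Norm D f)) :
    ∃ C : ℝ, 0 < C ∧
      ∀ (x₀ : EuclideanSpace ℝ (Fin d)) (l : ℝ), 0 < l → cube x₀ l ⊆ D →
        ∀ P : EuclideanSpace ℝ (Fin d) → ℝ,
          (∃ p : MvPolynomial (Fin d) ℝ, p.IsHomogeneous n ∧
            ∀ x, P x = MvPolynomial.eval (fun i => x i - x₀ i) p) →
          ∀ g : EuclideanSpace ℝ (Fin d) → ℝ, IsRestrictedCZ D K P g →
            ∃ S ∈ PolyLE d n,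
              (ENNReal.ofReal (l ^ d))⁻¹ *
                  ∫⁻ x in cube x₀ l, ENNReal.ofReal |g x - S x| ≤
                ENNReal.ofReal (C * sSup ((fun x => |P x|) '' D) *
                  (l ^ n / max 1 (Real.log (1 / l)))) := by
  have hd := hG.dpos
  have hRp := hG.Rpos
  obtain ⟨hr0, hc0, hc1, hcone⟩ := hG.cones
  set s₀ := c * r0 with hs₀d
  have hs₀ : 0 < s₀ := by positivity
  obtain ⟨z₀, hz₀⟩ : ∃ z₀ : Eu d, cube z₀ s₀ ⊆ D := by
    obtain ⟨x, hx⟩ := hne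
    obtain ⟨e, he⟩ := hcone x hx
    have hcn := he x hx (by simp; exact hr0.le)
    exact ⟨_, hcn.sub r0 hr0 le_rfl⟩
  have hz₀D : z₀ ∈ D := hz₀ (center_mem z₀ hs₀)
  choose A hA hAb using fun a : MI d n => mono_part hn hG hK hC' H (eH_hom a)
  obtain ⟨C₁, hC₁, h₁⟩ := coeff_bound d n
  obtain ⟨C₂, hC₂, h₂⟩ := poly_hc d n (Rd / s₀) (by positivity)
  set C₃ := C₁ * (C₂ * (d / s₀) ^ n) with hC₃
  have hC₃p : 0 < C₃ := by positivity
  refine ⟨C₃ * (∑ a, A a) + 1, by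
    have : 0 ≤ ∑ a, A a := Finset.sum_nonneg fun a _ => (hA a).le
    positivity, ?_⟩
  rintro x₀ l hl hQ P ⟨p, hp, hPp⟩ g hg
  have hx₀ : x₀ ∈ D := hQ (center_mem x₀ hl)
  have hPe : P = fun x => pv p (x - x₀) := by
    funext x; rw [hPp]; rfl
  have hpd := hp.totalDegree_le
  have hPm : P ∈ PolyLE d n := by rw [hPe]; exact pv_center_mem hpd x₀
  have hbdd : BddAbove ((fun x => |P x|) '' D) := by
    have hcp := (isCompact_closedBall x₀ Rd).bddAbove_image (polyLE_continuous hPm).abs.continuousOn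
    refine hcp.mono (image_mono fun x hx => ?_)
    rw [mem_closedBall, dist_eq_norm]; exact hG.diam x hx x₀ hx₀
  set N := sSup ((fun x => |P x|) '' D) with hN
  have hPN : ∀ x ∈ D, |P x| ≤ N := fun x hx => le_csSup hbdd ⟨x, hx, rfl⟩
  have hN0 : 0 ≤ N := (abs_nonneg _).trans (hPN x₀ hx₀)
  have hav : av z₀ s₀ (fun x => pv p (x - x₀)) ≤ N := by
    rw [← hPe]; exact av_le_of_bound hs₀ fun x hx => hPN x (hz₀ hx)
  have hhc : hc n p = p := (MvPolynomial.homogeneousComponent_of_mem hp).trans (if_pos rfl)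
  have hcoef : ∀ a : MI d n, |p.coeff (miF a)| ≤ C₃ * N := by
    intro a
    have h3 : av (0 : Eu d) 1 (pv p) ≤ C₂ * (d / s₀) ^ n * N := by
      refine av_le_of_bound one_pos fun w hw => ?_
      have h4 := h₂ x₀ z₀ s₀ hs₀ (by rw [div_mul_cancel₀ _ hs₀.ne']; exact hG.diam z₀ hz₀D x₀ hx₀) p hpd n w
      rw [hhc] at h4
      have h5 := norm_sub_le_of_mem_cube one_pos.le hw
      rw [sub_zero] at h5
      have h6 : ‖w‖ / s₀ ≤ d / s₀ := by
        refine div_le_div_of_nonneg_right (h5.trans ?_) hs₀.le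
        linarith [(Nat.cast_nonneg d : (0 : ℝ) ≤ d)]
      refine h4.trans (mul_le_mul (mul_le_mul_of_nonneg_left (pow_le_pow_left₀ (by positivity) h6 n) hC₂.le) hav
        (av_nonneg _ hs₀ _) (by positivity))
    have h7 := h₁ p hpd a
    unfold av at h3
    rw [one_pow, inv_one, one_mul] at h3
    calc _ ≤ _ := h7
      _ ≤ C₁ * (C₂ * (d / s₀) ^ n * N) := mul_le_mul_of_nonneg_left h3 hC₁.le
      _ = _ := by rw [hC₃]; ring
  have hmi : ∀ a : MI d n, (fun x => pv (eH a) (x - x₀)) ∈ PolyLE d n := fun a => pv_center_mem (eH_hom a).totalDegree_le x₀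
  have hmI := fun a : MI d n => hG.intOn_cont (polyLE_continuous (hmi a))
  choose G hGr using fun a : MI d n => restr_exists hd hK hG.opn (hmI a) (polyLE_contDiff (hmi a) 1)
  set L := max 1 (Real.log (1 / l)) with hL
  have hLp : 0 < L := lt_of_lt_of_le one_pos (le_max_left _ _)
  have q1 := QA.sum (n := n) hl Finset.univ (fun a : MI d n => p.coeff (miF a)) (fun a => A a / L)
    (fun a => by have := hA a; positivity) G
    (fun a => (restr_meas hK hG.opn (hmI a) (hGr a)).mono_set hQ) (fun a => hAb a x₀ l hl hQ (G a) (hGr a))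
  have e1 := Lim.sum hK hG.opn Finset.univ (fun a : MI d n => p.coeff (miF a)) _ G hmI (fun a => (hGr a).2)
  have e2 : (fun x => ∑ a : MI d n, p.coeff (miF a) * pv (eH a) (x - x₀)) = P := by
    rw [hPe]; funext x; exact (pv_eH hp _).symm
  rw [e2] at e1
  have q2 := QA.congr hQ q1 (Lim.unique e1 hg.2)
  have hsum : ∑ a : MI d n, |p.coeff (miF a)| * (A a / L) ≤ (C₃ * (∑ a, A a) + 1) * N / L := by
    calc _ ≤ ∑ a : MI d n, C₃ * N * (A a / L) := Finset.sum_le_sum fun a _ =>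
          mul_le_mul_of_nonneg_right (hcoef a) (by have := hA a; positivity)
      _ = (C₃ * (∑ a, A a)) * N / L := by rw [← Finset.mul_sum, ← Finset.sum_div]; ring
      _ ≤ _ := by
          refine div_le_div_of_nonneg_right (mul_le_mul_of_nonneg_right (by linarith) hN0) hLp.le
  obtain ⟨S, hS, hSb⟩ := q2.mono hl hsum
  refine ⟨S, hS, ?_⟩
  have hld : 0 < l ^ d := by positivity
  calc _ ≤ (ENNReal.ofReal (l ^ d))⁻¹ * _ := mul_le_mul_right hSb _
    _ = _ := by
      rw [← ENNReal.ofReal_inv_of_pos hld, ← ENNReal.ofReal_mul (by positivity)]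
      congr 1; field_simp

lemma zero_dim {D : Set (Eu 0)} {K f g : Eu 0 → ℝ} (hg : IsRestrictedCZ D K f g) :
    g =ᵐ[volume.restrict D] fun _ => 0 := by
  filter_upwards [hg.2] with y hy
  refine tendsto_nhds_unique hy (tendsto_const_nhds.congr' ?_)
  filter_upwards [self_mem_nhdsWithin] with ε hε
  have : {x ∈ D | ε < dist y x} = ∅ := by
    ext x
    have e : x = y := Subsingleton.elim _ _
    have hε' : (0 : ℝ) < ε := hε
    simp [e, hε'.le]
  rw [this]; simp

lemma zero_lint {D S : Set (Eu 0)} {K f g : Eu 0 → ℝ} (hg : IsRestrictedCZ D K f g) (hS : S ⊆ D) :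
    ∫⁻ x in S, ENNReal.ofReal |g x| = 0 := by
  rw [lintegral_congr_ae (g := fun _ => 0)]
  · simp
  · filter_upwards [ae_restrict_of_ae_restrict_of_subset hS (zero_dim hg)] with x hx
    rw [hx]; simp

lemma zero_semi {n : ℕ} {D : Set (Eu 0)} {K f g : Eu 0 → ℝ} (hg : IsRestrictedCZ D K f g) :
    LocallyIntegrableOn g D ∧ zygSeminorm (fun t => t ^ n) n D g = 0 ∧ l1Norm D g = 0 := by
  refine ⟨?_, ?_, zero_lint hg subset_rfl⟩
  · have h : IntegrableOn g D := (integrable_zero _ _ _).congr (zero_dim hg).symm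
    exact h.locallyIntegrableOn
  · have := lcamp_seminorm (n := n) (D := D) (g := g) (A := 0) le_rfl fun z s _ hQ =>
      ⟨fun _ => 0, polyLE_const 0, by simpa using zero_lint hg hQ⟩
    simpa using this
/-- **T(P) theorem for the classical Zygmund spaces `𝒵_n(D)`**, i.e. for
`ω_n(t) = t^n`, in which case `ω̃_n(ℓ) = ℓ^n / max{1, log(1/ℓ)}`. -/
theorem statement_2 {d : ℕ} (n : ℕ) (hn : 0 < n)
    (D : Set (EuclideanSpace ℝ (Fin d))) (hD : IsLipschitzDomain D)
    (Ω K : EuclideanSpace ℝ (Fin d) → ℝ)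
    (hΩ : IsCZDensity d ((n : ℕ∞) + 1) Ω)
    (hK : K = fun x => Ω x / ‖x‖ ^ d) :
    (∃ C' : ℝ, 0 < C' ∧
      ∀ f g : EuclideanSpace ℝ (Fin d) → ℝ,
        LocallyIntegrableOn f D → zygSeminorm (fun t => t ^ n) n D f < ⊤ →
        l1Norm D f < ⊤ → IsRestrictedCZ D K f g →
        LocallyIntegrableOn g D ∧
          zygSeminorm (fun t => t ^ n) n D g + l1Norm D g ≤
            ENNReal.ofReal C' * (zygSeminorm (fun t => t ^ n) n D f + l1Norm D f)) ↔
    ((∀ P ∈ PolyLE d n, ∀ g : EuclideanSpace ℝ (Fin d) → ℝ,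
      IsRestrictedCZ D K P g →
        LocallyIntegrableOn g D ∧ zygSeminorm (fun t => t ^ n) n D g < ⊤) ∧
    (∃ C : ℝ, 0 < C ∧
      ∀ (x₀ : EuclideanSpace ℝ (Fin d)) (l : ℝ), 0 < l → cube x₀ l ⊆ D →
        ∀ P : EuclideanSpace ℝ (Fin d) → ℝ,
          (∃ p : MvPolynomial (Fin d) ℝ, p.IsHomogeneous n ∧
            ∀ x, P x = MvPolynomial.eval (fun i => x i - x₀ i) p) →
          ∀ g : EuclideanSpace ℝ (Fin d) → ℝ, IsRestrictedCZ D K P g →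
            ∃ S ∈ PolyLE d n,
              (ENNReal.ofReal (l ^ d))⁻¹ *
                  ∫⁻ x in cube x₀ l, ENNReal.ofReal |g x - S x| ≤
                ENNReal.ofReal (C * sSup ((fun x => |P x|) '' D) *
                  (l ^ n / max 1 (Real.log (1 / l)))))) := by
  rcases Nat.eq_zero_or_pos d with h0 | hd
  · subst h0
    refine ⟨fun _ => ⟨?_, 1, one_pos, ?_⟩, fun _ => ⟨1, one_pos, ?_⟩⟩
    · intro P _ g hg
      have h := zero_semi (n := n) hg
      exact ⟨h.1, by rw [h.2.1]; simp⟩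
    · intro x₀ l hl hQ P _ g hg
      refine ⟨fun _ => 0, polyLE_const 0, ?_⟩
      have e : ∫⁻ x in cube x₀ l, ENNReal.ofReal |g x - 0| = 0 := by simpa using zero_lint hg hQ
      rw [e, mul_zero]
      exact bot_le
    · intro f g _ _ _ hg
      have h := zero_semi (n := n) hg
      refine ⟨h.1, ?_⟩
      rw [h.2.1, h.2.2, add_zero]
      exact bot_le
  · obtain ⟨c, r0, hcones⟩ := lipschitz_cones hd hD
    obtain ⟨hopen, hconn, hbdd, -⟩ := hD
    obtain ⟨Rd, hRd⟩ := Metric.isBounded_iff.1 hbdd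
    have hG : Geo D c r0 (|Rd| + 1) := ⟨hd, hopen, hcones, by positivity, fun x hx y hy => by
      rw [← dist_eq_norm]; linarith [hRd hx hy, le_abs_self Rd]⟩
    obtain ⟨CK, hCK⟩ := ker_of (n := n) hd hΩ hK
    constructor
    · rintro ⟨C', hC', H⟩
      exact ⟨fun P hP g hg => forward_i hG H hP hg, forward_ii hn hG hconn.nonempty hCK hC' H⟩
    · rintro ⟨hi, C, hC, hii⟩
      exact backward hn hG hconn.nonempty hCK hi hC hii
end
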